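/- Assume p₁ is a quadratic residue modulo p₂. If π₁ is not a square in the residue field ℤ[i]/(π₃), then Cl₂(K₄) is isomorphic to ℤ/2ℤ × ℤ/2ℤ × ℤ/2ℤ; if π₁ is a square in ℤ[i]/(π₃), then Cl₂(K₄) is isomorphic to ℤ/2ℤ × ℤ/4ℤ. -/

import Mathlib

open NumberField IntermediateField

set_option linter.unusedSectionVars false

section GaussianResidue

/-- The primes congruent to `5` modulo `8`, written as a sum `e ^ 2 + 4 * f ^ 2`. -/
structure SumSq (p : ℕ) (e f : ℤ) : Prop where
  prime : p.Prime
  mod_eight : p % 8 = 5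
  eq : (p : ℤ) = e ^ 2 + 4 * f ^ 2

namespace SumSq

variable {p : ℕ} {e f : ℤ}

theorem neg (H : SumSq p e f) : SumSq p e (-f) := ⟨H.prime, H.mod_eight, by rw [H.eq]; ring⟩

theorem odd_left (H : SumSq p e f) : e % 2 = 1 := by
  have h1 := H.eq
  have h2 := H.mod_eight
  rcases Int.even_or_odd' e with ⟨k, rfl | rfl⟩
  · have : (p : ℤ) = 2 * (2 * k ^ 2 + 2 * f ^ 2) := by rw [h1]; ring
    omega
  · omega

theorem sq_mod_eight_of_odd {a : ℤ} (ha : a % 2 = 1) : a ^ 2 % 8 = 1 := by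
  have h : a % 8 = 1 ∨ a % 8 = 3 ∨ a % 8 = 5 ∨ a % 8 = 7 := by omega
  rcases h with h | h | h | h <;> simp [pow_two, Int.mul_emod, h]

theorem odd_right (H : SumSq p e f) : f % 2 = 1 := by
  have h1 := H.eq
  have h2 := H.mod_eight
  have h3 := Int.sq_mod_four_eq_one_of_odd (Int.odd_iff.2 H.odd_left)
  rcases Int.even_or_odd' f with ⟨k, rfl | rfl⟩
  · have h4 : e ^ 2 % 8 = 1 := sq_mod_eight_of_odd H.odd_left
    have : (p : ℤ) = e ^ 2 + 8 * (2 * k ^ 2) := by rw [h1]; ring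
    omega
  · omega

theorem not_dvd_two (H : SumSq p e f) : ¬ (p : ℤ) ∣ 2 := by
  intro h
  have := Int.le_of_dvd (by norm_num) h
  have := H.mod_eight
  omega

theorem intPrime (H : SumSq p e f) : Prime (p : ℤ) := Nat.prime_iff_prime_int.1 H.prime

theorem not_dvd_right (H : SumSq p e f) : ¬ (p : ℤ) ∣ f := by
  intro h
  have h1 : (p : ℤ) ∣ e ^ 2 := by
    have : e ^ 2 = p - 4 * f * f := by rw [H.eq]; ring
    rw [this]
    exact dvd_sub dvd_rfl (h.mul_left _)
  have h2 := H.intPrime.dvd_of_dvd_pow h1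
  obtain ⟨a, ha⟩ := h
  obtain ⟨b, hb⟩ := h2
  have h3 := H.eq
  have h4 : (p : ℤ) * (p * (b ^ 2 + 4 * a ^ 2)) = p * 1 := by rw [mul_one]; nth_rw 3 [h3]; rw [ha, hb]; ring
  have h5 := mul_left_cancel₀ H.intPrime.ne_zero h4
  exact H.intPrime.not_isUnit (IsUnit.of_mul_eq_one _ h5)

theorem not_dvd_left (H : SumSq p e f) : ¬ (p : ℤ) ∣ e := by
  intro h
  have h1 : (p : ℤ) ∣ 2 * (2 * f ^ 2) := by
    have : 2 * (2 * f ^ 2) = p - e * e := by rw [H.eq]; ring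
    rw [this]
    exact dvd_sub dvd_rfl (h.mul_left _)
  rcases H.intPrime.dvd_or_dvd h1 with h2 | h2
  · exact H.not_dvd_two h2
  rcases H.intPrime.dvd_or_dvd h2 with h2 | h2
  · exact H.not_dvd_two h2
  · exact H.not_dvd_right (H.intPrime.dvd_of_dvd_pow h2)

theorem not_dvd_two_mul (H : SumSq p e f) : ¬ (p : ℤ) ∣ 2 * f := fun h =>
  (H.intPrime.dvd_or_dvd h).elim H.not_dvd_two H.not_dvd_right

theorem dvd_iff (H : SumSq p e f) (x y : ℤ) :
    (⟨e, 2 * f⟩ : GaussianInt) ∣ ⟨x, y⟩ ↔ (p : ℤ) ∣ 2 * f * x - e * y := by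
  constructor
  · rintro ⟨⟨u, v⟩, h⟩
    rw [Zsqrtd.ext_iff] at h
    simp only [Zsqrtd.re_mul, Zsqrtd.im_mul] at h
    refine ⟨-v, ?_⟩
    rw [h.1, h.2, H.eq]
    ring
  · rintro ⟨k, hk⟩
    have h1 : (p : ℤ) ∣ 2 * f * (x * e + 2 * f * y) := by
      refine ⟨e * k + y, ?_⟩
      have h2 := H.eq
      linear_combination e * hk - y * h2
    obtain ⟨u, hu⟩ := (H.intPrime.dvd_or_dvd h1).resolve_left H.not_dvd_two_mul
    refine ⟨⟨u, -k⟩, ?_⟩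
    have h0 := H.intPrime.ne_zero
    rw [Zsqrtd.ext_iff]
    simp only [Zsqrtd.re_mul, Zsqrtd.im_mul]
    constructor
    · apply mul_left_cancel₀ h0
      have : (p : ℤ) * (e * u + -1 * (2 * f) * -k) = e * (p * u) + 2 * f * (p * k) := by ring
      rw [this, ← hu, ← hk, H.eq]
      ring
    · apply mul_left_cancel₀ h0
      have : (p : ℤ) * (e * -k + 2 * f * u) = - e * (p * k) + 2 * f * (p * u) := by ring
      rw [this, ← hu, ← hk, H.eq]
      ring

theorem prime_gaussian (H : SumSq p e f) : Prime (⟨e, 2 * f⟩ : GaussianInt) := by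
  refine ⟨?_, ?_, ?_⟩
  · intro h
    rw [Zsqrtd.ext_iff] at h
    have h1 : e = 0 := h.1
    have := H.odd_left
    omega
  · intro h
    have h1 : (⟨e, 2 * f⟩ : GaussianInt) ∣ ⟨1, 0⟩ := h.dvd
    rw [H.dvd_iff] at h1
    simp only [mul_one, mul_zero, sub_zero] at h1
    exact H.not_dvd_two_mul h1
  · rintro ⟨x, y⟩ ⟨u, v⟩ h
    rw [H.dvd_iff, H.dvd_iff]
    have h1 : (p : ℤ) ∣ 2 * f * (x * u + -1 * y * v) - e * (x * v + y * u) := (H.dvd_iff _ _).1 h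
    apply H.intPrime.dvd_or_dvd
    have h2 : (2 * f * x - e * y) * (2 * f * u - e * v) =
      2 * f * (2 * f * (x * u + -1 * y * v) - e * (x * v + y * u)) + p * (y * v) := by
      rw [H.eq]; ring
    rw [h2]
    exact dvd_add (h1.mul_left _) (dvd_mul_right _ _)

end SumSq

open Classical in
/-- The additive quadratic residue symbol: `0` if `x` is congruent to the square of an integer
modulo `q`, and `1` otherwise. -/
noncomputable def resid (q x : GaussianInt) : ZMod 2 :=
  if ∃ r : ℤ, q ∣ ⟨r ^ 2, 0⟩ - x then 0 else 1

theorem resid_eq_zero_iff {q x : GaussianInt} : resid q x = 0 ↔ ∃ r : ℤ, q ∣ ⟨r ^ 2, 0⟩ - x := by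
  unfold resid
  split_ifs with h <;> simp [h]

namespace SumSq

variable {p : ℕ} {e f : ℤ}

theorem legendreSym_two [Fact p.Prime] (H : SumSq p e f) : legendreSym p 2 = -1 := by
  have := H.mod_eight
  rw [legendreSym.at_two (by omega), ZMod.χ₈_nat_mod_eight, this]
  rfl

theorem legendreSym_neg [Fact p.Prime] (H : SumSq p e f) (a : ℤ) :
    legendreSym p (-a) = legendreSym p a := by
  have := H.mod_eight
  rw [legendreSym.at_neg (by omega), ZMod.χ₄_nat_one_mod_four (by omega), one_mul]

theorem legendreSym_odd [Fact p.Prime] (H : SumSq p e f) {a : ℤ} (ha : a % 2 = 1) :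
    legendreSym p a = jacobiSym p a.natAbs := by
  have := H.mod_eight
  have h1 : legendreSym p a = legendreSym p (a.natAbs : ℤ) := by
    rcases Int.natAbs_eq a with h | h
    · rw [← h]
    · nth_rw 1 [h]; rw [H.legendreSym_neg]
  rw [h1, jacobiSym.legendreSym.to_jacobiSym]
  have hodd : Odd a.natAbs := by rw [Int.natAbs_odd, Int.odd_iff]; exact ha
  rw [jacobiSym.quadratic_reciprocity_one_mod_four' hodd (by omega)]

theorem legendreSym_eq_one_of_jacobi [Fact p.Prime] (H : SumSq p e f) {a : ℤ} (ha : a % 2 = 1)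
    (hp : ¬ (p : ℤ) ∣ a) {X c : ℤ} (h : a ∣ p - c * X ^ 2) :
    legendreSym p a = jacobiSym c a.natAbs := by
  have hne : legendreSym p a ≠ 0 := by
    rw [Ne, legendreSym.eq_zero_iff, ZMod.intCast_zmod_eq_zero_iff_dvd]; exact hp
  rw [H.legendreSym_odd ha] at hne ⊢
  have h1 : jacobiSym p a.natAbs = jacobiSym (c * X ^ 2) a.natAbs := by
    apply jacobiSym.mod_left'
    apply Int.emod_emod_of_dvd _ dvd_rfl |>.symm.trans
    rw [Int.emod_emod_of_dvd _ dvd_rfl]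
    rw [Int.emod_eq_emod_iff_emod_sub_eq_zero]
    exact Int.emod_eq_zero_of_dvd (Int.natAbs_dvd.2 h)
  rw [h1] at hne ⊢
  rw [jacobiSym.mul_left] at hne ⊢
  rw [jacobiSym.pow_left] at hne ⊢
  rcases jacobiSym.trichotomy X a.natAbs with h | h | h <;> simp_all

theorem legendreSym_right [Fact p.Prime] (H : SumSq p e f) : legendreSym p f = 1 := by
  rw [H.legendreSym_eq_one_of_jacobi H.odd_right H.not_dvd_right (X := e) (c := 1),
    jacobiSym.one_left]
  exact ⟨4 * f, by rw [H.eq]; ring⟩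

theorem legendreSym_left [Fact p.Prime] (H : SumSq p e f) : legendreSym p e = 1 := by
  rw [H.legendreSym_eq_one_of_jacobi H.odd_left H.not_dvd_left (X := 2 * f) (c := 1),
    jacobiSym.one_left]
  exact ⟨e, by rw [H.eq]; ring⟩

theorem legendreSym_two_mul_right [Fact p.Prime] (H : SumSq p e f) :
    legendreSym p (2 * f) = -1 := by
  rw [legendreSym.mul, H.legendreSym_two, H.legendreSym_right]; rfl

theorem resid_eq_zero_iff [Fact p.Prime] (H : SumSq p e f) {x y : ℤ}
    (hxy : ¬ (⟨e, 2 * f⟩ : GaussianInt) ∣ ⟨x, y⟩) :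
    resid ⟨e, 2 * f⟩ ⟨x, y⟩ = 0 ↔ legendreSym p (2 * f * x - e * y) = -1 := by
  have hl : ((2 * f * x - e * y : ℤ) : ZMod p) ≠ 0 := by
    rw [Ne, ZMod.intCast_zmod_eq_zero_iff_dvd, ← H.dvd_iff]; exact hxy
  have h2f : ((2 * f : ℤ) : ZMod p) ≠ 0 := by
    rw [Ne, ZMod.intCast_zmod_eq_zero_iff_dvd]; exact H.not_dvd_two_mul
  have key : legendreSym p (2 * f * x - e * y) = -1 ↔
      legendreSym p ((2 * f) * (2 * f * x - e * y)) = 1 := by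
    rw [legendreSym.mul p (2 * f), H.legendreSym_two_mul_right]
    constructor <;> intro h <;> linarith
  have hm : (((2 * f) * (2 * f * x - e * y) : ℤ) : ZMod p) ≠ 0 := by
    rw [Int.cast_mul]; exact mul_ne_zero h2f hl
  rw [_root_.resid_eq_zero_iff, key, legendreSym.eq_one_iff p hm]
  have hd : ∀ r : ℤ, (⟨e, 2 * f⟩ : GaussianInt) ∣ ⟨r ^ 2, 0⟩ - ⟨x, y⟩ ↔
      ((2 * f : ℤ) : ZMod p) * (r : ZMod p) ^ 2 = ((2 * f * x - e * y : ℤ) : ZMod p) := by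
    intro r
    have h3 : (⟨r ^ 2, 0⟩ - ⟨x, y⟩ : GaussianInt) = ⟨r ^ 2 - x, 0 - y⟩ := rfl
    rw [h3, H.dvd_iff, ← ZMod.intCast_zmod_eq_zero_iff_dvd, ← sub_eq_zero (b := ((_ : ℤ) : ZMod p))]
    push_cast
    constructor <;> intro h <;> linear_combination h
  constructor
  · rintro ⟨r, hr⟩
    rw [hd] at hr
    exact ⟨((2 * f : ℤ) : ZMod p) * r, by rw [Int.cast_mul, ← hr]; ring⟩
  · rintro ⟨s, hs⟩
    obtain ⟨r, hr⟩ := ZMod.intCast_surjective (s / ((2 * f : ℤ) : ZMod p))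
    refine ⟨r, (hd r).2 ?_⟩
    rw [hr]
    apply mul_left_cancel₀ h2f
    rw [Int.cast_mul] at hs
    rw [hs]
    field_simp

theorem legendreSym_eq [Fact p.Prime] (H : SumSq p e f) {x y : ℤ}
    (hxy : ¬ (⟨e, 2 * f⟩ : GaussianInt) ∣ ⟨x, y⟩) :
    legendreSym p (2 * f * x - e * y) = if resid ⟨e, 2 * f⟩ ⟨x, y⟩ = 0 then -1 else 1 := by
  have hl : ((2 * f * x - e * y : ℤ) : ZMod p) ≠ 0 := by
    rw [Ne, ZMod.intCast_zmod_eq_zero_iff_dvd, ← H.dvd_iff]; exact hxy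
  split_ifs with h
  · exact (H.resid_eq_zero_iff hxy).1 h
  · rcases legendreSym.eq_one_or_neg_one p hl with h1 | h1
    · exact h1
    · exact absurd ((H.resid_eq_zero_iff hxy).2 h1) h

theorem resid_mul (H : SumSq p e f) {z w : GaussianInt}
    (hz : ¬ (⟨e, 2 * f⟩ : GaussianInt) ∣ z) (hw : ¬ (⟨e, 2 * f⟩ : GaussianInt) ∣ w) :
    resid ⟨e, 2 * f⟩ (z * w) = resid ⟨e, 2 * f⟩ z + resid ⟨e, 2 * f⟩ w := by
  have : Fact p.Prime := ⟨H.prime⟩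
  have hzw : ¬ (⟨e, 2 * f⟩ : GaussianInt) ∣ z * w := fun h =>
    (H.prime_gaussian.dvd_or_dvd h).elim hz hw
  obtain ⟨x, y⟩ := z
  obtain ⟨u, v⟩ := w
  have h1 := H.legendreSym_eq hz
  have h2 := H.legendreSym_eq hw
  have h3 := H.legendreSym_eq (x := x * u + -1 * y * v) (y := x * v + y * u) hzw
  have h4 : legendreSym p (2 * f) * legendreSym p
      (2 * f * (x * u + -1 * y * v) - e * (x * v + y * u)) =
      legendreSym p (2 * f * x - e * y) * legendreSym p (2 * f * u - e * v) := by
    rw [← legendreSym.mul, ← legendreSym.mul, legendreSym.mod, legendreSym.mod p (_ * _)]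
    congr 1
    rw [Int.emod_eq_emod_iff_emod_sub_eq_zero]
    apply Int.emod_eq_zero_of_dvd
    refine ⟨- (y * v), ?_⟩
    rw [H.eq]
    ring
  rw [H.legendreSym_two_mul_right, h1, h2, h3] at h4
  have h5 : (⟨x * u + -1 * y * v, x * v + y * u⟩ : GaussianInt) = ⟨x, y⟩ * ⟨u, v⟩ := rfl
  rw [h5] at h4
  generalize resid ⟨e, 2 * f⟩ (⟨x, y⟩ * ⟨u, v⟩) = c at *
  generalize resid ⟨e, 2 * f⟩ ⟨x, y⟩ = a at *
  generalize resid ⟨e, 2 * f⟩ ⟨u, v⟩ = b at *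
  clear h1 h2 h3 h5
  revert a b c
  decide

end SumSq
end GaussianResidue

section GaussianResidue
namespace SumSq

variable {p q : ℕ} {e f g h : ℤ}

theorem resid_eq_of_legendreSym [Fact p.Prime] (H : SumSq p e f) {x y : ℤ}
    (hxy : legendreSym p (2 * f * x - e * y) ≠ 0) :
    resid ⟨e, 2 * f⟩ ⟨x, y⟩ = if legendreSym p (2 * f * x - e * y) = -1 then 0 else 1 := by
  have h0 : ¬ (⟨e, 2 * f⟩ : GaussianInt) ∣ ⟨x, y⟩ := by
    rw [H.dvd_iff, ← ZMod.intCast_zmod_eq_zero_iff_dvd, ← legendreSym.eq_zero_iff]; exact hxy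
  have h1 := H.legendreSym_eq h0
  have h2 : resid ⟨e, 2 * f⟩ ⟨x, y⟩ = 0 ∨ resid ⟨e, 2 * f⟩ ⟨x, y⟩ = 1 := by
    generalize resid ⟨e, 2 * f⟩ ⟨x, y⟩ = a
    revert a; decide
  rcases h2 with h2 | h2 <;> rw [h2] at h1 <;> rw [h1, h2] <;> simp

theorem resid_I (H : SumSq p e f) : resid ⟨e, 2 * f⟩ ⟨0, 1⟩ = 1 := by
  have : Fact p.Prime := ⟨H.prime⟩
  have h1 : legendreSym p (2 * f * 0 - e * 1) = 1 := by
    rw [show 2 * f * 0 - e * 1 = - e by ring, H.legendreSym_neg, H.legendreSym_left]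
  rw [H.resid_eq_of_legendreSym] <;> rw [h1] <;> decide

theorem resid_conj (H : SumSq p e f) : resid ⟨e, 2 * f⟩ ⟨e, 2 * -f⟩ = 1 := by
  have : Fact p.Prime := ⟨H.prime⟩
  have h1 : legendreSym p (2 * f * e - e * (2 * -f)) = 1 := by
    rw [show 2 * f * e - e * (2 * -f) = 2 * (2 * f) * e by ring, legendreSym.mul,
      legendreSym.mul, H.legendreSym_two, H.legendreSym_two_mul_right, H.legendreSym_left]
    rfl
  rw [H.resid_eq_of_legendreSym] <;> rw [h1] <;> decide

theorem resid_one_add_I (H : SumSq p e f) :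
    resid ⟨e, 2 * f⟩ ⟨1, 1⟩ = if (2 * f - e) % 8 = 1 ∨ (2 * f - e) % 8 = 7 then 1 else 0 := by
  have : Fact p.Prime := ⟨H.prime⟩
  have he := H.odd_left
  have hodd : (2 * f - e) % 2 = 1 := by omega
  have hnd : ¬ (p : ℤ) ∣ 2 * f - e := by
    intro hd
    have h1 : (p : ℤ) ∣ 2 * f * (2 * (2 * f)) := by
      have : 2 * f * (2 * (2 * f)) = p + (2 * f - e) * (2 * f + e) := by rw [H.eq]; ring
      rw [this]
      exact dvd_add dvd_rfl (hd.mul_right _)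
    rcases H.intPrime.dvd_or_dvd h1 with h2 | h2
    · exact H.not_dvd_two_mul h2
    · rcases H.intPrime.dvd_or_dvd h2 with h2 | h2
      · exact H.not_dvd_two h2
      · exact H.not_dvd_two_mul h2
  have h1 : legendreSym p (2 * f * 1 - e * 1) =
      if (2 * f - e) % 8 = 1 ∨ (2 * f - e) % 8 = 7 then 1 else -1 := by
    rw [mul_one, mul_one, H.legendreSym_eq_one_of_jacobi hodd hnd (c := 2) (X := 2 * f),
      jacobiSym.at_two (by rw [Int.natAbs_odd, Int.odd_iff]; exact hodd),
      ZMod.χ₈_nat_eq_if_mod_eight]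
    · have e1 : (2 * f - e).natAbs % 2 = 1 := by omega
      rw [if_neg (by omega)]
      congr 1
      rw [eq_iff_iff]
      omega
    · exact ⟨-(2 * f + e), by rw [H.eq]; ring⟩
  rw [H.resid_eq_of_legendreSym] <;> rw [h1] <;> split_ifs <;> simp_all

theorem resid_one_add_I_neg (H : SumSq p e f) :
    resid ⟨e, 2 * -f⟩ ⟨1, 1⟩ = resid ⟨e, 2 * f⟩ ⟨1, 1⟩ + 1 := by
  rw [H.resid_one_add_I, H.neg.resid_one_add_I]
  have h1 := H.odd_left
  have h2 := H.odd_right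
  split_ifs <;> first | rfl | omega

theorem not_dvd (H : SumSq p e f) (H' : SumSq q g h) (hne : p ≠ q) :
    ¬ (⟨e, 2 * f⟩ : GaussianInt) ∣ ⟨g, 2 * h⟩ := by
  intro hd
  have h1 := map_dvd (Zsqrtd.normMonoidHom (d := -1)) hd
  have e1 : Zsqrtd.normMonoidHom (d := -1) ⟨e, 2 * f⟩ = p := by
    rw [H.eq]; change e * e - -1 * (2 * f) * (2 * f) = _; ring
  have e2 : Zsqrtd.normMonoidHom (d := -1) ⟨g, 2 * h⟩ = q := by
    rw [H'.eq]; change g * g - -1 * (2 * h) * (2 * h) = _; ring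
  rw [e1, e2, Int.natCast_dvd_natCast, Nat.prime_dvd_prime_iff_eq H.prime H'.prime] at h1
  exact hne h1

theorem legendreSym_cross_ne_zero [Fact p.Prime] (H : SumSq p e f) (H' : SumSq q g h)
    (hne : p ≠ q) : legendreSym p (f * g - e * h) ≠ 0 := by
  have h1 := H.not_dvd H' hne
  rw [H.dvd_iff] at h1
  rw [Ne, legendreSym.eq_zero_iff, ZMod.intCast_zmod_eq_zero_iff_dvd]
  intro h2
  apply h1
  rw [show 2 * f * g - e * (2 * h) = 2 * (f * g - e * h) by ring]
  exact h2.mul_left _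

theorem resid_cross [Fact p.Prime] (H : SumSq p e f) (H' : SumSq q g h) (hne : p ≠ q) :
    resid ⟨e, 2 * f⟩ ⟨g, 2 * h⟩ = if legendreSym p (f * g - e * h) = 1 then 0 else 1 := by
  have h0 := H.legendreSym_cross_ne_zero H' hne
  have h1 : legendreSym p (2 * f * g - e * (2 * h)) = - legendreSym p (f * g - e * h) := by
    rw [show 2 * f * g - e * (2 * h) = 2 * (f * g - e * h) by ring, legendreSym.mul,
      H.legendreSym_two, neg_one_mul]
  rw [H.resid_eq_of_legendreSym (by rw [h1]; exact neg_ne_zero.2 h0), h1]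
  congr 1
  rw [neg_inj]

theorem resid_cross_neg_left (H : SumSq p e f) (H' : SumSq q g h) (hne : p ≠ q) :
    resid ⟨e, 2 * -f⟩ ⟨g, 2 * h⟩ = resid ⟨e, 2 * f⟩ ⟨g, 2 * -h⟩ := by
  have : Fact p.Prime := ⟨H.prime⟩
  rw [H.neg.resid_cross H' hne, H.resid_cross H'.neg hne]
  rw [← H.legendreSym_neg (-f * g - e * h)]
  congr 3
  ring

theorem resid_cross_neg_right (H : SumSq p e f) (H' : SumSq q g h) (hne : p ≠ q)
    (hpq : IsSquare (q : ZMod p)) :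
    resid ⟨e, 2 * f⟩ ⟨g, 2 * -h⟩ = resid ⟨e, 2 * f⟩ ⟨g, 2 * h⟩ := by
  have : Fact p.Prime := ⟨H.prime⟩
  rw [H.resid_cross H'.neg hne, H.resid_cross H' hne]
  have h1 := H.legendreSym_cross_ne_zero H' hne
  have h2 := H.legendreSym_cross_ne_zero H'.neg hne
  have hq : ((q : ℤ) : ZMod p) ≠ 0 := by
    rw [Int.cast_natCast, Ne, ZMod.natCast_eq_zero_iff,
      Nat.prime_dvd_prime_iff_eq H.prime H'.prime]
    exact hne
  have h3 : legendreSym p ((f * g - e * h) * (f * g - e * -h)) = 1 := by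
    have h4 : legendreSym p (2 * f) * legendreSym p (2 * f) *
        legendreSym p ((f * g - e * h) * (f * g - e * -h)) =
        legendreSym p (f * f * e * e) * legendreSym p q := by
      rw [← legendreSym.mul, ← legendreSym.mul, ← legendreSym.mul,
        ← H.legendreSym_neg (f * f * e * e * q), legendreSym.mod, legendreSym.mod p (- _)]
      congr 1
      rw [Int.emod_eq_emod_iff_emod_sub_eq_zero]
      apply Int.emod_eq_zero_of_dvd
      refine ⟨f ^ 2 * g ^ 2, ?_⟩
      have h5 := H.eq
      have h6 := H'.eq
      linear_combination f * f * e * e * h6 - f ^ 2 * g ^ 2 * h5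
    rw [H.legendreSym_two_mul_right, (legendreSym.eq_one_iff p hq).2 (by simpa using hpq),
      legendreSym.mul p (f * f * e), legendreSym.mul p (f * f), legendreSym.mul p f, H.legendreSym_left,
      H.legendreSym_right] at h4
    simpa using h4
  rw [legendreSym.mul] at h3
  have h5 := Int.eq_one_or_neg_one_of_mul_eq_one' h3
  rcases h5 with h5 | h5 <;> rw [h5.1, h5.2]

theorem legendreSym_cross_symm [Fact p.Prime] [Fact q.Prime] (H : SumSq p e f)
    (H' : SumSq q g h) (hne : p ≠ q) :
    legendreSym p (f * g - e * h) = legendreSym q (f * g - e * h) := by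
  have h1 := H.legendreSym_cross_ne_zero H' hne
  have h2 := H'.legendreSym_cross_ne_zero H hne.symm
  rw [show h * e - g * f = -(f * g - e * h) by ring, H'.legendreSym_neg] at h2
  have hid : (p : ℤ) * q = (e * g + 4 * f * h) ^ 2 + 4 * (f * g - e * h) ^ 2 := by
    rw [H.eq, H'.eq]; ring
  generalize f * g - e * h = m at *
  generalize e * g + 4 * f * h = X at *
  have hm0 : m ≠ 0 := by
    rintro rfl
    rw [Ne, legendreSym.at_zero] at h1
    exact h1 rfl
  have : ∃ (k : ℕ) (n : ℤ), n % 2 = 1 ∧ m = 2 ^ k * n := by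
    obtain ⟨k, n, hn, hk⟩ := Nat.exists_eq_two_pow_mul_odd (n := m.natAbs) (by omega)
    rw [Nat.odd_iff] at hn
    rcases Int.natAbs_eq m with hm | hm
    · exact ⟨k, n, by omega, by rw [hm, hk]; push_cast; ring⟩
    · exact ⟨k, -n, by omega, by rw [hm, hk]; push_cast; ring⟩
  obtain ⟨k, n, hn, rfl⟩ := this
  have hpow : ∀ (r : ℕ) [Fact r.Prime], legendreSym r (2 ^ k) = legendreSym r 2 ^ k := by
    intro r _
    rw [jacobiSym.legendreSym.to_jacobiSym, jacobiSym.pow_left, jacobiSym.legendreSym.to_jacobiSym]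
  rw [legendreSym.mul, legendreSym.mul, hpow, hpow, H.legendreSym_two, H'.legendreSym_two]
  rw [legendreSym.mul] at h1 h2
  have h1' := right_ne_zero_of_mul h1
  have h2' := right_ne_zero_of_mul h2
  congr 1
  rw [H.legendreSym_odd hn] at h1' ⊢
  rw [H'.legendreSym_odd hn] at h2' ⊢
  have h3 : jacobiSym p n.natAbs * jacobiSym q n.natAbs = jacobiSym (X ^ 2) n.natAbs := by
    rw [← jacobiSym.mul_left, hid]
    apply jacobiSym.mod_left'
    rw [Int.emod_eq_emod_iff_emod_sub_eq_zero]
    apply Int.emod_eq_zero_of_dvd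
    rw [Int.natAbs_dvd]
    exact ⟨4 * 2 ^ k * 2 ^ k * n, by ring⟩
  rw [jacobiSym.pow_left] at h3
  rcases jacobiSym.trichotomy p n.natAbs with h | h | h <;>
  rcases jacobiSym.trichotomy q n.natAbs with h' | h' | h' <;>
  rcases jacobiSym.trichotomy X n.natAbs with h'' | h'' | h'' <;>
  rw [h, h', h''] at h3 <;> simp_all

theorem resid_cross_symm (H : SumSq p e f) (H' : SumSq q g h) (hne : p ≠ q) :
    resid ⟨g, 2 * h⟩ ⟨e, 2 * f⟩ = resid ⟨e, 2 * f⟩ ⟨g, 2 * h⟩ := by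
  have : Fact p.Prime := ⟨H.prime⟩
  have : Fact q.Prime := ⟨H'.prime⟩
  rw [H.resid_cross H' hne, H'.resid_cross H hne.symm, H.legendreSym_cross_symm H' hne,
    show h * e - g * f = -(f * g - e * h) by ring, H'.legendreSym_neg]

end SumSq
end GaussianResidue

section GaussianResidue

/-- Four pairwise coprime Gaussian primes together with a table of their residue symbols. -/
structure PrimeData (q : Fin 4 → GaussianInt) (a t u : ZMod 2) : Prop where
  prime : ∀ j, Prime (q j)
  not_dvd_two : ∀ j, ¬ q j ∣ 2
  not_dvd : ∀ j k, j ≠ k → ¬ q j ∣ q k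
  resid_mul : ∀ j z w, ¬ q j ∣ z → ¬ q j ∣ w → resid (q j) (z * w) = resid (q j) z + resid (q j) w
  resid_I : ∀ j, resid (q j) ⟨0, 1⟩ = 1
  resid_one_add_I : ∀ j, resid (q j) ⟨1, 1⟩ = ![t, t + 1, u, u + 1] j
  resid_prime : ∀ j k, j ≠ k →
    resid (q j) (q k) = ![![0, 1, a, a], ![1, 0, a, a], ![a, a, 0, 1], ![a, a, 1, 0]] j k
  mod_four_mul : 4 ∣ q 0 * q 2 - 1 ∨ 4 ∣ q 0 * q 2 + 1
  mod_four_mul' : 4 ∣ q 1 * q 3 - 1 ∨ 4 ∣ q 1 * q 3 + 1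
  mod_four : 4 ∣ q 0 - ⟨1, 2⟩ ∨ 4 ∣ q 0 + ⟨1, 2⟩
  exists_sq : t = u → ∃ s, 16 ∣ s ^ 2 - q 0 * q 2

theorem gaussian_dvd_of_int {n : ℤ} {z : GaussianInt} (h1 : n ∣ z.re) (h2 : n ∣ z.im) :
    (n : GaussianInt) ∣ z := Zsqrtd.intCast_dvd n z |>.2 ⟨h1, h2⟩

theorem exists_sq_mod_sixteen (A B : ℤ) (hB : B % 4 = 0)
    (hAB : (A - B) % 8 = 1 ∨ (A - B) % 8 = 7) :
    ∃ s : GaussianInt, 16 ∣ s ^ 2 - ⟨A, B⟩ := by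
  have key : ∀ a b : Fin 16, b.val % 4 = 0 →
      ((a.val + 16 - b.val) % 8 = 1 ∨ (a.val + 16 - b.val) % 8 = 7) →
      ∃ x y : Fin 8, (x.val * x.val + 64 - y.val * y.val) % 16 = a.val ∧
        (2 * (x.val * y.val)) % 16 = b.val := by decide +kernel
  obtain ⟨x, y, h1, h2⟩ := key ⟨(A % 16).toNat, by omega⟩ ⟨(B % 16).toNat, by omega⟩
    (by simp only; omega) (by simp only; omega)
  simp only at h1 h2
  refine ⟨⟨x, y⟩, ?_⟩
  have h := gaussian_dvd_of_int (n := 16) (z := (⟨x, y⟩ : GaussianInt) ^ 2 - ⟨A, B⟩) ?_ ?_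
  · simpa using h
  · rw [pow_two]
    simp only [Zsqrtd.re_sub, Zsqrtd.re_mul]
    have hy : y.val * y.val ≤ 49 := by nlinarith [y.isLt]
    zify [show y.val * y.val ≤ x.val * x.val + 64 by omega] at h1
    have := Int.toNat_of_nonneg (a := A % 16) (by omega)
    have e1 : ((x : ℕ) : ℤ) * (x : ℕ) + -1 * (y : ℕ) * (y : ℕ) = (x : ℕ) * (x : ℕ) - (y : ℕ) * (y : ℕ) := by ring
    rw [e1]
    omega
  · rw [pow_two]
    simp only [Zsqrtd.im_sub, Zsqrtd.im_mul]
    zify at h2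
    have e1 : ((x : ℕ) : ℤ) * (y : ℕ) + (y : ℕ) * (x : ℕ) = 2 * ((x : ℕ) * (y : ℕ)) := by ring
    rw [e1]
    omega

variable {p₁ p₂ : ℕ} {e f g h : ℤ}

theorem SumSq.mod_four_mul {p₁ p₂ : ℕ} {e f g h : ℤ} (H : SumSq p₁ e f) (H' : SumSq p₂ g h) :
    4 ∣ (⟨e, 2 * f⟩ * ⟨g, 2 * h⟩ - 1 : GaussianInt) ∨
      4 ∣ (⟨e, 2 * f⟩ * ⟨g, 2 * h⟩ + 1 : GaussianInt) := by
  have h1 := Int.emod_emod_of_dvd e (by norm_num : (2 : ℤ) ∣ 4)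
  have h2 := Int.emod_emod_of_dvd g (by norm_num : (2 : ℤ) ∣ 4)
  have he := H.odd_left
  have hf := H.odd_right
  have hg := H'.odd_left
  have hh := H'.odd_right
  obtain ⟨e', rfl⟩ : ∃ k, e = 2 * k + 1 := ⟨e / 2, by omega⟩
  obtain ⟨f', rfl⟩ : ∃ k, f = 2 * k + 1 := ⟨f / 2, by omega⟩
  obtain ⟨g', rfl⟩ : ∃ k, g = 2 * k + 1 := ⟨g / 2, by omega⟩
  obtain ⟨h', rfl⟩ : ∃ k, h = 2 * k + 1 := ⟨h / 2, by omega⟩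
  rcases Int.even_or_odd' (e' + g') with ⟨k, hk | hk⟩
  · left
    apply gaussian_dvd_of_int (n := 4)
    · obtain rfl : g' = 2 * k - e' := by omega
      exact ⟨e' * (2 * k - e') + k - (2 * f' + 1) * (2 * h' + 1), by
        change (2 * e' + 1) * (2 * (2 * k - e') + 1) +
          -1 * (2 * (2 * f' + 1)) * (2 * (2 * h' + 1)) - 1 = _
        ring⟩
    · exact ⟨(2 * e' + 1) * h' + e' + f' * (2 * g' + 1) + g' + 1, by
        change (2 * e' + 1) * (2 * (2 * h' + 1)) + (2 * (2 * f' + 1)) * (2 * g' + 1) - 0 = _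
        ring⟩
  · right
    apply gaussian_dvd_of_int (n := 4)
    · obtain rfl : g' = 2 * k + 1 - e' := by omega
      exact ⟨e' * (2 * k + 1 - e') + k - (2 * f' + 1) * (2 * h' + 1) + 1, by
        change (2 * e' + 1) * (2 * (2 * k + 1 - e') + 1) +
          -1 * (2 * (2 * f' + 1)) * (2 * (2 * h' + 1)) + 1 = _
        ring⟩
    · exact ⟨(2 * e' + 1) * h' + e' + f' * (2 * g' + 1) + g' + 1, by
        change (2 * e' + 1) * (2 * (2 * h' + 1)) + (2 * (2 * f' + 1)) * (2 * g' + 1) + 0 = _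
        ring⟩

theorem SumSq.mod_four {p : ℕ} {e f : ℤ} (H : SumSq p e f) :
    4 ∣ (⟨e, 2 * f⟩ - ⟨1, 2⟩ : GaussianInt) ∨ 4 ∣ (⟨e, 2 * f⟩ + ⟨1, 2⟩ : GaussianInt) := by
  have he := H.odd_left
  have hf := H.odd_right
  have : e % 4 = 1 ∨ e % 4 = 3 := by omega
  rcases this with h | h
  · left
    apply gaussian_dvd_of_int (n := 4)
    · change _ ∣ e - 1; omega
    · change _ ∣ 2 * f - 2; omega
  · right
    apply gaussian_dvd_of_int (n := 4)
    · change _ ∣ e + 1; omega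
    · change _ ∣ 2 * f + 2; omega

theorem SumSq.exists_sq {p₁ p₂ : ℕ} {e f g h : ℤ} (H : SumSq p₁ e f) (H' : SumSq p₂ g h)
    (ht : resid ⟨e, 2 * f⟩ ⟨1, 1⟩ = resid ⟨g, 2 * h⟩ ⟨1, 1⟩) :
    ∃ s : GaussianInt, 16 ∣ s ^ 2 - ⟨e, 2 * f⟩ * ⟨g, 2 * h⟩ := by
  have he := H.odd_left
  have hf := H.odd_right
  have hg := H'.odd_left
  have hh := H'.odd_right
  rw [H.resid_one_add_I, H'.resid_one_add_I] at ht
  have h1 : ((2 * f - e) * (2 * h - g)) % 8 = 1 ∨ ((2 * f - e) * (2 * h - g)) % 8 = 7 := by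
    rw [Int.mul_emod]
    have c1 : (2 * f - e) % 8 = 1 ∨ (2 * f - e) % 8 = 3 ∨ (2 * f - e) % 8 = 5 ∨
      (2 * f - e) % 8 = 7 := by omega
    have c2 : (2 * h - g) % 8 = 1 ∨ (2 * h - g) % 8 = 3 ∨ (2 * h - g) % 8 = 5 ∨
      (2 * h - g) % 8 = 7 := by omega
    rcases c1 with c1 | c1 | c1 | c1 <;> rcases c2 with c2 | c2 | c2 | c2 <;>
      simp [c1, c2] at ht ⊢
  refine exists_sq_mod_sixteen (e * g + -1 * (2 * f) * (2 * h)) (e * (2 * h) + 2 * f * g) ?_ ?_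
  · obtain ⟨e', rfl⟩ : ∃ k, e = 2 * k + 1 := ⟨e / 2, by omega⟩
    obtain ⟨f', rfl⟩ : ∃ k, f = 2 * k + 1 := ⟨f / 2, by omega⟩
    obtain ⟨g', rfl⟩ : ∃ k, g = 2 * k + 1 := ⟨g / 2, by omega⟩
    obtain ⟨h', rfl⟩ : ∃ k, h = 2 * k + 1 := ⟨h / 2, by omega⟩
    have : (2 * e' + 1) * (2 * (2 * h' + 1)) + 2 * (2 * f' + 1) * (2 * g' + 1) =
      4 * ((2 * e' + 1) * h' + e' + f' * (2 * g' + 1) + g' + 1) := by ring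
    rw [this]
    omega
  · have : e * g + -1 * (2 * f) * (2 * h) - (e * (2 * h) + 2 * f * g) =
      (2 * f - e) * (2 * h - g) - 8 * (f * h) := by ring
    rw [this]
    omega

theorem SumSq.primeData {p₁ p₂ : ℕ} {e f g h : ℤ} (H : SumSq p₁ e f) (H' : SumSq p₂ g h)
    (hne : p₁ ≠ p₂) (hQR : IsSquare (p₁ : ZMod p₂)) :
    PrimeData ![⟨e, 2 * f⟩, ⟨e, 2 * -f⟩, ⟨g, 2 * h⟩, ⟨g, 2 * -h⟩]
      (resid ⟨g, 2 * h⟩ ⟨e, 2 * f⟩) (resid ⟨e, 2 * f⟩ ⟨1, 1⟩) (resid ⟨g, 2 * h⟩ ⟨1, 1⟩) := by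
  have : Fact p₁.Prime := ⟨H.prime⟩
  have : Fact p₂.Prime := ⟨H'.prime⟩
  have hQR' : IsSquare (p₂ : ZMod p₁) := by
    have h1 := H.mod_eight
    have h2 := H'.mod_eight
    exact (ZMod.exists_sq_eq_prime_iff_of_mod_four_eq_one (by omega) (by omega)).1 hQR
  have c1 := H.resid_conj
  have c2 := H.neg.resid_conj
  have c3 := H'.resid_conj
  have c4 := H'.neg.resid_conj
  rw [neg_neg] at c2 c4
  have n12 := H.not_dvd H' hne
  have n21 := H'.not_dvd H hne.symm
  have hself : ∀ {p : ℕ} {e f : ℤ} (H : SumSq p e f),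
      ¬ (⟨e, 2 * f⟩ : GaussianInt) ∣ ⟨e, 2 * -f⟩ := by
    intro p e f H hd
    rw [H.dvd_iff] at hd
    have : 2 * f * e - e * (2 * -f) = 2 * f * (2 * e) := by ring
    rw [this] at hd
    rcases H.intPrime.dvd_or_dvd hd with h | h
    · exact H.not_dvd_two_mul h
    · rcases H.intPrime.dvd_or_dvd h with h | h
      · exact H.not_dvd_two h
      · exact H.not_dvd_left h
  have s1 := hself H
  have s2 := hself H.neg
  have s3 := hself H'
  have s4 := hself H'.neg
  rw [neg_neg] at s2 s4
  have h2 : ∀ {p : ℕ} {e f : ℤ} (H : SumSq p e f), ¬ (⟨e, 2 * f⟩ : GaussianInt) ∣ 2 := by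
    intro p e f H hd
    have h3 : (⟨e, 2 * f⟩ : GaussianInt) ∣ ⟨2, 0⟩ := hd
    rw [H.dvd_iff] at h3
    rw [show 2 * f * 2 - e * 0 = 2 * f * 2 by ring] at h3
    exact (H.intPrime.dvd_or_dvd h3).elim H.not_dvd_two_mul H.not_dvd_two
  have r := H.resid_cross_symm H' hne
  have r1 := H.resid_cross_neg_right H' hne hQR'
  have r2 := H.resid_cross_neg_left H' hne
  have r3 := H.neg.resid_cross_neg_right H' hne hQR'
  have r4 := H'.resid_cross_neg_right H hne.symm hQR
  have r5 := H'.resid_cross_neg_left H hne.symm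
  have r6 := H'.neg.resid_cross_neg_right H hne.symm hQR
  refine ⟨?_, ?_, ?_, ?_, ?_, ?_, ?_, H.mod_four_mul H', H.neg.mod_four_mul H'.neg, H.mod_four,
    H.exists_sq H'⟩
  · intro j
    fin_cases j
    exacts [H.prime_gaussian, H.neg.prime_gaussian, H'.prime_gaussian, H'.neg.prime_gaussian]
  · intro j
    fin_cases j
    exacts [h2 H, h2 H.neg, h2 H', h2 H'.neg]
  · intro j k hjk
    fin_cases j <;> fin_cases k <;> first | exact absurd rfl hjk | skip
    exacts [s1, n12, H.not_dvd H'.neg hne, s2, H.neg.not_dvd H' hne, H.neg.not_dvd H'.neg hne,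
      n21, H'.not_dvd H.neg hne.symm, s3, H'.neg.not_dvd H hne.symm,
      H'.neg.not_dvd H.neg hne.symm, s4]
  · intro j z w
    fin_cases j
    exacts [H.resid_mul, H.neg.resid_mul, H'.resid_mul, H'.neg.resid_mul]
  · intro j
    fin_cases j
    exacts [H.resid_I, H.neg.resid_I, H'.resid_I, H'.neg.resid_I]
  · intro j
    fin_cases j
    exacts [rfl, H.resid_one_add_I_neg, rfl, H'.resid_one_add_I_neg]
  · intro j k hjk
    fin_cases j <;> fin_cases k <;> first | exact absurd rfl hjk | skip
    exacts [c1, r.symm, r1.trans r.symm, c2, r2.trans (r1.trans r.symm),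
      r3.trans (r2.trans (r1.trans r.symm)), rfl, r4, c3, r5.trans r4, r6.trans (r5.trans r4), c4]

end GaussianResidue

section ExponentVectors

/-- The factors `i`, `1 + i` and four given primes. -/
def gaussGen (q : Fin 4 → GaussianInt) : Fin 6 → GaussianInt :=
  ![⟨0, 1⟩, ⟨1, 1⟩, q 0, q 1, q 2, q 3]

/-- The product of the factors in `gaussGen` with exponents given by a vector over `ZMod 2`. -/
def gaussProd (q : Fin 4 → GaussianInt) (v : Fin 6 → ZMod 2) : GaussianInt :=
  ∏ k, gaussGen q k ^ (v k).val

/-- The table of residue symbols of the factors, with zeros where they are undefined. -/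
def residTable (a t u : ZMod 2) : Fin 4 → Fin 6 → ZMod 2 :=
  ![![1, t, 0, 1, a, a], ![1, t + 1, 1, 0, a, a], ![1, u, a, a, 0, 1], ![1, u + 1, a, a, 1, 0]]

/-- The residue symbol of the prime-to-`q j` part of a product. -/
def residLin (a t u : ZMod 2) (j : Fin 4) (v : Fin 6 → ZMod 2) : ZMod 2 :=
  ∑ k, v k * residTable a t u j k

/-- The index in `gaussGen` of the prime `q j`. -/
def primeIdx : Fin 4 → Fin 6 := ![2, 3, 4, 5]

/-- The additive Hilbert symbol at `q j` of two products. -/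
def hilb (a t u : ZMod 2) (j : Fin 4) (v w : Fin 6 → ZMod 2) : ZMod 2 :=
  v (primeIdx j) * residLin a t u j w + w (primeIdx j) * residLin a t u j v

/-- The ternary quadratic form `x ^ 2 - d * y ^ 2 - n * z ^ 2`. -/
def ternary {R : Type*} [CommRing R] (d n : R) (x : Fin 3 → R) : R :=
  x 0 ^ 2 - d * x 1 ^ 2 - n * x 2 ^ 2

/-- The bilinear form associated with `ternary`. -/
def ternaryBil {R : Type*} [CommRing R] (d n : R) (x y : Fin 3 → R) : R :=
  x 0 * y 0 - d * (x 1 * y 1) - n * (x 2 * y 2)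

/-- Solvability of `x ^ 2 = d * y ^ 2 + n * z ^ 2` modulo `q ^ N`, with a solution primitive
at `q`. -/
def LocSol (q : GaussianInt) (N : ℕ) (d n : GaussianInt) : Prop :=
  ∃ y : Fin 3 → GaussianInt, (∃ i, ¬ q ∣ y i) ∧ q ^ N ∣ ternary d n y

theorem exists_primitive_int {ι : Type*} {q : GaussianInt} (hq : Prime q) (x : ι → GaussianInt)
    (i : ι) (hx : x i ≠ 0) :
    ∃ (k : ℕ) (y : ι → GaussianInt), (∀ j, x j = q ^ k * y j) ∧ ∃ j, ¬ q ∣ y j := by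
  obtain ⟨n, hn⟩ : ∃ n, ¬ q ^ n ∣ x i :=
    FiniteMultiplicity.of_not_isUnit hq.not_isUnit hx |>.exists_eq_pow_mul_and_not_dvd.elim
      fun c hc => ⟨multiplicity q (x i) + 1, fun h =>
        hc.2 (by
          rw [hc.1, pow_succ, ← hc.1] at h
          nth_rw 2 [hc.1] at h
          exact (mul_dvd_mul_iff_left (pow_ne_zero _ hq.ne_zero)).1 h)⟩
  clear hx
  induction n generalizing x with
  | zero => simp at hn
  | succ n ih =>
    by_cases hall : ∀ j, q ∣ x j
    · choose y hy using hall
      obtain ⟨k, z, hz, hz'⟩ := ih y (fun h => hn (by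
        rw [hy i, pow_succ']; exact mul_dvd_mul_left _ h))
      exact ⟨k + 1, z, fun j => by rw [hy j, hz j]; ring, hz'⟩
    · push Not at hall
      exact ⟨0, x, by simp, hall⟩

variable {F : Type*} [Field F] [Algebra GaussianInt F] [IsFractionRing GaussianInt F]

theorem exists_primitive {ι : Type*} [Finite ι] {q : GaussianInt} (hq : Prime q) (x : ι → F)
    (i : ι) (hx : x i ≠ 0) :
    ∃ (c : F) (y : ι → GaussianInt), c ≠ 0 ∧ (∀ j, algebraMap GaussianInt F (y j) = c * x j) ∧
      ∃ j, ¬ q ∣ y j := by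
  classical
  obtain ⟨_⟩ := nonempty_fintype ι
  obtain ⟨b, hb⟩ := IsLocalization.exist_integer_multiples (nonZeroDivisors GaussianInt)
    Finset.univ x
  choose z hz using fun j => hb j (Finset.mem_univ j)
  have hb0 : (b : GaussianInt) ≠ 0 := nonZeroDivisors.ne_zero b.2
  have hb1 : algebraMap GaussianInt F b ≠ 0 := by
    simpa using (map_ne_zero_iff _ (IsFractionRing.injective GaussianInt F)).2 hb0
  have hz' : ∀ j, algebraMap GaussianInt F (z j) = algebraMap GaussianInt F b * x j := by
    intro j; rw [hz j, Algebra.smul_def]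
  obtain ⟨k, y, hy, hy'⟩ := exists_primitive_int hq z i (by
    intro h
    have := hz' i
    rw [h, map_zero] at this
    exact mul_ne_zero hb1 hx this.symm)
  have hq1 : algebraMap GaussianInt F q ≠ 0 :=
    (map_ne_zero_iff _ (IsFractionRing.injective GaussianInt F)).2 hq.ne_zero
  refine ⟨(algebraMap GaussianInt F q ^ k)⁻¹ * algebraMap GaussianInt F b, y,
    mul_ne_zero (inv_ne_zero (pow_ne_zero _ hq1)) hb1, fun j => ?_, hy'⟩
  rw [mul_assoc, ← hz' j, hy j, map_mul, map_pow, inv_mul_cancel_left₀ (pow_ne_zero _ hq1)]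

theorem algebraMap_ternary (d n : GaussianInt) (y : Fin 3 → GaussianInt) :
    algebraMap GaussianInt F (ternary d n y) =
      ternary (algebraMap GaussianInt F d) (algebraMap GaussianInt F n)
        (fun i => algebraMap GaussianInt F (y i)) := by
  simp [ternary]

theorem algebraMap_ternaryBil (d n : GaussianInt) (y z : Fin 3 → GaussianInt) :
    algebraMap GaussianInt F (ternaryBil d n y z) =
      ternaryBil (algebraMap GaussianInt F d) (algebraMap GaussianInt F n)
        (fun i => algebraMap GaussianInt F (y i)) (fun i => algebraMap GaussianInt F (z i)) := by
  simp [ternaryBil]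

theorem locSol_of_ternary {q : GaussianInt} (hq : Prime q) (N : ℕ) {d n : GaussianInt}
    {x : Fin 3 → F} (i : Fin 3) (hx : x i ≠ 0)
    (h : ternary (algebraMap GaussianInt F d) (algebraMap GaussianInt F n) x = 0) :
    LocSol q N d n := by
  obtain ⟨c, y, hc, hy, hi⟩ := exists_primitive hq x i hx
  refine ⟨y, hi, ?_⟩
  have : ternary d n y = 0 := by
    apply IsFractionRing.injective GaussianInt F
    rw [algebraMap_ternary, map_zero]
    simp only [hy]
    unfold ternary at h ⊢
    linear_combination c ^ 2 * h
  rw [this]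
  exact dvd_zero _

/-- A solution of a ternary equation over `F(√m)`, written in coordinates, gives integral
coordinates primitive at a given prime. -/
theorem exists_primitive_pair {q : GaussianInt} (hq : Prime q) {d n m : GaussianInt}
    {x y : Fin 3 → F} (hne : ∃ i, x i ≠ 0 ∨ y i ≠ 0)
    (h1 : ternary (algebraMap GaussianInt F d) (algebraMap GaussianInt F n) x +
      algebraMap GaussianInt F m *
        ternary (algebraMap GaussianInt F d) (algebraMap GaussianInt F n) y = 0)
    (h2 : ternaryBil (algebraMap GaussianInt F d) (algebraMap GaussianInt F n) x y = 0) :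
    ∃ v w : Fin 3 → GaussianInt, (∃ i, ¬ q ∣ v i ∨ ¬ q ∣ w i) ∧
      ternary d n v + m * ternary d n w = 0 ∧ ternaryBil d n v w = 0 := by
  obtain ⟨j, hj⟩ : ∃ j, Sum.elim x y j ≠ 0 := by
    obtain ⟨i, hi | hi⟩ := hne
    exacts [⟨Sum.inl i, hi⟩, ⟨Sum.inr i, hi⟩]
  obtain ⟨c, z, hc, hz, j, hj⟩ := exists_primitive hq (Sum.elim x y) j hj
  have hz1 := fun i => hz (Sum.inl i)
  have hz2 := fun i => hz (Sum.inr i)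
  simp only [Sum.elim_inl, Sum.elim_inr] at hz1 hz2
  refine ⟨fun i => z (Sum.inl i), fun i => z (Sum.inr i), ?_, ?_, ?_⟩
  · rcases j with i | i
    exacts [⟨i, Or.inl hj⟩, ⟨i, Or.inr hj⟩]
  · apply IsFractionRing.injective GaussianInt F
    rw [map_add, map_mul, algebraMap_ternary, algebraMap_ternary, map_zero]
    simp only [hz1, hz2]
    unfold ternary at h1 ⊢
    linear_combination c ^ 2 * h1
  · apply IsFractionRing.injective GaussianInt F
    rw [algebraMap_ternaryBil, map_zero]
    simp only [hz1, hz2]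
    unfold ternaryBil at h2 ⊢
    linear_combination c ^ 2 * h2

theorem ternary_add_mul {R : Type*} [CommRing R] {d n m s : R} {v w : Fin 3 → R}
    (h1 : ternary d n v + m * ternary d n w = 0) (h2 : ternaryBil d n v w = 0) :
    ternary d n (fun i => v i + s * w i) = (s ^ 2 - m) * ternary d n w := by
  unfold ternary at *
  unfold ternaryBil at h2
  linear_combination h1 + 2 * s * h2

theorem isCoprime_of_prime {q x : GaussianInt} (hq : Prime q) (hx : ¬ q ∣ x) :
    IsCoprime q x := hq.irreducible.coprime_iff_not_dvd.2 hx

theorem exists_sq_lift {q m s : GaussianInt} (hq : Prime q) (h2 : ¬ q ∣ 2) (hs : ¬ q ∣ s)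
    (h : q ∣ s ^ 2 - m) : ∃ s', ¬ q ∣ s' ∧ q ^ 2 ∣ s' ^ 2 - m := by
  obtain ⟨k, hk⟩ := h
  obtain ⟨a, b, hab⟩ := isCoprime_of_prime hq (x := 2 * s)
    (fun hd => (hq.dvd_or_dvd hd).elim h2 hs)
  refine ⟨s - q * (b * k), fun hd => hs ?_, ?_⟩
  · have := dvd_add hd (dvd_mul_right q (b * k))
    simpa using this
  · refine ⟨b ^ 2 * k ^ 2 + a * k, ?_⟩
    linear_combination hk - q * k * hab

theorem locSol_of_pair {q : GaussianInt} (hq : Prime q) (hq2 : ¬ q ∣ 2) {d n m s : GaussianInt}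
    (hm : ¬ q ∣ m) (hs : q ∣ s ^ 2 - m) {v w : Fin 3 → GaussianInt}
    (hvw : ∃ i, ¬ q ∣ v i ∨ ¬ q ∣ w i)
    (h1 : ternary d n v + m * ternary d n w = 0) (h2 : ternaryBil d n v w = 0) :
    LocSol q 2 d n := by
  have hs0 : ¬ q ∣ s := fun h => hm (by
    have h3 : q ∣ s ^ 2 := dvd_pow h two_ne_zero
    have := dvd_sub h3 hs
    simpa using this)
  obtain ⟨r, hr0, hr⟩ := exists_sq_lift hq hq2 hs0 hs
  by_cases hc : ∀ i, q ∣ v i + r * w i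
  · by_cases hc' : ∀ i, q ∣ v i + (-r) * w i
    · exfalso
      obtain ⟨i, hi⟩ := hvw
      have a1 : q ∣ 2 * v i := by
        have := dvd_add (hc i) (hc' i)
        rwa [show v i + r * w i + (v i + -r * w i) = 2 * v i by ring] at this
      have a2 : q ∣ 2 * (r * w i) := by
        have := dvd_sub (hc i) (hc' i)
        rwa [show v i + r * w i - (v i + -r * w i) = 2 * (r * w i) by ring] at this
      rcases hi with hi | hi
      · exact (hq.dvd_or_dvd a1).elim hq2 hi
      · exact (hq.dvd_or_dvd a2).elim hq2 fun h => (hq.dvd_or_dvd h).elim hr0 hi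
    · push Not at hc'
      refine ⟨_, hc', ?_⟩
      rw [ternary_add_mul h1 h2, neg_sq]
      exact hr.mul_right _
  · push Not at hc
    refine ⟨_, hc, ?_⟩
    rw [ternary_add_mul h1 h2]
    exact hr.mul_right _

end ExponentVectors

section LocalConditions

theorem gaussian_dvd_int_iff {n : ℤ} {z : GaussianInt} :
    (n : GaussianInt) ∣ z ↔ n ∣ z.re ∧ n ∣ z.im := Zsqrtd.intCast_dvd n z

theorem four_dvd_iff {z : GaussianInt} : 4 ∣ z ↔ 4 ∣ z.re ∧ 4 ∣ z.im :=
  gaussian_dvd_int_iff (n := 4)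

theorem one_add_I_dvd_iff {z : GaussianInt} :
    (⟨1, 1⟩ : GaussianInt) ∣ z ↔ (z.re + z.im) % 2 = 0 := by
  constructor
  · rintro ⟨w, rfl⟩
    simp only [Zsqrtd.re_mul, Zsqrtd.im_mul]
    omega
  · intro h
    obtain ⟨x, y⟩ := z
    simp only at h
    obtain ⟨k, hk⟩ : ∃ k, x + y = 2 * k := ⟨(x + y) / 2, by omega⟩
    refine ⟨⟨k, k - x⟩, ?_⟩
    rw [Zsqrtd.ext_iff]
    simp only [Zsqrtd.re_mul, Zsqrtd.im_mul]
    constructor <;> linarith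

theorem one_add_I_prime : Prime (⟨1, 1⟩ : GaussianInt) := by
  refine ⟨?_, ?_, ?_⟩
  · intro h
    rw [Zsqrtd.ext_iff] at h
    simp at h
  · intro h
    have := one_add_I_dvd_iff.1 (h.dvd : (⟨1, 1⟩ : GaussianInt) ∣ ⟨1, 0⟩)
    simp at this
  · rintro ⟨x, y⟩ ⟨u, v⟩
    simp only [one_add_I_dvd_iff, Zsqrtd.re_mul, Zsqrtd.im_mul]
    intro h
    have h1 : (x + y) * (u + v) % 2 = 0 := by
      have : (x + y) * (u + v) = x * u + -1 * y * v + (x * v + y * u) + 2 * (y * v) := by ring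
      omega
    rcases Int.even_or_odd' (x + y) with ⟨a, ha | ha⟩
    · left; omega
    · right
      rw [ha] at h1
      have : (2 * a + 1) * (u + v) = 2 * (a * (u + v)) + (u + v) := by ring
      omega

/-- The possible residues of squares of Gaussian integers modulo `4`. -/
def gaussSq : Fin 4 → GaussianInt := ![⟨1, 0⟩, ⟨-1, 0⟩, ⟨0, 0⟩, ⟨0, 2⟩]

theorem sq_mod_four (z : GaussianInt) :
    ∃ k : Fin 4, 4 ∣ z ^ 2 - gaussSq k ∧ (1 < k → (⟨1, 1⟩ : GaussianInt) ∣ z) := by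
  obtain ⟨x, y⟩ := z
  rw [pow_two]
  rcases Int.even_or_odd' x with ⟨a, rfl | rfl⟩ <;> rcases Int.even_or_odd' y with ⟨b, rfl | rfl⟩
  · refine ⟨2, ?_, fun _ => by rw [one_add_I_dvd_iff]; simp only; omega⟩
    rw [four_dvd_iff]
    exact ⟨⟨a * a - b * b, by simp only [gaussSq, Matrix.cons_val, Zsqrtd.re_sub, Zsqrtd.re_mul]; ring⟩,
      ⟨2 * a * b, by simp only [gaussSq, Matrix.cons_val, Zsqrtd.im_sub, Zsqrtd.im_mul]; ring⟩⟩
  · refine ⟨1, ?_, fun h => absurd h (by decide)⟩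
    rw [four_dvd_iff]
    exact ⟨⟨a * a - b * b - b, by simp only [gaussSq, Matrix.cons_val, Zsqrtd.re_sub, Zsqrtd.re_mul]; ring⟩,
      ⟨a * (2 * b + 1), by simp only [gaussSq, Matrix.cons_val, Zsqrtd.im_sub, Zsqrtd.im_mul]; ring⟩⟩
  · refine ⟨0, ?_, fun h => absurd h (by decide)⟩
    rw [four_dvd_iff]
    exact ⟨⟨a * a - b * b + a, by simp only [gaussSq, Matrix.cons_val, Zsqrtd.re_sub, Zsqrtd.re_mul]; ring⟩,
      ⟨b * (2 * a + 1), by simp only [gaussSq, Matrix.cons_val, Zsqrtd.im_sub, Zsqrtd.im_mul]; ring⟩⟩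
  · refine ⟨3, ?_, fun _ => by rw [one_add_I_dvd_iff]; simp only; omega⟩
    rw [four_dvd_iff]
    exact ⟨⟨a * a - b * b + a - b, by simp only [gaussSq, Matrix.cons_val, Zsqrtd.re_sub, Zsqrtd.re_mul]; ring⟩,
      ⟨2 * a * b + a + b, by simp only [gaussSq, Matrix.cons_val, Zsqrtd.im_sub, Zsqrtd.im_mul]; ring⟩⟩

/-- Representatives modulo `4` of the coefficients occurring in `not_locSol_one_add_I`. -/
def gaussUnit : Fin 4 → GaussianInt := ![1, ⟨0, 1⟩, -1, ⟨0, -1⟩]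

theorem not_four_dvd : ∀ (x y z : Fin 4) (a : Fin 4) (b : Fin 4), a = 1 ∨ a = 3 →
    (4 ∣ (gaussSq x - gaussUnit a * gaussSq y - gaussUnit b * ⟨1, 2⟩ * gaussSq z).re ∧
    4 ∣ (gaussSq x - gaussUnit a * gaussSq y - gaussUnit b * ⟨1, 2⟩ * gaussSq z).im) →
    1 < x ∧ 1 < y ∧ 1 < z := by decide +kernel

theorem not_ternary_mod_four {d n : GaussianInt} {a b : Fin 4} (ha : a = 1 ∨ a = 3)
    (hd : 4 ∣ d - gaussUnit a) (hn : 4 ∣ n - gaussUnit b * ⟨1, 2⟩) (y : Fin 3 → GaussianInt)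
    (h : 4 ∣ ternary d n y) (i : Fin 3) : (⟨1, 1⟩ : GaussianInt) ∣ y i := by
  obtain ⟨k0, h0, h0'⟩ := sq_mod_four (y 0)
  obtain ⟨k1, h1, h1'⟩ := sq_mod_four (y 1)
  obtain ⟨k2, h2, h2'⟩ := sq_mod_four (y 2)
  have key : 4 ∣ gaussSq k0 - gaussUnit a * gaussSq k1 - gaussUnit b * ⟨1, 2⟩ * gaussSq k2 := by
    unfold ternary at h
    obtain ⟨c, hc⟩ := h
    obtain ⟨c0, hc0⟩ := h0
    obtain ⟨c1, hc1⟩ := h1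
    obtain ⟨c2, hc2⟩ := h2
    obtain ⟨c3, hc3⟩ := hd
    obtain ⟨c4, hc4⟩ := hn
    refine ⟨c - c0 + c3 * y 1 ^ 2 + c1 * gaussUnit a + c4 * y 2 ^ 2 +
      c2 * (gaussUnit b * ⟨1, 2⟩), ?_⟩
    linear_combination hc - hc0 + y 1 ^ 2 * hc3 + gaussUnit a * hc1 + y 2 ^ 2 * hc4 +
      gaussUnit b * ⟨1, 2⟩ * hc2
  rw [four_dvd_iff] at key
  obtain ⟨e0, e1, e2⟩ := not_four_dvd k0 k1 k2 a b ha key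
  fin_cases i
  exacts [h0' e0, h1' e1, h2' e2]

theorem one_add_I_pow_four : (⟨1, 1⟩ : GaussianInt) ^ 4 = -4 := by decide

theorem exists_ternary_mod_four {d n m s : GaussianInt} (hm : ¬ (⟨1, 1⟩ : GaussianInt) ∣ m)
    (hs : 16 ∣ s ^ 2 - m) {v w : Fin 3 → GaussianInt}
    (hvw : ∃ i, ¬ (⟨1, 1⟩ : GaussianInt) ∣ v i ∨ ¬ (⟨1, 1⟩ : GaussianInt) ∣ w i)
    (h1 : ternary d n v + m * ternary d n w = 0) (h2 : ternaryBil d n v w = 0) :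
    ∃ y, (∃ i, ¬ (⟨1, 1⟩ : GaussianInt) ∣ y i) ∧ 4 ∣ ternary d n y := by
  have hp := one_add_I_prime
  have hl3 : (2 : GaussianInt) = ⟨1, 1⟩ ^ 2 * ⟨0, -1⟩ := by decide
  have h16 : (16 : GaussianInt) = ⟨1, 1⟩ ^ 8 := by decide
  have hs0 : ¬ (⟨1, 1⟩ : GaussianInt) ∣ s := fun h => hm (by
    have h3 : (⟨1, 1⟩ : GaussianInt) ∣ s ^ 2 := dvd_pow h two_ne_zero
    have h4 : (⟨1, 1⟩ : GaussianInt) ∣ s ^ 2 - m :=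
      (h16 ▸ dvd_pow_self _ (by norm_num) : (⟨1, 1⟩ : GaussianInt) ∣ 16).trans hs
    have := dvd_sub h3 h4
    simpa using this)
  have step : ∀ r : GaussianInt, 16 ∣ r ^ 2 - m →
      (∃ i, ¬ (⟨1, 1⟩ : GaussianInt) ^ 3 ∣ v i + r * w i) →
      ∃ y, (∃ i, ¬ (⟨1, 1⟩ : GaussianInt) ∣ y i) ∧ 4 ∣ ternary d n y := by
    rintro r hr ⟨i, hi⟩
    obtain ⟨k, y, hy, hy'⟩ := exists_primitive_int hp (fun i => v i + r * w i) i
      (fun h => hi (by rw [h]; exact dvd_zero _))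
    refine ⟨y, hy', ?_⟩
    have hk : k ≤ 2 := by
      by_contra hk
      apply hi
      have := hy i
      rw [this]
      exact (pow_dvd_pow _ (by omega)).mul_right _
    have e1 : ternary d n (fun i => v i + r * w i) = (⟨1, 1⟩ ^ k) ^ 2 * ternary d n y := by
      simp only [hy]
      unfold ternary
      ring
    rw [ternary_add_mul h1 h2] at e1
    have e2 : (⟨1, 1⟩ : GaussianInt) ^ (2 * k) * ⟨1, 1⟩ ^ (8 - 2 * k) ∣
        ⟨1, 1⟩ ^ (2 * k) * ternary d n y := by
      rw [← pow_add, show 2 * k + (8 - 2 * k) = 8 by omega, ← h16, mul_comm 2 k, pow_mul, ← e1]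
      exact hr.mul_right _
    rw [mul_dvd_mul_iff_left (pow_ne_zero _ hp.ne_zero)] at e2
    have e3 := (pow_dvd_pow (⟨1, 1⟩ : GaussianInt) (show 4 ≤ 8 - 2 * k by omega)).trans e2
    rw [one_add_I_pow_four] at e3
    exact neg_dvd.1 e3
  have cancel : ∀ z : GaussianInt, (⟨1, 1⟩ : GaussianInt) ^ 3 ∣ 2 * z →
      (⟨1, 1⟩ : GaussianInt) ∣ z := by
    rintro z ⟨c, hc⟩
    refine ⟨⟨0, 1⟩ * c, mul_left_cancel₀ (pow_ne_zero 2 hp.ne_zero) ?_⟩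
    have e4 : (⟨0, 1⟩ : GaussianInt) * ⟨0, -1⟩ = 1 := by decide
    rw [hl3] at hc
    linear_combination ⟨0, 1⟩ * hc - ⟨1, 1⟩ ^ 2 * z * e4
  by_cases hc : ∀ i, (⟨1, 1⟩ : GaussianInt) ^ 3 ∣ v i + s * w i
  · apply step (-s) (by rwa [neg_sq])
    by_contra! hc'
    obtain ⟨i, hi⟩ := hvw
    have a1 := cancel (v i) (by
      have := dvd_add (hc i) (hc' i)
      rwa [show v i + s * w i + (v i + -s * w i) = 2 * v i by ring] at this)
    have a2 := cancel (s * w i) (by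
      have := dvd_sub (hc i) (hc' i)
      rwa [show v i + s * w i - (v i + -s * w i) = 2 * (s * w i) by ring] at this)
    exact hi.elim (fun h => h a1) fun h => (hp.dvd_or_dvd a2).elim hs0 h
  · push Not at hc
    exact step s hs hc

theorem resid_congr {q x y : GaussianInt} (h : q ∣ x - y) : resid q x = resid q y := by
  unfold resid
  congr 1
  rw [eq_iff_iff]
  apply exists_congr
  intro r
  constructor
  · intro h'
    have := dvd_add h' h
    rwa [sub_add_sub_cancel] at this
  · intro h'
    have := dvd_sub h' h
    rwa [sub_sub_sub_cancel_right, ] at this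

theorem resid_one (q : GaussianInt) : resid q 1 = 0 := by
  rw [resid_eq_zero_iff]
  exact ⟨1, by rw [one_pow]; exact dvd_zero _⟩

theorem LocSol.symm {q : GaussianInt} {N : ℕ} {d n : GaussianInt} (h : LocSol q N d n) :
    LocSol q N n d := by
  obtain ⟨y, ⟨i, hi⟩, hy⟩ := h
  refine ⟨![y 0, y 2, y 1], ?_, ?_⟩
  · fin_cases i
    exacts [⟨0, hi⟩, ⟨2, hi⟩, ⟨1, hi⟩]
  · convert hy using 1
    simp only [ternary, Matrix.cons_val]
    ring

namespace PrimeData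

variable {q : Fin 4 → GaussianInt} {a t u : ZMod 2}

theorem resid_sq (H : PrimeData q a t u) {j : Fin 4} {z : GaussianInt} (hz : ¬ q j ∣ z) :
    resid (q j) (z ^ 2) = 0 := by
  rw [pow_two, H.resid_mul _ _ _ hz hz]
  exact CharTwo.add_self_eq_zero _

theorem not_dvd_mul (H : PrimeData q a t u) {j : Fin 4} {z w : GaussianInt} (hz : ¬ q j ∣ z)
    (hw : ¬ q j ∣ w) : ¬ q j ∣ z * w := fun h => ((H.prime j).dvd_or_dvd h).elim hz hw

theorem resid_neg_one (H : PrimeData q a t u) (j : Fin 4) : resid (q j) (-1) = 0 := by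
  have h : (-1 : GaussianInt) = ⟨0, 1⟩ ^ 2 := by decide
  rw [h, H.resid_sq]
  intro hd
  exact (H.prime j).not_isUnit (isUnit_of_dvd_unit hd
    (IsUnit.of_mul_eq_one ⟨0, -1⟩ (by decide)))

theorem resid_eq_zero_of_sq (H : PrimeData q a t u) {j : Fin 4} {x r : GaussianInt}
    (hx : ¬ q j ∣ x) (h : q j ∣ r ^ 2 - x) : resid (q j) x = 0 := by
  rw [← resid_congr h, H.resid_sq]
  intro hr
  apply hx
  have := dvd_sub (dvd_pow hr two_ne_zero) h
  simpa using this

theorem locSol_unit_left (H : PrimeData q a t u) {j : Fin 4} {d n : GaussianInt}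
    (hd : ¬ q j ∣ d) (hn : q j ∣ n) (hn' : ¬ q j ^ 2 ∣ n) (h : LocSol (q j) 2 d n) :
    resid (q j) d = 0 := by
  have hp := H.prime j
  obtain ⟨y, ⟨i, hi⟩, hy⟩ := h
  unfold ternary at hy
  have h1 : q j ∣ y 0 ^ 2 - d * y 1 ^ 2 := by
    have h2 := (dvd_pow_self (q j) two_ne_zero).trans hy
    have := dvd_add h2 (hn.mul_right (y 2 ^ 2))
    simpa using this
  have hy1 : ¬ q j ∣ y 1 := by
    intro hy1
    have hy0 : q j ∣ y 0 := by
      have := dvd_add h1 ((dvd_pow hy1 two_ne_zero).mul_left d)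
      rw [sub_add_cancel] at this
      exact hp.dvd_of_dvd_pow this
    have hy2 : q j ∣ y 2 := by
      have h3 : q j ^ 2 ∣ n * y 2 ^ 2 := by
        have := dvd_sub (dvd_sub (pow_dvd_pow_of_dvd hy0 2)
          ((pow_dvd_pow_of_dvd hy1 2).mul_left d)) hy
        simpa using this
      by_contra hy2
      apply hn'
      exact (isCoprime_of_prime hp (fun h => hy2 (hp.dvd_of_dvd_pow h))).pow_left.dvd_of_dvd_mul_right h3
    fin_cases i
    exacts [hi hy0, hi hy1, hi hy2]
  have h4 : resid (q j) (d * y 1 ^ 2) = 0 :=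
    H.resid_eq_zero_of_sq (H.not_dvd_mul hd fun h => hy1 (hp.dvd_of_dvd_pow h)) h1
  rw [H.resid_mul _ _ _ hd (fun h => hy1 (hp.dvd_of_dvd_pow h)), H.resid_sq hy1, add_zero] at h4
  exact h4

theorem locSol_both (H : PrimeData q a t u) {j : Fin 4} {d n : GaussianInt}
    (hd : ¬ q j ∣ d) (hn : ¬ q j ∣ n) (h : LocSol (q j) 2 (q j * d) (q j * n)) :
    resid (q j) d + resid (q j) n = 0 := by
  have hp := H.prime j
  obtain ⟨y, ⟨i, hi⟩, hy⟩ := h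
  unfold ternary at hy
  have hy0 : q j ∣ y 0 := by
    have h2 := (dvd_pow_self (q j) two_ne_zero).trans hy
    have := dvd_add h2 (dvd_mul_right (q j) (d * y 1 ^ 2 + n * y 2 ^ 2))
    apply hp.dvd_of_dvd_pow (n := 2)
    convert this using 1
    ring
  have h1 : q j ∣ d * y 1 ^ 2 + n * y 2 ^ 2 := by
    have h2 := dvd_sub (pow_dvd_pow_of_dvd hy0 2) hy
    rw [pow_two (q j), show y 0 ^ 2 - (y 0 ^ 2 - q j * d * y 1 ^ 2 - q j * n * y 2 ^ 2) =
      q j * (d * y 1 ^ 2 + n * y 2 ^ 2) by ring, mul_dvd_mul_iff_left hp.ne_zero] at h2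
    exact h2
  have hy1 : ¬ q j ∣ y 1 := by
    intro hy1
    have hy2 : q j ∣ y 2 := by
      have := dvd_sub h1 ((dvd_pow hy1 two_ne_zero).mul_left d)
      rw [add_sub_cancel_left] at this
      exact hp.dvd_of_dvd_pow ((hp.dvd_or_dvd this).resolve_left hn)
    fin_cases i
    exacts [hi hy0, hi hy1, hi hy2]
  have hy2 : ¬ q j ∣ y 2 := by
    intro hy2
    have := dvd_sub h1 ((dvd_pow hy2 two_ne_zero).mul_left n)
    rw [add_sub_cancel_right] at this
    exact hy1 (hp.dvd_of_dvd_pow ((hp.dvd_or_dvd this).resolve_left hd))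
  have e1 : ¬ q j ∣ y 1 ^ 2 := fun h => hy1 (hp.dvd_of_dvd_pow h)
  have e2 : ¬ q j ∣ y 2 ^ 2 := fun h => hy2 (hp.dvd_of_dvd_pow h)
  have e3 : ¬ q j ∣ -1 := fun h => hp.not_isUnit (isUnit_of_dvd_unit h (isUnit_one.neg))
  have h3 : resid (q j) (d * y 1 ^ 2) = resid (q j) (-1 * (n * y 2 ^ 2)) :=
    resid_congr (by convert h1 using 1; ring)
  rw [H.resid_mul _ _ _ hd e1, H.resid_mul _ _ _ e3 (H.not_dvd_mul hn e2),
    H.resid_mul _ _ _ hn e2, H.resid_sq hy1, H.resid_sq hy2, H.resid_neg_one] at h3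
  rw [add_zero, add_zero, zero_add] at h3
  rw [h3]
  exact CharTwo.add_self_eq_zero _

end PrimeData
end LocalConditions

section HilbertSymbol

variable {q : Fin 4 → GaussianInt} {a t u : ZMod 2}

namespace PrimeData

theorem prime_not_dvd_gen (H : PrimeData q a t u) {j : Fin 4} {k : Fin 6} (hk : k ≠ primeIdx j) :
    ¬ q j ∣ gaussGen q k := by
  have hI : ¬ q j ∣ (⟨0, 1⟩ : GaussianInt) := fun hd =>
    (H.prime j).not_isUnit (isUnit_of_dvd_unit hd (IsUnit.of_mul_eq_one ⟨0, -1⟩ (by decide)))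
  have hl : ¬ q j ∣ (⟨1, 1⟩ : GaussianInt) := fun hd =>
    H.not_dvd_two j (hd.trans ⟨⟨1, -1⟩, by decide⟩)
  have hq : ∀ k, j ≠ k → ¬ q j ∣ q k := fun k => H.not_dvd j k
  fin_cases k
  · exact hI
  · exact hl
  all_goals
    apply hq
    rintro rfl
    exact hk rfl

theorem resid_gen (H : PrimeData q a t u) {j : Fin 4} {k : Fin 6} (hk : k ≠ primeIdx j) :
    resid (q j) (gaussGen q k) = residTable a t u j k := by
  have h1 := H.resid_I j
  have h2 := H.resid_one_add_I j
  have h3 := fun k => H.resid_prime j k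
  fin_cases j <;> fin_cases k <;>
    first
    | exact absurd rfl hk
    | exact h1
    | exact h2
    | exact h3 0 (by decide)
    | exact h3 1 (by decide)
    | exact h3 2 (by decide)
    | exact h3 3 (by decide)

theorem resid_gaussProd (H : PrimeData q a t u) {j : Fin 4} {v : Fin 6 → ZMod 2}
    (hv : v (primeIdx j) = 0) :
    ¬ q j ∣ gaussProd q v ∧ resid (q j) (gaussProd q v) = residLin a t u j v := by
  classical
  unfold gaussProd residLin
  induction (Finset.univ : Finset (Fin 6)) using Finset.induction_on with
  | empty =>
    exact ⟨fun h => (H.prime j).not_isUnit (isUnit_of_dvd_one h), resid_one _⟩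
  | insert k s hk ih =>
    rw [Finset.prod_insert hk, Finset.sum_insert hk]
    have key : ¬ q j ∣ gaussGen q k ^ (v k).val ∧
        resid (q j) (gaussGen q k ^ (v k).val) = v k * residTable a t u j k := by
      rcases (by decide : ∀ z : ZMod 2, z = 0 ∨ z = 1) (v k) with h | h
      · rw [h, ZMod.val_zero, pow_zero, zero_mul]
        exact ⟨fun h => (H.prime j).not_isUnit (isUnit_of_dvd_one h), resid_one _⟩
      · rw [h, ZMod.val_one, pow_one, one_mul]
        have hkj : k ≠ primeIdx j := by
          rintro rfl
          rw [hv] at h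
          exact absurd h (by decide)
        exact ⟨H.prime_not_dvd_gen hkj, H.resid_gen hkj⟩
    exact ⟨H.not_dvd_mul key.1 ih.1, by rw [H.resid_mul _ _ _ key.1 ih.1, key.2, ih.2]⟩

end PrimeData

theorem residTable_primeIdx (j : Fin 4) : residTable a t u j (primeIdx j) = 0 := by
  fin_cases j <;> rfl

theorem residLin_update (j : Fin 4) (v : Fin 6 → ZMod 2) :
    residLin a t u j (Function.update v (primeIdx j) 0) = residLin a t u j v := by
  unfold residLin
  apply Finset.sum_congr rfl
  intro k _
  by_cases h : k = primeIdx j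
  · rw [h, residTable_primeIdx, mul_zero, mul_zero]
  · rw [Function.update_of_ne h]

theorem gaussGen_primeIdx (j : Fin 4) : gaussGen q (primeIdx j) = q j := by
  fin_cases j <;> rfl

theorem gaussProd_eq_mul {j : Fin 4} {v : Fin 6 → ZMod 2} (hv : v (primeIdx j) = 1) :
    gaussProd q v = q j * gaussProd q (Function.update v (primeIdx j) 0) := by
  unfold gaussProd
  rw [Fintype.prod_eq_mul_prod_compl (primeIdx j), Fintype.prod_eq_mul_prod_compl (primeIdx j),
    hv, Function.update_self, ZMod.val_zero, ZMod.val_one, pow_zero, pow_one, one_mul,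
    gaussGen_primeIdx]
  congr 1
  apply Finset.prod_congr rfl
  intro k hk
  rw [Function.update_of_ne (by simpa using hk)]

theorem PrimeData.hilb_eq_zero (H : PrimeData q a t u) {j : Fin 4} {v w : Fin 6 → ZMod 2}
    (h : LocSol (q j) 2 (gaussProd q v) (gaussProd q w)) : hilb a t u j v w = 0 := by
  unfold hilb
  have two : ∀ z : ZMod 2, z = 0 ∨ z = 1 := by decide
  have hU : ∀ v : Fin 6 → ZMod 2, _ := fun v =>
    H.resid_gaussProd (j := j) (v := Function.update v (primeIdx j) 0) (Function.update_self ..)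
  have hsq : ∀ v : Fin 6 → ZMod 2, v (primeIdx j) = 1 → ¬ q j ^ 2 ∣ gaussProd q v := by
    intro v hv
    rw [gaussProd_eq_mul hv, pow_two, mul_dvd_mul_iff_left (H.prime j).ne_zero]
    exact (hU v).1
  have hd : ∀ v : Fin 6 → ZMod 2, v (primeIdx j) = 1 → q j ∣ gaussProd q v := by
    intro v hv
    rw [gaussProd_eq_mul hv]
    exact dvd_mul_right _ _
  rcases two (v (primeIdx j)) with hv | hv <;> rcases two (w (primeIdx j)) with hw | hw
  · rw [hv, hw]
    ring
  · have := H.locSol_unit_left (H.resid_gaussProd hv).1 (hd w hw) (hsq w hw) h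
    rw [(H.resid_gaussProd hv).2] at this
    rw [hv, hw, this]
    ring
  · have := H.locSol_unit_left (H.resid_gaussProd hw).1 (hd v hv) (hsq v hv) h.symm
    rw [(H.resid_gaussProd hw).2] at this
    rw [hv, hw, this]
    ring
  · rw [gaussProd_eq_mul hv, gaussProd_eq_mul hw] at h
    have := H.locSol_both (hU v).1 (hU w).1 h
    rw [(hU v).2, (hU w).2, residLin_update, residLin_update] at this
    rw [hv, hw, one_mul, one_mul, add_comm, this]

end HilbertSymbol

section RootClass

open scoped nonZeroDivisors

/-- The principal fractional ideal generated by `x` is the square of a fractional ideal in the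
class `c`. -/
def RootClass (E : Type*) [Field E] [NumberField E] (x : E) (c : ClassGroup (𝓞 E)) : Prop :=
  ∃ (a b : 𝓞 E) (J : (Ideal (𝓞 E))⁰), a ≠ 0 ∧ b ≠ 0 ∧ x * algebraMap (𝓞 E) E a ^ 2 = algebraMap (𝓞 E) E b ∧
    Ideal.span {b} = (J : Ideal (𝓞 E)) ^ 2 ∧ ClassGroup.mk0 J = c

theorem Ideal.pow_left_injective_of_isDedekindDomain {R : Type*} [CommRing R] [IsDedekindDomain R]
    {I J : Ideal R} {n : ℕ} (hn : n ≠ 0) (h : I ^ n = J ^ n) : I = J :=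
  dvd_antisymm ((UniqueFactorizationMonoid.pow_dvd_pow_iff_dvd hn).1 h.dvd) ((UniqueFactorizationMonoid.pow_dvd_pow_iff_dvd hn).1 h.symm.dvd)

/-- Equality of `x` and `y` up to a nonzero square factor. -/
def SqEquiv (E : Type*) [Field E] (x y : E) : Prop := ∃ c : E, c ≠ 0 ∧ x = y * c ^ 2

namespace SqEquiv

variable {E : Type*} [Field E] {x y z x' y' : E}

theorem refl (x : E) : SqEquiv E x x := ⟨1, one_ne_zero, by ring⟩

theorem symm (h : SqEquiv E x y) : SqEquiv E y x := by
  obtain ⟨c, hc, rfl⟩ := h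
  exact ⟨c⁻¹, inv_ne_zero hc, by field_simp⟩

theorem trans (h : SqEquiv E x y) (h' : SqEquiv E y z) : SqEquiv E x z := by
  obtain ⟨c, hc, rfl⟩ := h
  obtain ⟨d, hd, rfl⟩ := h'
  exact ⟨c * d, mul_ne_zero hc hd, by ring⟩

theorem mul (h : SqEquiv E x y) (h' : SqEquiv E x' y') : SqEquiv E (x * x') (y * y') := by
  obtain ⟨c, hc, rfl⟩ := h
  obtain ⟨d, hd, rfl⟩ := h'
  exact ⟨c * d, mul_ne_zero hc hd, by ring⟩

theorem sq_one (hx : x ≠ 0) : SqEquiv E (x ^ 2) 1 := ⟨x, hx, by ring⟩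

theorem mul_self_one (hx : x ≠ 0) : SqEquiv E (x * x) 1 := ⟨x, hx, by ring⟩

theorem mul_sq (hy : y ≠ 0) : SqEquiv E (x * y ^ 2) x := ⟨y, hy, rfl⟩

theorem inv (hx : x ≠ 0) : SqEquiv E x⁻¹ x := ⟨x⁻¹, inv_ne_zero hx, by field_simp⟩

theorem ne_zero_iff (h : SqEquiv E x y) : x ≠ 0 ↔ y ≠ 0 := by
  obtain ⟨c, hc, rfl⟩ := h
  exact ⟨fun h => left_ne_zero_of_mul h, fun h => mul_ne_zero h (pow_ne_zero 2 hc)⟩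

theorem mul_one_iff (hy : y ≠ 0) : SqEquiv E (x * y) 1 ↔ SqEquiv E x y := by
  constructor
  · intro h
    have h1 := h.mul (refl y)
    rw [one_mul, mul_assoc] at h1
    exact (((refl x).mul (mul_self_one hy)).symm.trans (by rwa [])) |> fun h2 => by
      rw [mul_one] at h2
      exact h2
  · intro h
    exact (h.mul (refl y)).trans (mul_self_one hy)

theorem map {L : Type*} [Field L] (f : E →+* L) (h : SqEquiv E x y) : SqEquiv L (f x) (f y) := by
  obtain ⟨c, hc, rfl⟩ := h
  exact ⟨f c, (map_ne_zero f).2 hc, by rw [map_mul, map_pow]⟩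

end SqEquiv

namespace RootClass

variable {E : Type*} [Field E] [NumberField E] {x y : E} {c d : ClassGroup (𝓞 E)}

theorem ne_zero (h : RootClass E x c) : x ≠ 0 := by
  obtain ⟨a, b, J, ha, hb, hx, -, -⟩ := h
  rintro rfl
  rw [zero_mul] at hx
  exact hb ((map_eq_zero_iff _ RingOfIntegers.coe_injective).1 hx.symm)

theorem mul (hx : RootClass E x c) (hy : RootClass E y d) : RootClass E (x * y) (c * d) := by
  obtain ⟨a, b, J, ha, hb, hx, hJ, rfl⟩ := hx
  obtain ⟨a', b', J', ha', hb', hy, hJ', rfl⟩ := hy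
  refine ⟨a * a', b * b', J * J', mul_ne_zero ha ha', mul_ne_zero hb hb', ?_, ?_, ?_⟩
  · rw [map_mul, map_mul, ← hx, ← hy]
    ring
  · rw [← Ideal.span_singleton_mul_span_singleton, hJ, hJ', Submonoid.coe_mul, mul_pow]
  · rw [map_mul]

theorem sq_eq_one (h : RootClass E x c) : c ^ 2 = 1 := by
  obtain ⟨a, b, J, ha, hb, hx, hJ, rfl⟩ := h
  rw [← map_pow, ClassGroup.mk0_eq_one_iff]
  exact ⟨⟨b, hJ.symm⟩⟩

theorem exists_of_sq_eq_one (h : c ^ 2 = 1) : ∃ x, RootClass E x c := by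
  obtain ⟨J, rfl⟩ := ClassGroup.mk0_surjective c
  rw [← map_pow, ClassGroup.mk0_eq_one_iff] at h
  obtain ⟨b, hb⟩ := h.principal
  refine ⟨b, 1, b, J, one_ne_zero, ?_, by simp, hb.symm, rfl⟩
  rintro rfl
  apply nonZeroDivisors.coe_ne_zero (J ^ 2)
  rw [hb]
  simp

theorem unit (ε : (𝓞 E)ˣ) : RootClass E (algebraMap (𝓞 E) E ε) 1 := by
  refine ⟨1, ε, 1, one_ne_zero, ε.ne_zero, by simp, ?_, map_one _⟩
  rw [Ideal.span_singleton_eq_top.2 ε.isUnit, Submonoid.coe_one, one_pow, Ideal.one_eq_top]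

theorem exists_int_ratio (hy : y ≠ 0) : ∃ a b : 𝓞 E, a ≠ 0 ∧ b ≠ 0 ∧ y * algebraMap (𝓞 E) E a = algebraMap (𝓞 E) E b := by
  obtain ⟨b, a, ha, h⟩ := IsFractionRing.div_surjective (A := 𝓞 E) y
  have ha' : algebraMap (𝓞 E) E a ≠ 0 := (map_ne_zero_iff _ RingOfIntegers.coe_injective).2 (nonZeroDivisors.ne_zero ha)
  have h' : y * algebraMap (𝓞 E) E a = algebraMap (𝓞 E) E b := by
    rw [← h, div_mul_cancel₀ _ ha']
  refine ⟨a, b, nonZeroDivisors.ne_zero ha, ?_, h'⟩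
  rintro rfl
  apply mul_ne_zero hy ha'
  rw [h']
  simp

theorem sq (hy : y ≠ 0) : RootClass E (y ^ 2) 1 := by
  obtain ⟨a, b, ha, hb, h⟩ := exists_int_ratio hy
  refine ⟨a, b ^ 2, ⟨Ideal.span {b}, mem_nonZeroDivisors_of_ne_zero (by simpa using hb)⟩, ha,
    pow_ne_zero 2 hb, ?_, ?_, ?_⟩
  · rw [map_pow, ← h, mul_pow]
  · rw [← Ideal.span_singleton_pow]
  · rw [ClassGroup.mk0_eq_one_iff]
    exact ⟨⟨b, rfl⟩⟩

theorem congr (h : RootClass E x c) (h' : SqEquiv E x y) : RootClass E y c := by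
  obtain ⟨z, hz, rfl⟩ := h'.symm
  simpa using h.mul (sq hz)

theorem unique (h : RootClass E x c) (h' : RootClass E x d) : c = d := by
  obtain ⟨a, b, J, ha, hb, hx, hJ, rfl⟩ := h
  obtain ⟨a', b', J', ha', hb', hx', hJ', rfl⟩ := h'
  rw [ClassGroup.mk0_eq_mk0_iff]
  refine ⟨a', a, ha', ha, ?_⟩
  apply Ideal.pow_left_injective_of_isDedekindDomain two_ne_zero
  rw [mul_pow, mul_pow, ← hJ, ← hJ', Ideal.span_singleton_pow, Ideal.span_singleton_pow,
    Ideal.span_singleton_mul_span_singleton, Ideal.span_singleton_mul_span_singleton]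
  congr 2
  apply RingOfIntegers.coe_injective
  rw [map_mul, map_mul, map_pow, map_pow, ← hx, ← hx']
  ring

theorem eq_one_of_unit (ε : (𝓞 E)ˣ) (h : RootClass E x c)
    (h' : SqEquiv E x (algebraMap (𝓞 E) E ε)) : c = 1 :=
  (h.congr h').unique (unit ε)

theorem exists_unit (h : RootClass E x 1) : ∃ ε : (𝓞 E)ˣ, SqEquiv E x (algebraMap (𝓞 E) E ε) := by
  obtain ⟨a, b, J, ha, hb, hx, hJ, h1⟩ := h
  rw [ClassGroup.mk0_eq_one_iff] at h1
  obtain ⟨z, hz⟩ := h1.principal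
  rw [hz, ← Ideal.span, Ideal.span_singleton_pow, Ideal.span_singleton_eq_span_singleton] at hJ
  obtain ⟨ε, hε⟩ := hJ.symm
  have hz0 : z ≠ 0 := by
    rintro rfl
    rw [← hε] at hb
    simp at hb
  have ha' : algebraMap (𝓞 E) E a ≠ 0 := (map_ne_zero_iff _ RingOfIntegers.coe_injective).2 ha
  refine ⟨ε, algebraMap (𝓞 E) E z / algebraMap (𝓞 E) E a, div_ne_zero ((map_ne_zero_iff _ RingOfIntegers.coe_injective).2 hz0) ha', ?_⟩
  rw [← hε] at hx
  rw [map_mul, map_pow] at hx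
  rw [div_pow, ← mul_div_assoc, eq_div_iff (pow_ne_zero 2 ha'), hx]
  ring

theorem map (L : Type*) [Field L] [NumberField L] [Algebra E L] (h : RootClass E x c) :
    RootClass L (algebraMap E L x) (ClassGroup.extendedHom (𝓞 E) (𝓞 L) c) := by
  obtain ⟨a, b, J, ha, hb, hx, hJ, rfl⟩ := h
  have hinj := FaithfulSMul.algebraMap_injective (𝓞 E) (𝓞 L)
  refine ⟨algebraMap (𝓞 E) (𝓞 L) a, algebraMap (𝓞 E) (𝓞 L) b,
    ClassGroup.extendedIdeal (𝓞 E) (𝓞 L) J, (map_ne_zero_iff _ hinj).2 ha,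
    (map_ne_zero_iff _ hinj).2 hb, ?_, ?_, ?_⟩
  · have := congrArg (algebraMap E L) hx
    rw [map_mul, map_pow] at this
    exact this
  · change _ = (J : Ideal (𝓞 E)).map _ ^ 2
    rw [← Ideal.map_pow, ← hJ, Ideal.map_span, Set.image_singleton]
  · rw [ClassGroup.extendedHom_mk0]

end RootClass
end RootClass

section Quadratic

open scoped nonZeroDivisors

/-- The norm map on class groups. -/
theorem exists_clNorm (K E : Type*) [Field K] [NumberField K] [Field E] [NumberField E]
    [Algebra K E] : ∃ N : ClassGroup (𝓞 E) →* ClassGroup (𝓞 K), ∀ (J : (Ideal (𝓞 E))⁰)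
      (I : (Ideal (𝓞 K))⁰), (I : Ideal (𝓞 K)) = Ideal.relNorm (𝓞 K) (J : Ideal (𝓞 E)) →
        N (ClassGroup.mk0 J) = ClassGroup.mk0 I := by
  let n : (Ideal (𝓞 E))⁰ →* (Ideal (𝓞 K))⁰ :=
    { toFun := fun J => ⟨Ideal.relNorm (𝓞 K) (J : Ideal (𝓞 E)), mem_nonZeroDivisors_of_ne_zero
        (fun h => nonZeroDivisors.coe_ne_zero J (Ideal.relNorm_eq_bot_iff.1 h))⟩
      map_one' := Subtype.ext (map_one _)
      map_mul' := fun _ _ => Subtype.ext (map_mul _ _ _) }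
  have key : ∀ I J : (Ideal (𝓞 E))⁰, ClassGroup.mk0 I = ClassGroup.mk0 J →
      ClassGroup.mk0 (n I) = ClassGroup.mk0 (n J) := by
    intro I J h
    rw [ClassGroup.mk0_eq_mk0_iff] at h ⊢
    obtain ⟨x, y, hx, hy, h⟩ := h
    refine ⟨Algebra.intNorm (𝓞 K) (𝓞 E) x, Algebra.intNorm (𝓞 K) (𝓞 E) y,
      Algebra.intNorm_ne_zero.2 hx, Algebra.intNorm_ne_zero.2 hy, ?_⟩
    have := congrArg (Ideal.relNorm (𝓞 K)) h
    rw [map_mul, map_mul, Ideal.relNorm_singleton, Ideal.relNorm_singleton] at this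
    exact this
  refine ⟨MonoidHom.mk' (fun c => ClassGroup.mk0 (n (ClassGroup.mk0_surjective c).choose)) ?_, ?_⟩
  · intro c d
    rw [← map_mul, ← map_mul]
    apply key
    rw [(ClassGroup.mk0_surjective _).choose_spec, map_mul,
      (ClassGroup.mk0_surjective _).choose_spec, (ClassGroup.mk0_surjective _).choose_spec]
  · intro J I hI
    have : I = n J := Subtype.ext hI
    rw [this]
    exact key _ _ (ClassGroup.mk0_surjective _).choose_spec

/-- The norm map on class groups. -/
noncomputable def clNorm (K E : Type*) [Field K] [NumberField K] [Field E] [NumberField E]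
    [Algebra K E] : ClassGroup (𝓞 E) →* ClassGroup (𝓞 K) := (exists_clNorm K E).choose

variable {K E : Type*} [Field K] [NumberField K] [Field E] [NumberField E] [Algebra K E]

theorem clNorm_mk0 {J : (Ideal (𝓞 E))⁰} {I : (Ideal (𝓞 K))⁰}
    (h : (I : Ideal (𝓞 K)) = Ideal.relNorm (𝓞 K) (J : Ideal (𝓞 E))) :
    clNorm K E (ClassGroup.mk0 J) = ClassGroup.mk0 I := (exists_clNorm K E).choose_spec J I h

/-- The nonzero ideal which is the relative norm of a nonzero ideal. -/
noncomputable def normIdeal (K : Type*) {E : Type*} [Field K] [NumberField K] [Field E]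
    [NumberField E] [Algebra K E] (J : (Ideal (𝓞 E))⁰) : (Ideal (𝓞 K))⁰ :=
  ⟨Ideal.relNorm (𝓞 K) (J : Ideal (𝓞 E)), mem_nonZeroDivisors_of_ne_zero
    (fun h => nonZeroDivisors.coe_ne_zero J (Ideal.relNorm_eq_bot_iff.1 h))⟩

theorem RootClass.norm {x : E} {c : ClassGroup (𝓞 E)} (h : RootClass E x c) :
    RootClass K (Algebra.norm K x) (clNorm K E c) := by
  obtain ⟨a, b, J, ha, hb, hx, hJ, rfl⟩ := h
  refine ⟨Algebra.intNorm (𝓞 K) (𝓞 E) a, Algebra.intNorm (𝓞 K) (𝓞 E) b, normIdeal K J,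
    Algebra.intNorm_ne_zero.2 ha, Algebra.intNorm_ne_zero.2 hb, ?_, ?_, (clNorm_mk0 rfl).symm⟩
  · rw [Algebra.algebraMap_intNorm (L := E), Algebra.algebraMap_intNorm (L := E), ← hx, map_mul,
      map_pow]
  · change _ = Ideal.relNorm (𝓞 K) (J : Ideal (𝓞 E)) ^ 2
    rw [← map_pow, ← hJ, Ideal.relNorm_singleton]

theorem clNorm_eq_one_of_rootClass_algebraMap [Algebra.IsQuadraticExtension K E] {x : K}
    {c : ClassGroup (𝓞 E)} (h : RootClass E (algebraMap K E x) c) : clNorm K E c = 1 := by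
  have h1 := h.norm (K := K)
  rw [Algebra.norm_algebraMap, Algebra.IsQuadraticExtension.finrank_eq_two] at h1
  refine h1.unique (.sq ?_)
  rintro rfl
  exact h.ne_zero (map_zero _)

section Galois

variable [Algebra.IsQuadraticExtension K E] {σ : Gal(E/K)}

theorem gal_eq_one_or (hσ : σ ≠ 1) (τ : Gal(E/K)) : τ = 1 ∨ τ = σ := by
  classical
  by_contra! h
  have h1 : Nat.card Gal(E/K) = 2 := by
    rw [IsGalois.card_aut_eq_finrank, Algebra.IsQuadraticExtension.finrank_eq_two]
  have h2 : ({1, σ, τ} : Finset Gal(E/K)).card = 3 := by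
    rw [Finset.card_eq_three]
    exact ⟨1, σ, τ, hσ.symm, h.1.symm, h.2.symm, rfl⟩
  have h3 := Finset.card_le_univ ({1, σ, τ} : Finset Gal(E/K))
  rw [← Nat.card_eq_fintype_card, h1, h2] at h3
  omega

theorem gal_univ [DecidableEq Gal(E/K)] (hσ : σ ≠ 1) :
    (Finset.univ : Finset Gal(E/K)) = {1, σ} := by
  ext τ
  simpa using gal_eq_one_or hσ τ

theorem algebraMap_norm_eq (hσ : σ ≠ 1) (x : E) :
    algebraMap K E (Algebra.norm K x) = x * σ x := by
  classical
  rw [Algebra.norm_eq_prod_automorphisms, gal_univ hσ, Finset.prod_pair hσ.symm]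
  rfl

theorem algebraMap_trace_eq (hσ : σ ≠ 1) (x : E) :
    algebraMap K E (Algebra.trace K E x) = x + σ x := by
  classical
  rw [trace_eq_sum_automorphisms, gal_univ hσ, Finset.sum_pair hσ.symm]
  rfl

theorem gal_apply_apply (hσ : σ ≠ 1) (x : E) : σ (σ x) = x := by
  rcases gal_eq_one_or hσ (σ * σ) with h | h
  · exact DFunLike.congr_fun h x
  · exact absurd (mul_left_cancel (h.trans (mul_one σ).symm)) hσ

theorem mem_range_of_gal_fixed (hσ : σ ≠ 1) {x : E} (hx : σ x = x) :
    ∃ y, algebraMap K E y = x := by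
  have h := (IsGalois.mem_bot_iff_fixed (F := K) x).2 fun τ => by
    rcases gal_eq_one_or hσ τ with rfl | rfl
    · rfl
    · exact hx
  exact IntermediateField.mem_bot.1 h

theorem exists_gal_ne_one : ∃ σ : Gal(E/K), σ ≠ 1 := by
  by_contra! h
  have h1 : Nat.card Gal(E/K) = 2 := by
    rw [IsGalois.card_aut_eq_finrank, Algebra.IsQuadraticExtension.finrank_eq_two]
  have : Subsingleton Gal(E/K) := ⟨fun a b => (h a).trans (h b).symm⟩
  rw [Nat.card_unique] at h1
  omega

/-- A form of Hilbert's theorem 90 for elements whose norm is a square. -/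
theorem exists_sqEquiv_of_norm_eq_sq {x : E} (hx : x ≠ 0) {c : K}
    (h : Algebra.norm K x = c ^ 2) : ∃ (b : K) (z : E), b ≠ 0 ∧ z ≠ 0 ∧
      SqEquiv E x (algebraMap K E b) ∧ (b * c = Algebra.norm K z ∨ b * c = -Algebra.norm K z) := by
  obtain ⟨σ, hσ⟩ := exists_gal_ne_one (K := K) (E := E)
  have aux : ∀ c' : K, Algebra.norm K x = c' ^ 2 → x + algebraMap K E c' ≠ 0 →
      ∃ (b : K) (z : E), b ≠ 0 ∧ z ≠ 0 ∧ SqEquiv E x (algebraMap K E b) ∧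
        b * c' = Algebra.norm K z := by
    intro c' h' hz
    have h1 := algebraMap_norm_eq hσ x
    rw [h', map_pow] at h1
    set y := algebraMap K E c' with hy
    have h2 : x * algebraMap K E (2 * c' + Algebra.trace K E x) = (x + y) ^ 2 := by
      rw [map_add, map_mul, algebraMap_trace_eq hσ, ← hy, map_ofNat]
      linear_combination -h1
    have hb : 2 * c' + Algebra.trace K E x ≠ 0 := by
      intro hb
      rw [hb, map_zero, mul_zero] at h2
      exact hz (pow_eq_zero_iff two_ne_zero |>.1 h2.symm)
    refine ⟨2 * c' + Algebra.trace K E x, x + y, hb, hz, ?_, ?_⟩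
    · have hb' := (map_ne_zero (algebraMap K E)).2 hb
      rw [← SqEquiv.mul_one_iff hb', h2]
      exact SqEquiv.sq_one hz
    · apply (algebraMap K E).injective
      rw [algebraMap_norm_eq hσ, map_mul, map_add, map_mul, algebraMap_trace_eq hσ, map_add, hy,
        AlgEquiv.commutes, map_ofNat, ← hy]
      linear_combination h1
  by_cases hc : x + algebraMap K E c = 0
  · have hc' : x + algebraMap K E (-c) ≠ 0 := by
      intro hc'
      rw [map_neg] at hc'
      apply hx
      have : 2 * x = 0 := by linear_combination hc + hc'
      simpa using this
    obtain ⟨b, z, hb, hz, h1, h2⟩ := aux (-c) (by rw [h, neg_sq]) hc'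
    exact ⟨b, z, hb, hz, h1, Or.inr (by rw [← h2]; ring)⟩
  · obtain ⟨b, z, hb, hz, h1, h2⟩ := aux c h hc
    exact ⟨b, z, hb, hz, h1, Or.inl h2⟩

/-- Elements of the base field becoming squares in a quadratic extension. -/
theorem sqEquiv_one_of_algebraMap {s : E} {d : K} (hs : s ^ 2 = algebraMap K E d)
    (hs' : ∀ y, algebraMap K E y ≠ s) {x : K} (h : SqEquiv E (algebraMap K E x) 1) :
    SqEquiv K x 1 ∨ SqEquiv K x d := by
  obtain ⟨σ, hσ⟩ := exists_gal_ne_one (K := K) (E := E)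
  obtain ⟨y, hy, hxy⟩ := h
  rw [one_mul] at hxy
  have pm : ∀ (z : E) (k : K), z ^ 2 = algebraMap K E k → σ z = z ∨ σ z = -z := by
    intro z k hz
    apply sq_eq_sq_iff_eq_or_eq_neg.1
    rw [← map_pow, hz, AlgEquiv.commutes]
  have hσs : σ s = -s := by
    rcases pm s d hs with h | h
    · obtain ⟨y, hy⟩ := mem_range_of_gal_fixed hσ h
      exact absurd hy (hs' y)
    · exact h
  have hs0 : s ≠ 0 := fun h => hs' 0 (by rw [map_zero, h])
  rcases pm y x hxy.symm with h | h
  · left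
    obtain ⟨z, rfl⟩ := mem_range_of_gal_fixed hσ h
    refine ⟨z, fun h => hy (by rw [h, map_zero]), ?_⟩
    apply (algebraMap K E).injective
    rw [hxy, map_mul, map_one, one_mul, map_pow]
  · right
    obtain ⟨z, hz⟩ := mem_range_of_gal_fixed hσ (x := y / s) (by rw [map_div₀, h, hσs, neg_div_neg_eq])
    refine ⟨z, fun h => div_ne_zero hy hs0 (by rw [← hz, h, map_zero]), ?_⟩
    apply (algebraMap K E).injective
    rw [hxy, map_mul, map_pow, hz, ← hs, div_pow]
    field_simp

/-- The image of an ideal under a Galois automorphism. -/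
noncomputable def galIdeal (σ : Gal(E/K)) (J : (Ideal (𝓞 E))⁰) : (Ideal (𝓞 E))⁰ :=
  ⟨(J : Ideal (𝓞 E)).map (RingOfIntegers.mapRingEquiv (σ : E ≃+* E) : 𝓞 E →+* 𝓞 E),
    mem_nonZeroDivisors_of_ne_zero fun h => nonZeroDivisors.coe_ne_zero J
      ((Ideal.map_eq_bot_iff_of_injective
        (RingOfIntegers.mapRingEquiv (σ : E ≃+* E)).injective).1 h)⟩

theorem map_relNorm_eq (hσ : σ ≠ 1) (J : (Ideal (𝓞 E))⁰) :
    (Ideal.relNorm (𝓞 K) (J : Ideal (𝓞 E))).map (algebraMap (𝓞 K) (𝓞 E)) = J * galIdeal σ J := by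
  obtain ⟨n, hn, h1⟩ : ∃ n : ℕ, n ≠ 0 ∧ ClassGroup.mk0 (J ^ n) = 1 :=
    ⟨Fintype.card (ClassGroup (𝓞 E)), Fintype.card_ne_zero, by rw [map_pow, pow_card_eq_one]⟩
  rw [ClassGroup.mk0_eq_one_iff] at h1
  obtain ⟨b, hb⟩ := h1.principal
  rw [SubmonoidClass.coe_pow, ← Ideal.span] at hb
  apply Ideal.pow_left_injective_of_isDedekindDomain hn
  rw [← Ideal.map_pow, ← map_pow, hb, Ideal.relNorm_singleton, mul_pow, hb]
  change _ = _ * (Ideal.map _ (J : Ideal (𝓞 E))) ^ n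
  rw [← Ideal.map_pow, hb, Ideal.map_span, Ideal.map_span, Set.image_singleton,
    Set.image_singleton, Ideal.span_singleton_mul_span_singleton]
  congr 2
  apply RingOfIntegers.coe_injective
  rw [← IsScalarTower.algebraMap_apply, IsScalarTower.algebraMap_apply (𝓞 K) K E,
    Algebra.algebraMap_intNorm (L := E), algebraMap_norm_eq hσ, map_mul]
  rfl

theorem extendedHom_clNorm (hσ : σ ≠ 1) (J : (Ideal (𝓞 E))⁰) :
    ClassGroup.extendedHom (𝓞 K) (𝓞 E) (clNorm K E (ClassGroup.mk0 J)) =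
      ClassGroup.mk0 J * ClassGroup.mk0 (galIdeal σ J) := by
  rw [clNorm_mk0 (I := normIdeal K J) rfl, ClassGroup.extendedHom_mk0, ← map_mul]
  congr 1
  exact Subtype.ext (map_relNorm_eq hσ J)

end Galois
end Quadratic

section GaussianField

variable {q : Fin 4 → GaussianInt} {a t u : ZMod 2}

theorem PrimeData.gen_prime (H : PrimeData q a t u) {k : Fin 6} (hk : k ≠ 0) :
    Prime (gaussGen q k) := by
  fin_cases k
  · exact absurd rfl hk
  · exact one_add_I_prime
  · exact H.prime 0
  · exact H.prime 1
  · exact H.prime 2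
  · exact H.prime 3

theorem exists_primeIdx : ∀ k : Fin 6, k = 0 ∨ k = 1 ∨ ∃ j, k = primeIdx j := by decide

theorem isUnit_gaussGen_zero : IsUnit (gaussGen q 0) :=
  IsUnit.of_mul_eq_one (⟨0, -1⟩ : GaussianInt) (by decide : (⟨0, 1⟩ * ⟨0, -1⟩ : GaussianInt) = 1)

theorem PrimeData.gen_not_dvd (H : PrimeData q a t u) {k l : Fin 6} (hk : k ≠ 0) (hkl : k ≠ l) :
    ¬ gaussGen q k ∣ gaussGen q l := by
  intro h
  have hl : l ≠ 0 := by
    rintro rfl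
    exact (H.gen_prime hk).not_isUnit (isUnit_of_dvd_unit h isUnit_gaussGen_zero)
  have h' := (((H.gen_prime hk).irreducible).dvd_symm (H.gen_prime hl).irreducible) h
  rcases exists_primeIdx k with hk0 | rfl | ⟨j, rfl⟩
  · exact hk hk0
  · rcases exists_primeIdx l with hl0 | rfl | ⟨j, rfl⟩
    · exact hl hl0
    · exact hkl rfl
    · rw [gaussGen_primeIdx] at h'
      exact H.prime_not_dvd_gen hkl h'
  · rw [gaussGen_primeIdx] at h
    exact H.prime_not_dvd_gen hkl.symm h

theorem PrimeData.gaussProd_ne_zero (H : PrimeData q a t u) (v : Fin 6 → ZMod 2) :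
    gaussProd q v ≠ 0 := by
  refine Finset.prod_ne_zero_iff.2 fun k _ => pow_ne_zero _ ?_
  rcases eq_or_ne k 0 with rfl | hk
  · exact isUnit_gaussGen_zero.ne_zero
  · exact (H.gen_prime hk).ne_zero

theorem prime_not_dvd_gaussProd {π : GaussianInt} (hπ : Prime π) {v : Fin 6 → ZMod 2}
    (h : ∀ k, v k ≠ 0 → ¬ π ∣ gaussGen q k) : ¬ π ∣ gaussProd q v := by
  intro hd
  obtain ⟨k, -, hk⟩ := hπ.exists_mem_finset_dvd hd
  by_cases hv : v k = 0
  · rw [hv, ZMod.val_zero, pow_zero] at hk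
    exact hπ.not_isUnit (isUnit_of_dvd_one hk)
  · exact h k hv (hπ.dvd_of_dvd_pow hk)

theorem gaussProd_eq_gen_mul {k : Fin 6} {v : Fin 6 → ZMod 2} (hv : v k = 1) :
    gaussProd q v = gaussGen q k * gaussProd q (Function.update v k 0) := by
  unfold gaussProd
  rw [Fintype.prod_eq_mul_prod_compl k, Fintype.prod_eq_mul_prod_compl k, hv,
    Function.update_self, ZMod.val_zero, ZMod.val_one, pow_zero, pow_one, one_mul]
  congr 1
  refine Finset.prod_congr rfl fun l hl => ?_
  rw [Function.update_of_ne (by simpa using hl)]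

theorem not_isSquare_I (r : GaussianInt) : r ^ 2 ≠ ⟨0, 1⟩ := by
  obtain ⟨x, y⟩ := r
  intro h
  rw [pow_two, Zsqrtd.ext_iff] at h
  simp only [Zsqrtd.re_mul, Zsqrtd.im_mul] at h
  have : x * y + x * y = 1 := by linarith [h.2, mul_comm x y]
  omega

theorem PrimeData.eq_zero_of_sq (H : PrimeData q a t u) {v : Fin 6 → ZMod 2} {r : GaussianInt}
    (h : gaussProd q v = r ^ 2) : v = 0 := by
  have two : ∀ z : ZMod 2, z ≠ 0 → z = 1 := by decide
  have h1 : ∀ k, k ≠ 0 → v k = 0 := by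
    intro k hk
    by_contra hv
    have h2 := gaussProd_eq_gen_mul (q := q) (two _ hv)
    obtain ⟨c, rfl⟩ : gaussGen q k ∣ r :=
      (H.gen_prime hk).dvd_of_dvd_pow (h ▸ h2 ▸ dvd_mul_right _ _)
    rw [h, mul_pow, pow_two (gaussGen q k), mul_assoc] at h2
    have h3 := mul_left_cancel₀ (H.gen_prime hk).ne_zero h2
    refine prime_not_dvd_gaussProd (H.gen_prime hk) (fun l hl => ?_) (h3 ▸ dvd_mul_right _ _)
    refine H.gen_not_dvd hk ?_
    rintro rfl
    exact hl (Function.update_self ..)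
  have h0 : v 0 = 0 := by
    by_contra hv
    have h2 := gaussProd_eq_gen_mul (q := q) (two _ hv)
    have h3 : Function.update v 0 0 = (0 : Fin 6 → ZMod 2) := by
      ext k
      rcases eq_or_ne k 0 with rfl | hk
      · rw [Function.update_self, Pi.zero_apply]
      · rw [Function.update_of_ne hk, h1 k hk, Pi.zero_apply]
    rw [h3, h] at h2
    apply not_isSquare_I r
    rw [h2]
    simp [gaussProd, gaussGen]
  ext k
  rcases eq_or_ne k 0 with rfl | hk
  · rw [h0, Pi.zero_apply]
  · rw [h1 k hk, Pi.zero_apply]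

theorem gaussianInt_isUnit {z : GaussianInt} (h : IsUnit z) :
    z = 1 ∨ z = -1 ∨ z = ⟨0, 1⟩ ∨ z = -⟨0, 1⟩ := by
  obtain ⟨x, y⟩ := z
  have h1 := (Zsqrtd.norm_eq_one_iff' (by norm_num) _).2 h
  rw [Zsqrtd.norm_def] at h1
  simp only at h1
  have hx : -1 ≤ x ∧ x ≤ 1 := abs_le.1 ((sq_le_one_iff_abs_le_one x).1 (by nlinarith [mul_self_nonneg y]))
  have hy : -1 ≤ y ∧ y ≤ 1 := abs_le.1 ((sq_le_one_iff_abs_le_one y).1 (by nlinarith [mul_self_nonneg x]))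
  obtain ⟨hx1, hx2⟩ := hx
  obtain ⟨hy1, hy2⟩ := hy
  interval_cases x <;> interval_cases y <;> first | (exfalso; omega) | decide

variable (F : Type*) [Field F] [NumberField F] [Algebra GaussianInt F]
  [IsFractionRing GaussianInt F]

/-- The image of `gaussProd` in the field of Gaussian numbers. -/
noncomputable def gaussEl (q : Fin 4 → GaussianInt) (v : Fin 6 → ZMod 2) : F :=
  algebraMap GaussianInt F (gaussProd q v)

/-- The imaginary unit in the field of Gaussian numbers. -/
noncomputable def gaussI : F := algebraMap GaussianInt F ⟨0, 1⟩

theorem gaussI_sq : gaussI F ^ 2 = -1 := by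
  rw [gaussI, ← map_pow, show (⟨0, 1⟩ : GaussianInt) ^ 2 = -1 by decide, map_neg, map_one]

theorem gaussI_ne_zero : gaussI F ≠ 0 := by
  intro h
  have := gaussI_sq F
  rw [h] at this
  norm_num at this

theorem sqEquiv_neg (x : F) : SqEquiv F (-x) x :=
  ⟨gaussI F, gaussI_ne_zero F, by rw [gaussI_sq]; ring⟩

theorem gaussEl_zero : gaussEl F q 0 = 1 := by simp [gaussEl, gaussProd]

theorem gaussEl_single (k : Fin 6) :
    gaussEl F q (Pi.single k 1) = algebraMap GaussianInt F (gaussGen q k) := by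
  rw [gaussEl, gaussProd_eq_gen_mul (k := k) (Pi.single_eq_same k 1)]
  congr 1
  convert mul_one _
  rw [show Function.update (Pi.single k (1 : ZMod 2)) k 0 = (0 : Fin 6 → ZMod 2) by
    ext l
    rcases eq_or_ne l k with rfl | h
    · simp
    · simp [h]]
  simp [gaussProd]

variable {F}

theorem PrimeData.gaussEl_ne_zero (H : PrimeData q a t u) (v : Fin 6 → ZMod 2) :
    gaussEl F q v ≠ 0 :=
  (map_ne_zero_iff _ (IsFractionRing.injective GaussianInt F)).2 (H.gaussProd_ne_zero v)

theorem PrimeData.gaussEl_add (H : PrimeData q a t u) (v w : Fin 6 → ZMod 2) :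
    SqEquiv F (gaussEl F q v * gaussEl F q w) (gaussEl F q (v + w)) := by
  refine ⟨algebraMap GaussianInt F (∏ k, if v k = 1 ∧ w k = 1 then gaussGen q k else 1),
    (map_ne_zero_iff _ (IsFractionRing.injective GaussianInt F)).2 ?_, ?_⟩
  · refine Finset.prod_ne_zero_iff.2 fun k _ => ?_
    split_ifs
    · rcases eq_or_ne k 0 with rfl | hk
      · exact isUnit_gaussGen_zero.ne_zero
      · exact (H.gen_prime hk).ne_zero
    · exact one_ne_zero
  · unfold gaussEl
    rw [← map_pow, ← map_mul, ← map_mul]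
    congr 1
    unfold gaussProd
    rw [← Finset.prod_pow, ← Finset.prod_mul_distrib, ← Finset.prod_mul_distrib]
    refine Finset.prod_congr rfl fun k _ => ?_
    rw [Pi.add_apply]
    have h1 : (1 : ZMod 2).val = 1 := rfl
    have h2 : (0 : ZMod 2).val = 0 := rfl
    have h3 : (1 + 1 : ZMod 2) = 0 := rfl
    rcases (by decide : ∀ z : ZMod 2, z = 0 ∨ z = 1) (v k) with h | h <;>
      rcases (by decide : ∀ z : ZMod 2, z = 0 ∨ z = 1) (w k) with h' | h' <;>
      simp [h, h', h1, h2, h3, pow_two]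

theorem PrimeData.eq_zero_of_sqEquiv_one (H : PrimeData q a t u) {v : Fin 6 → ZMod 2}
    (h : SqEquiv F (gaussEl F q v) 1) : v = 0 := by
  obtain ⟨c, hc, h⟩ := h
  rw [one_mul] at h
  obtain ⟨r, rfl⟩ : ∃ r, algebraMap GaussianInt F r = c :=
    (IsIntegrallyClosed.isIntegral_iff (R := GaussianInt) (x := c)).1
      (IsIntegral.of_pow two_pos (h ▸ isIntegral_algebraMap))
  rw [← map_pow] at h
  exact H.eq_zero_of_sq (IsFractionRing.injective GaussianInt F h)

theorem PrimeData.eq_of_sqEquiv (H : PrimeData q a t u) {v w : Fin 6 → ZMod 2}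
    (h : SqEquiv F (gaussEl F q v) (gaussEl F q w)) : v = w := by
  have h1 := H.eq_zero_of_sqEquiv_one ((H.gaussEl_add v w).symm.trans
    ((SqEquiv.mul_one_iff (H.gaussEl_ne_zero w)).2 h))
  rw [← sub_eq_zero, ← h1]
  ext k
  simp [CharTwo.sub_eq_add]

theorem sqEquiv_of_isUnit {z : GaussianInt} (h : IsUnit z) :
    SqEquiv F (algebraMap GaussianInt F z) 1 ∨
      SqEquiv F (algebraMap GaussianInt F z) (gaussI F) := by
  rcases gaussianInt_isUnit h with rfl | rfl | rfl | rfl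
  · left
    rw [map_one]
    exact .refl _
  · left
    rw [map_neg, map_one]
    exact sqEquiv_neg F 1
  · right
    exact .refl _
  · right
    rw [map_neg]
    exact sqEquiv_neg F _

theorem gaussEl_e0 : gaussEl F q (Pi.single 0 1) = gaussI F := gaussEl_single F 0

/-- Up to squares, an element is a product of the given factors unless it is exactly divisible by
some other prime. -/
theorem PrimeData.sqEquiv_gaussEl_or (H : PrimeData q a t u) {x : F} (hx : x ≠ 0) :
    (∃ v, SqEquiv F x (gaussEl F q v)) ∨ ∃ π c : GaussianInt, Prime π ∧ ¬ π ∣ c ∧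
      (∀ k, ¬ π ∣ gaussGen q k) ∧ SqEquiv F x (algebraMap GaussianInt F (π * c)) := by
  suffices key : ∀ z : GaussianInt, z ≠ 0 →
      (∃ v, SqEquiv F (algebraMap GaussianInt F z) (gaussEl F q v)) ∨
      ∃ π c : GaussianInt, Prime π ∧ ¬ π ∣ c ∧ (∀ k, ¬ π ∣ gaussGen q k) ∧
        SqEquiv F (algebraMap GaussianInt F z) (algebraMap GaussianInt F (π * c)) by
    have hinj := IsFractionRing.injective GaussianInt F
    obtain ⟨r, s, hs, rfl⟩ := IsFractionRing.div_surjective (A := GaussianInt) x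
    have hs' := (map_ne_zero_iff _ hinj).2 (nonZeroDivisors.ne_zero hs)
    have hr : r ≠ 0 := by
      rintro rfl
      rw [map_zero, zero_div] at hx
      exact hx rfl
    have h1 : SqEquiv F (algebraMap GaussianInt F r / algebraMap GaussianInt F s)
        (algebraMap GaussianInt F (r * s)) :=
      ⟨(algebraMap GaussianInt F s)⁻¹, inv_ne_zero hs', by rw [map_mul]; field_simp⟩
    rcases key (r * s) (mul_ne_zero hr (nonZeroDivisors.ne_zero hs)) with
      ⟨v, h⟩ | ⟨π, c, hπ, hc, hg, h⟩
    · exact Or.inl ⟨v, h1.trans h⟩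
    · exact Or.inr ⟨π, c, hπ, hc, hg, h1.trans h⟩
  intro z
  have hinj := IsFractionRing.injective GaussianInt F
  induction z using (wellFounded_dvdNotUnit (α := GaussianInt)).induction with
  | _ z ih =>
  intro hz
  by_cases hu : IsUnit z
  · left
    rcases sqEquiv_of_isUnit (F := F) hu with h | h
    · exact ⟨0, by rwa [gaussEl_zero]⟩
    · exact ⟨Pi.single 0 1, by rwa [gaussEl_e0]⟩
  obtain ⟨p, hp, c, rfl⟩ := WfDvdMonoid.exists_irreducible_factor hu hz
  have hp := hp.prime
  have hc0 : c ≠ 0 := right_ne_zero_of_mul hz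
  by_cases hg : ∀ k, ¬ p ∣ gaussGen q k
  · by_cases hpc : p ∣ c
    · obtain ⟨d, rfl⟩ := hpc
      have hd0 : d ≠ 0 := right_ne_zero_of_mul hc0
      have h1 : SqEquiv F (algebraMap GaussianInt F (p * (p * d))) (algebraMap GaussianInt F d) :=
        ⟨algebraMap GaussianInt F p, (map_ne_zero_iff _ hinj).2 hp.ne_zero, by
          rw [map_mul, map_mul]; ring⟩
      rcases ih d ⟨hd0, p * p, fun h => hp.not_isUnit (isUnit_of_mul_isUnit_left h), by ring⟩
        hd0 with ⟨v, h⟩ | ⟨π, c, hπ, hc, hg, h⟩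
      · exact Or.inl ⟨v, h1.trans h⟩
      · exact Or.inr ⟨π, c, hπ, hc, hg, h1.trans h⟩
    · exact Or.inr ⟨p, c, hp, hpc, hg, .refl _⟩
  · push Not at hg
    obtain ⟨k, hk⟩ := hg
    have hk0 : k ≠ 0 := by
      rintro rfl
      exact hp.not_isUnit (isUnit_of_dvd_unit hk isUnit_gaussGen_zero)
    obtain ⟨w, hw⟩ : ∃ w, SqEquiv F (algebraMap GaussianInt F p) (gaussEl F q w) := by
      obtain ⟨ε, hε⟩ := (hp.irreducible.associated_of_dvd (H.gen_prime hk0).irreducible hk).symm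
      rw [← hε, map_mul, ← gaussEl_single]
      rcases sqEquiv_of_isUnit (F := F) ε.isUnit with h | h
      · exact ⟨_, by simpa using (SqEquiv.refl _).mul h⟩
      · rw [← gaussEl_e0 (q := q)] at h
        exact ⟨_, ((SqEquiv.refl _).mul h).trans (H.gaussEl_add _ _)⟩
    rw [map_mul]
    rcases ih c ⟨hc0, p, hp.not_isUnit, by ring⟩ hc0 with ⟨v, h⟩ | ⟨π, c, hπ, hc, hg, h⟩
    · exact Or.inl ⟨w + v, (hw.mul h).trans (H.gaussEl_add _ _)⟩
    · refine Or.inr ⟨π, p * c, hπ, fun h => (hπ.dvd_or_dvd h).elim (fun h => hg k (h.trans hk)) hc,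
        hg, ?_⟩
      rw [mul_left_comm, map_mul]
      exact (SqEquiv.refl _).mul h

end GaussianField

section GaussianRoots

variable {F : Type*} [Field F] [NumberField F] [Algebra GaussianInt F]
  [IsFractionRing GaussianInt F]

theorem gaussianInt_isIntegral (z : GaussianInt) : IsIntegral ℤ z := by
  have h : z = (z.re : GaussianInt) + z.im * ⟨0, 1⟩ := by
    ext <;> simp
  rw [h]
  have hI : IsIntegral ℤ (⟨0, 1⟩ : GaussianInt) := by
    refine IsIntegral.of_pow two_pos ?_
    rw [show (⟨0, 1⟩ : GaussianInt) ^ 2 = -1 by decide]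
    exact isIntegral_one.neg
  exact (isIntegral_algebraMap (x := z.re)).add ((isIntegral_algebraMap (x := z.im)).mul hI)

instance : Algebra.IsIntegral ℤ GaussianInt := ⟨gaussianInt_isIntegral⟩

theorem isIntegralClosure_gaussianInt : IsIntegralClosure GaussianInt ℤ F :=
  IsIntegralClosure.of_isIntegrallyClosed GaussianInt ℤ F

theorem exists_ringOfIntegers_equiv_gaussianInt :
    ∃ e : GaussianInt ≃+* 𝓞 F, ∀ z, algebraMap (𝓞 F) F (e z) = algebraMap GaussianInt F z := by
  have := isIntegralClosure_gaussianInt (F := F)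
  let e := (RingOfIntegers.equiv (K := F) GaussianInt).symm
  refine ⟨e, fun z => ?_⟩
  exact IsIntegralClosure.algebraMap_equiv ℤ GaussianInt F (𝓞 F) z

theorem RootClass.gauss {x : F} {c : ClassGroup (𝓞 F)} (h : RootClass F x c) :
    c = 1 ∧ (SqEquiv F x 1 ∨ SqEquiv F x (gaussI F)) := by
  obtain ⟨e, he⟩ := exists_ringOfIntegers_equiv_gaussianInt (F := F)
  have : IsPrincipalIdealRing (𝓞 F) := IsPrincipalIdealRing.of_surjective e e.surjective
  have hc : c = 1 := Subsingleton.elim _ _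
  subst hc
  refine ⟨rfl, ?_⟩
  obtain ⟨ε, hε⟩ := h.exists_unit
  obtain ⟨z, hz⟩ := e.surjective ε
  have hu : IsUnit z := by
    rw [← isUnit_map_iff e z, hz]
    exact ε.isUnit
  rw [← hz, he] at hε
  rcases sqEquiv_of_isUnit (F := F) hu with h | h
  · exact Or.inl (hε.trans h)
  · exact Or.inr (hε.trans h)

end GaussianRoots

section Coordinates

variable {F K : Type*} [Field F] [NumberField F] [Field K] [NumberField K] [Algebra F K]
  [Algebra.IsQuadraticExtension F K] {s : K} {d : F}

theorem gal_apply_sqrt (hs : s ^ 2 = algebraMap F K d) (hs' : ∀ y, algebraMap F K y ≠ s)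
    {σ : Gal(K/F)} (hσ : σ ≠ 1) : σ s = -s := by
  have h1 : σ s ^ 2 = s ^ 2 := by
    rw [← map_pow, hs, AlgEquiv.commutes]
  rcases sq_eq_sq_iff_eq_or_eq_neg.1 h1 with h | h
  · obtain ⟨y, hy⟩ := mem_range_of_gal_fixed hσ h
    exact absurd hy (hs' y)
  · exact h

theorem exists_coords (hs : s ^ 2 = algebraMap F K d) (hs' : ∀ y, algebraMap F K y ≠ s) (z : K) :
    ∃ α β : F, z = algebraMap F K α + algebraMap F K β * s ∧
      Algebra.norm F z = α ^ 2 - d * β ^ 2 := by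
  obtain ⟨σ, hσ⟩ := exists_gal_ne_one (K := F) (E := K)
  have hsσ := gal_apply_sqrt hs hs' hσ
  have hs0 : s ≠ 0 := fun h => hs' 0 (by rw [map_zero, h])
  obtain ⟨α, hα⟩ := mem_range_of_gal_fixed hσ (x := (z + σ z) / 2) (by
    rw [map_div₀, map_add, gal_apply_apply hσ, map_ofNat, add_comm])
  obtain ⟨β, hβ⟩ := mem_range_of_gal_fixed hσ (x := (z - σ z) / (2 * s)) (by
    rw [map_div₀, map_sub, gal_apply_apply hσ, map_mul, map_ofNat, hsσ]
    field_simp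
    ring)
  have h1 : z = algebraMap F K α + algebraMap F K β * s := by
    rw [hα, hβ]
    field_simp
    ring
  refine ⟨α, β, h1, FaithfulSMul.algebraMap_injective F K ?_⟩
  rw [algebraMap_norm_eq hσ]
  have h2 : σ z = algebraMap F K α - algebraMap F K β * s := by
    conv_lhs => rw [h1]
    rw [map_add, map_mul, AlgEquiv.commutes, AlgEquiv.commutes, hsσ]
    ring
  rw [h2]
  conv_lhs => rw [h1]
  simp only [map_sub, map_mul, map_pow, ← hs]
  ring

theorem coords_unique (hs' : ∀ y, algebraMap F K y ≠ s) {α β : F}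
    (h : algebraMap F K α + algebraMap F K β * s = 0) : α = 0 ∧ β = 0 := by
  have hβ : β = 0 := by
    by_contra hβ
    apply hs' (-α / β)
    have : algebraMap F K β ≠ 0 := (map_ne_zero_iff _ (FaithfulSMul.algebraMap_injective F K)).2 hβ
    rw [map_div₀, map_neg]
    field_simp
    linear_combination -h
  subst hβ
  rw [map_zero, zero_mul, add_zero] at h
  exact ⟨(map_eq_zero_iff _ (FaithfulSMul.algebraMap_injective F K)).1 h, rfl⟩

end Coordinates

section NormSymbol

variable {q : Fin 4 → GaussianInt} {a t u : ZMod 2}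
variable {F : Type*} [Field F] [NumberField F] [Algebra GaussianInt F]
  [IsFractionRing GaussianInt F]
variable {K : Type*} [Field K] [NumberField K] [Algebra F K]
  [Algebra.IsQuadraticExtension F K]

theorem PrimeData.hilb_of_norm (H : PrimeData q a t u) {D v : Fin 6 → ZMod 2} {s : K}
    (hs : s ^ 2 = algebraMap F K (gaussEl F q D)) (hs' : ∀ y, algebraMap F K y ≠ s) {z : K}
    (h : SqEquiv F (Algebra.norm F z) (gaussEl F q v)) (j : Fin 4) : hilb a t u j D v = 0 := by
  obtain ⟨α, β, hz, hN⟩ := exists_coords hs hs' z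
  obtain ⟨k, hk, h⟩ := h
  refine H.hilb_eq_zero (locSol_of_ternary (F := F) (H.prime j) 2 (x := ![α, β, k]) 2 hk ?_)
  change α ^ 2 - gaussEl F q D * β ^ 2 - gaussEl F q v * k ^ 2 = 0
  rw [← h, hN]
  ring

end NormSymbol

section TowerSymbol

variable {q : Fin 4 → GaussianInt} {a t u : ZMod 2}
variable {F : Type*} [Field F] [NumberField F] [Algebra GaussianInt F]
  [IsFractionRing GaussianInt F]
variable {K : Type*} [Field K] [NumberField K] [Algebra F K]
  [Algebra.IsQuadraticExtension F K]
variable {L : Type*} [Field L] [NumberField L] [Algebra K L]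
  [Algebra.IsQuadraticExtension K L]

omit [Algebra GaussianInt F] [IsFractionRing GaussianInt F] in
theorem exists_pair_of_norm {d m n : F} {s : K} {r : L} (hs : s ^ 2 = algebraMap F K m)
    (hs' : ∀ y, algebraMap F K y ≠ s) (hr : r ^ 2 = algebraMap K L (algebraMap F K d))
    (hr' : ∀ y, algebraMap K L y ≠ r) {x : L}
    (h : SqEquiv K (Algebra.norm K x) (algebraMap F K n)) :
    ∃ v w : Fin 3 → F, (∃ i, v i ≠ 0 ∨ w i ≠ 0) ∧ ternary d n v + m * ternary d n w = 0 ∧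
      ternaryBil d n v w = 0 := by
  obtain ⟨A, B, -, hN⟩ := exists_coords hr hr' x
  obtain ⟨k, hk, h⟩ := h
  obtain ⟨A0, A1, hA, -⟩ := exists_coords hs hs' A
  obtain ⟨B0, B1, hB, -⟩ := exists_coords hs hs' B
  obtain ⟨k0, k1, hk', -⟩ := exists_coords hs hs' k
  refine ⟨![A0, B0, k0], ![A1, B1, k1], ⟨2, ?_⟩, ?_⟩
  · by_contra! hc
    have h0 : k0 = 0 := hc.1
    have h1 : k1 = 0 := hc.2
    rw [h0, h1] at hk'
    simp at hk'
    exact hk hk'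
  · have key := coords_unique (F := F) hs'
      (α := ternary d n ![A0, B0, k0] + m * ternary d n ![A1, B1, k1])
      (β := 2 * ternaryBil d n ![A0, B0, k0] ![A1, B1, k1]) (by
        rw [hN, hA, hB, hk'] at h
        simp only [ternary, ternaryBil, Matrix.cons_val, map_sub, map_mul, map_add, map_pow, ← hs,
          map_ofNat]
        linear_combination h)
    exact ⟨key.1, (mul_eq_zero.1 key.2).resolve_left two_ne_zero⟩

theorem PrimeData.hilb_of_norm_tower (H : PrimeData q a t u) {D E v : Fin 6 → ZMod 2} {s : K}
    {r : L} (hs : s ^ 2 = algebraMap F K (gaussEl F q D)) (hs' : ∀ y, algebraMap F K y ≠ s)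
    (hr : r ^ 2 = algebraMap K L (algebraMap F K (gaussEl F q E)))
    (hr' : ∀ y, algebraMap K L y ≠ r) {x : L}
    (h : SqEquiv K (Algebra.norm K x) (algebraMap F K (gaussEl F q v))) {j : Fin 4}
    (hD : D (primeIdx j) = 0) (hD' : residLin a t u j D = 0) : hilb a t u j E v = 0 := by
  obtain ⟨x, y, hne, h1, h2⟩ := exists_pair_of_norm hs hs' hr hr' h
  obtain ⟨x, y, hi, h1, h2⟩ := exists_primitive_pair (H.prime j) hne h1 h2
  obtain ⟨hd, hres⟩ := H.resid_gaussProd (j := j) hD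
  rw [hD', resid_eq_zero_iff] at hres
  obtain ⟨k, hk⟩ := hres
  refine H.hilb_eq_zero (locSol_of_pair (s := (k : GaussianInt)) (H.prime j) (H.not_dvd_two j) hd ?_ hi h1 h2)
  convert hk using 2
  ext <;> simp [pow_two]

theorem PrimeData.false_of_norm_tower (H : PrimeData q a t u) (htu : t = u) {s : K}
    {r : L} (hs : s ^ 2 = algebraMap F K (gaussEl F q ![0, 0, 1, 0, 1, 0]))
    (hs' : ∀ y, algebraMap F K y ≠ s)
    (hr : r ^ 2 = algebraMap K L (algebraMap F K (gaussEl F q ![1, 0, 0, 1, 0, 1])))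
    (hr' : ∀ y, algebraMap K L y ≠ r) {x : L} {k : ZMod 2}
    (h : SqEquiv K (Algebra.norm K x) (algebraMap F K (gaussEl F q ![k, 0, 1, 0, 0, 0]))) :
    False := by
  obtain ⟨x, y, hne, h1, h2⟩ := exists_pair_of_norm hs hs' hr hr' h
  obtain ⟨x, y, hi, h1, h2⟩ := exists_primitive_pair one_add_I_prime hne h1 h2
  obtain ⟨c, hc⟩ := H.exists_sq htu
  have v1 : (1 : ZMod 2).val = 1 := rfl
  have v0 : (0 : ZMod 2).val = 0 := rfl
  have e1 : gaussProd q ![0, 0, 1, 0, 1, 0] = q 0 * q 2 := by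
    simp [gaussProd, gaussGen, Fin.prod_univ_succ, v1, v0]
  have e2 : gaussProd q ![1, 0, 0, 1, 0, 1] = ⟨0, 1⟩ * (q 1 * q 3) := by
    simp [gaussProd, gaussGen, Fin.prod_univ_succ, v1, v0]
  have e3 : gaussProd q ![k, 0, 1, 0, 0, 0] = q 0 ∨
      gaussProd q ![k, 0, 1, 0, 0, 0] = ⟨0, 1⟩ * q 0 := by
    rcases (by decide : ∀ k : ZMod 2, k = 0 ∨ k = 1) k with rfl | rfl
    · left; simp [gaussProd, gaussGen, Fin.prod_univ_succ, v1, v0]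
    · right; simp [gaussProd, gaussGen, Fin.prod_univ_succ, v1, v0]
  have hodd : ¬ (⟨1, 1⟩ : GaussianInt) ∣ q 0 * q 2 := fun h => by
    have h4 : (⟨1, 1⟩ : GaussianInt) ∣ 4 := ⟨⟨2, -2⟩, by decide⟩
    rcases H.mod_four_mul with h' | h'
    · have := dvd_sub h (h4.trans h')
      rw [sub_sub_cancel] at this
      exact one_add_I_prime.not_isUnit (isUnit_of_dvd_one this)
    · have := dvd_sub (h4.trans h') h
      rw [add_sub_cancel_left] at this
      exact one_add_I_prime.not_isUnit (isUnit_of_dvd_one this)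
  rw [e1] at h1
  rw [e2] at h1 h2
  obtain ⟨y, ⟨i, hi⟩, hy⟩ := exists_ternary_mod_four hodd hc hi h1 h2
  obtain ⟨α, hα, hα'⟩ : ∃ α : Fin 4, (α = 1 ∨ α = 3) ∧
      4 ∣ (⟨0, 1⟩ * (q 1 * q 3) : GaussianInt) - gaussUnit α := by
    rcases H.mod_four_mul' with h' | h'
    · exact ⟨1, Or.inl rfl, (h'.mul_left ⟨0, 1⟩).trans (by rw [gaussUnit]; simp [mul_sub])⟩
    · refine ⟨3, Or.inr rfl, (h'.mul_left ⟨0, 1⟩).trans (dvd_of_eq ?_)⟩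
      rw [mul_add, show gaussUnit 3 = - (⟨0, 1⟩ * 1) by decide, sub_neg_eq_add]
  obtain ⟨β, hβ⟩ : ∃ β : Fin 4, 4 ∣ gaussProd q ![k, 0, 1, 0, 0, 0] - gaussUnit β * ⟨1, 2⟩ := by
    rcases e3 with e3 | e3 <;> rw [e3] <;> rcases H.mod_four with h' | h'
    · exact ⟨0, by rwa [show gaussUnit 0 = 1 by decide, one_mul]⟩
    · exact ⟨2, by rwa [show gaussUnit 2 = -1 by decide, neg_one_mul, sub_neg_eq_add]⟩
    · exact ⟨1, by
        rw [show gaussUnit 1 = ⟨0, 1⟩ by decide, ← mul_sub]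
        exact h'.mul_left _⟩
    · exact ⟨3, by
        rw [show gaussUnit 3 = -⟨0, 1⟩ by decide, neg_mul, sub_neg_eq_add, ← mul_add]
        exact h'.mul_left _⟩
  exact hi (not_ternary_mod_four hα hα' hβ y hy i)

end TowerSymbol

section Radical

/-- The element `p` generates an ideal of the ring of integers without square factors. -/
def RadAt (E : Type*) [Field E] (p : E) : Prop :=
  ∀ x : E, IsIntegral ℤ (x ^ 2 / p) → IsIntegral ℤ (x / p)

theorem radAt_gaussian {F : Type*} [Field F] [NumberField F] [Algebra GaussianInt F]
    [IsFractionRing GaussianInt F] {π : GaussianInt} (hπ : Prime π) :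
    RadAt F (algebraMap GaussianInt F π) := by
  intro x hx
  have hinj := IsFractionRing.injective GaussianInt F
  have hp0 := (map_ne_zero_iff _ hinj).2 hπ.ne_zero
  have := isIntegralClosure_gaussianInt (F := F)
  obtain ⟨y, hy⟩ := (IsIntegralClosure.isIntegral_iff (A := GaussianInt)).1 hx
  have h1 : x ^ 2 = algebraMap GaussianInt F (π * y) := by
    rw [map_mul, hy]
    field_simp
  obtain ⟨z, rfl⟩ := (IsIntegrallyClosed.isIntegral_iff (R := GaussianInt) (x := x)).1
    (IsIntegral.of_pow two_pos (h1 ▸ isIntegral_algebraMap))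
  rw [← map_pow] at h1
  obtain ⟨w, rfl⟩ := hπ.dvd_of_dvd_pow (Dvd.intro _ (hinj h1).symm)
  rw [map_mul, mul_div_cancel_left₀ _ hp0, IsIntegralClosure.isIntegral_iff (A := GaussianInt)]
  exact ⟨w, rfl⟩

variable {K E : Type*} [Field K] [NumberField K] [Field E] [NumberField E] [Algebra K E]
  [Algebra.IsQuadraticExtension K E]

theorem RadAt.extend {p : K} (hp0 : p ≠ 0) (hp : RadAt K p) (hpi : IsIntegral ℤ p)
    {δ y₁ y₂ z₁ z₂ A B : E}
    (hy₁ : IsIntegral ℤ y₁) (hy₂ : IsIntegral ℤ y₂) (hz₁ : IsIntegral ℤ z₁) (hz₂ : IsIntegral ℤ z₂)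
    (hA : IsIntegral ℤ A) (hB : IsIntegral ℤ B) (hAB : A * algebraMap K E p + B * δ = 1)
    (hδ : ∀ x, δ * x = z₁ * algebraMap K E (Algebra.trace K E (x * y₁)) +
      z₂ * algebraMap K E (Algebra.trace K E (x * y₂))) :
    RadAt E (algebraMap K E p) := by
  intro x hx
  obtain ⟨σ, hσ⟩ := exists_gal_ne_one (K := K) (E := E)
  have hinj := FaithfulSMul.algebraMap_injective K E
  have hp' : algebraMap K E p ≠ 0 := (map_ne_zero_iff _ hinj).2 hp0
  have key : ∀ y : E, IsIntegral ℤ y →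
      IsIntegral ℤ (algebraMap K E (Algebra.trace K E (x * y)) / algebraMap K E p) := by
    intro y hy
    rw [← map_div₀]
    refine IsIntegral.algebraMap (hp _ ?_)
    rw [← isIntegral_algebraMap_iff hinj, map_div₀, map_pow, algebraMap_trace_eq hσ]
    have h1 : IsIntegral ℤ ((x * y) ^ 2 / algebraMap K E p) := by
      rw [mul_pow, mul_div_right_comm]
      exact hx.mul (hy.pow 2)
    have h2 : IsIntegral ℤ (σ (x * y) ^ 2 / algebraMap K E p) := by
      have := h1.map (σ : E ≃ₐ[K] E)
      rwa [map_div₀, map_pow, AlgEquiv.commutes] at this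
    have h3 : IsIntegral ℤ ((x * y) * σ (x * y) / algebraMap K E p) := by
      refine IsIntegral.of_pow two_pos ?_
      rw [show (x * y * σ (x * y) / algebraMap K E p) ^ 2 =
        (x * y) ^ 2 / algebraMap K E p * (σ (x * y) ^ 2 / algebraMap K E p) by ring]
      exact h1.mul h2
    rw [show (x * y + σ (x * y)) ^ 2 / algebraMap K E p =
      (x * y) ^ 2 / algebraMap K E p + σ (x * y) ^ 2 / algebraMap K E p +
      (x * y * σ (x * y) / algebraMap K E p + x * y * σ (x * y) / algebraMap K E p) by ring]
    exact (h1.add h2).add (h3.add h3)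
  have hxi : IsIntegral ℤ x := by
    refine IsIntegral.of_pow two_pos ?_
    have := hx.mul (hpi.algebraMap (B := E))
    rwa [div_mul_cancel₀ _ hp'] at this
  have h1 : x / algebraMap K E p = A * x + B *
      (z₁ * (algebraMap K E (Algebra.trace K E (x * y₁)) / algebraMap K E p) +
      z₂ * (algebraMap K E (Algebra.trace K E (x * y₂)) / algebraMap K E p)) := by
    have := hδ x
    field_simp
    linear_combination (-x) * hAB + B * this
  rw [h1]
  exact (hA.mul hxi).add (hB.mul ((hz₁.mul (key _ hy₁)).add (hz₂.mul (key _ hy₂))))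

theorem RadAt.extend_sqrt {p : K} (hp0 : p ≠ 0) (hp : RadAt K p) (hpi : IsIntegral ℤ p)
    {s : E} {d A B : K} (hs : s ^ 2 = algebraMap K E d) (hs' : ∀ y, algebraMap K E y ≠ s)
    (hd : IsIntegral ℤ d) (hA : IsIntegral ℤ A) (hB : IsIntegral ℤ B)
    (hAB : A * p + B * (2 * d) = 1) : RadAt E (algebraMap K E p) := by
  obtain ⟨σ, hσ⟩ := exists_gal_ne_one (K := K) (E := E)
  have hsσ := gal_apply_sqrt hs hs' hσ
  have hsi : IsIntegral ℤ s := IsIntegral.of_pow two_pos (hs ▸ hd.algebraMap)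
  refine hp.extend hp0 hpi (δ := algebraMap K E (2 * d)) (y₁ := 1) (y₂ := s)
    (z₁ := algebraMap K E d) (z₂ := s) isIntegral_one hsi hd.algebraMap hsi
    (hA.algebraMap (B := E)) (hB.algebraMap (B := E)) ?_ fun x => ?_
  · rw [← map_mul, ← map_mul, ← map_add, hAB, map_one]
  · rw [algebraMap_trace_eq hσ, algebraMap_trace_eq hσ, map_mul σ x s, hsσ, mul_one, map_mul, ← hs,
      map_ofNat]
    ring

theorem RadAt.extend_half {p : K} (hp0 : p ≠ 0) (hp : RadAt K p) (hpi : IsIntegral ℤ p)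
    {s : E} {d A B k u : K} (hs : s ^ 2 = algebraMap K E d) (hs' : ∀ y, algebraMap K E y ≠ s)
    (hd : IsIntegral ℤ d) (hA : IsIntegral ℤ A) (hB : IsIntegral ℤ B)
    (hk : IsIntegral ℤ k) (hu : IsIntegral ℤ u) (huk : u ^ 2 = d + 4 * k)
    (hAB : A * p + B * d = 1) : RadAt E (algebraMap K E p) := by
  obtain ⟨σ, hσ⟩ := exists_gal_ne_one (K := K) (E := E)
  have hsσ := gal_apply_sqrt hs hs' hσ
  have hsi : IsIntegral ℤ s := IsIntegral.of_pow two_pos (hs ▸ hd.algebraMap)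
  have hω : IsIntegral ℤ ((algebraMap K E u + s) / 2) := by
    have h1 : ((algebraMap K E u + s) / 2) * ((algebraMap K E u + s) / 2 - algebraMap K E u) =
        - algebraMap K E k := by
      have : algebraMap K E u ^ 2 = algebraMap K E (d + 4 * k) := by rw [← huk, map_pow]
      rw [map_add, map_mul, map_ofNat, ← hs] at this
      linear_combination (-1 / 4 : E) * this
    have hr : IsIntegral (𝓞 K) ((algebraMap K E u + s) / 2) := by
      obtain ⟨u', rfl⟩ : ∃ u' : 𝓞 K, algebraMap (𝓞 K) K u' = u := ⟨⟨u, hu⟩, rfl⟩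
      obtain ⟨k', rfl⟩ : ∃ k' : 𝓞 K, algebraMap (𝓞 K) K k' = k := ⟨⟨k, hk⟩, rfl⟩
      refine ⟨Polynomial.X ^ 2 - Polynomial.C u' * Polynomial.X + Polynomial.C k', by monicity!, ?_⟩
      simp only [Polynomial.eval₂_add, Polynomial.eval₂_sub, Polynomial.eval₂_mul,
        Polynomial.eval₂_pow, Polynomial.eval₂_X, Polynomial.eval₂_C,
        IsScalarTower.algebraMap_apply (𝓞 K) K E]
      linear_combination h1
    exact isIntegral_trans (A := 𝓞 K) _ hr
  have hω' : IsIntegral ℤ (-(s * ((algebraMap K E u + s) / 2 - s))) := (hsi.mul (hω.sub hsi)).neg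
  refine hp.extend hp0 hpi (δ := algebraMap K E d) (y₁ := (algebraMap K E u + s) / 2) (y₂ := 1)
    (z₁ := s) (z₂ := -(s * ((algebraMap K E u + s) / 2 - s))) hω isIntegral_one hsi hω'
    (hA.algebraMap (B := E)) (hB.algebraMap (B := E)) ?_ fun x => ?_
  · rw [← map_mul, ← map_mul, ← map_add, hAB, map_one]
  · rw [algebraMap_trace_eq hσ, algebraMap_trace_eq hσ, map_mul σ x _, map_div₀, map_add,
      AlgEquiv.commutes, hsσ, mul_one, ← hs, map_ofNat]
    ring

omit [NumberField K] [Algebra.IsQuadraticExtension K E] in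
theorem RootClass.false_of_radAt {p c : 𝓞 E} (hp : RadAt E (algebraMap (𝓞 E) E p)) (hp0 : p ≠ 0)
    (hpu : ¬ IsUnit p) (hpc : IsCoprime p c) {x : ClassGroup (𝓞 E)}
    (h : RootClass E (algebraMap (𝓞 E) E (p * c)) x) : False := by
  have hpE : algebraMap (𝓞 E) E p ≠ 0 := (map_ne_zero_iff _ RingOfIntegers.coe_injective).2 hp0
  obtain ⟨P, hP, hle⟩ := Ideal.exists_le_maximal (Ideal.span {p})
    (by rwa [Ne, Ideal.span_singleton_eq_top])
  have hpP : p ∈ P := hle (Ideal.mem_span_singleton_self p)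
  have hP0 : P ≠ ⊥ := by
    rintro rfl
    exact hp0 (by simpa using hpP)
  have hPp : Prime P := Ideal.prime_of_isPrime hP0 hP.isPrime
  have h1 : multiplicity P (Ideal.span {p}) = 1 := by
    refine multiplicity_eq_of_dvd_of_not_dvd ?_ ?_
    · rw [pow_one]; exact Ideal.dvd_iff_le.2 hle
    · rintro ⟨M, hM⟩
      have hM0 : M ≠ ⊥ := by
        rintro rfl
        rw [Ideal.mul_bot, Ideal.span_singleton_eq_bot] at hM
        exact hp0 hM
      obtain ⟨x, hx1, hx2⟩ : ∃ x ∈ P * M, x ∉ Ideal.span {p} := by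
        by_contra! hcon
        have hle : P * M ≤ Ideal.span {p} := hcon
        rw [← Ideal.dvd_iff_le, hM, pow_two, mul_assoc] at hle
        have h2 : P * (P * M) ∣ 1 * (P * M) := by rwa [one_mul]
        have h3 := (mul_dvd_mul_iff_right (mul_ne_zero hP0 hM0)).1 h2
        exact hPp.not_isUnit (isUnit_of_dvd_one h3)
      obtain ⟨y, hy⟩ : p ∣ x ^ 2 := by
        rw [← Ideal.mem_span_singleton, hM]
        have h2 : x ^ 2 ∈ (P * M) ^ 2 := Ideal.pow_mem_pow hx1 2
        rw [mul_pow, pow_two M, ← mul_assoc] at h2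
        exact Ideal.dvd_iff_le.1 (dvd_mul_right _ _) h2
      have h3 := hp (algebraMap (𝓞 E) E x) (by
        rw [← map_pow, hy, map_mul, mul_div_cancel_left₀ _ hpE]
        exact RingOfIntegers.isIntegral_coe y)
      obtain ⟨z, hz⟩ : ∃ z : 𝓞 E, algebraMap (𝓞 E) E z =
        algebraMap (𝓞 E) E x / algebraMap (𝓞 E) E p := ⟨⟨_, h3⟩, rfl⟩
      apply hx2
      rw [Ideal.mem_span_singleton]
      refine ⟨z, RingOfIntegers.coe_injective ?_⟩
      rw [map_mul, hz]
      field_simp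
  have h2 : multiplicity P (Ideal.span {c}) = 0 := by
    refine multiplicity_eq_zero.2 fun hd => ?_
    have hcP : c ∈ P := Ideal.dvd_iff_le.1 hd (Ideal.mem_span_singleton_self c)
    obtain ⟨r, s, hrs⟩ := hpc
    exact hP.ne_top ((Ideal.eq_top_iff_one P).2
      (hrs ▸ P.add_mem (P.mul_mem_left r hpP) (P.mul_mem_left s hcP)))
  obtain ⟨a, b, J, ha, hb, hab, hJ, -⟩ := h
  rw [← map_pow, ← map_mul] at hab
  have hab := RingOfIntegers.coe_injective hab
  have hfin : ∀ I : Ideal (𝓞 E), I ≠ 0 → FiniteMultiplicity P I := fun I hI =>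
    FiniteMultiplicity.of_prime_left hPp hI
  have hb' : Ideal.span {b} = Ideal.span {p} * Ideal.span {c} * Ideal.span {a} ^ 2 := by
    rw [← hab, Ideal.span_singleton_pow, Ideal.span_singleton_mul_span_singleton,
      Ideal.span_singleton_mul_span_singleton]
  have hb0 : Ideal.span {b} ≠ 0 := by rwa [Ne, Ideal.zero_eq_bot, Ideal.span_singleton_eq_bot]
  have h3 : multiplicity P (Ideal.span {b}) = 1 + 2 * multiplicity P (Ideal.span {a}) := by
    have hf := hfin _ hb0
    rw [hb'] at hf ⊢
    rw [multiplicity_mul hPp hf, multiplicity_mul hPp (hf.mul_left), h1, h2,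
      FiniteMultiplicity.multiplicity_pow hPp]
    refine hfin _ ?_
    rwa [Ne, Ideal.zero_eq_bot, Ideal.span_singleton_eq_bot]
  rw [hJ, FiniteMultiplicity.multiplicity_pow hPp (hfin _ (nonZeroDivisors.coe_ne_zero J))] at h3
  omega

end Radical

section GoodRad

variable {q : Fin 4 → GaussianInt} {a t u : ZMod 2}
variable (F : Type*) [Field F] [NumberField F] [Algebra GaussianInt F]
  [IsFractionRing GaussianInt F]
variable (E : Type*) [Field E] [NumberField E] [Algebra F E]

/-- The Gaussian primes other than the factors with index in `B` are unramified in `E`. -/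
def GoodRad (q : Fin 4 → GaussianInt) (B : Finset (Fin 6)) : Prop :=
  ∀ π : GaussianInt, Prime π → (∀ k ∈ B, ¬ π ∣ gaussGen q k) →
    RadAt E (algebraMap F E (algebraMap GaussianInt F π))

theorem exists_gaussianInt_hom : ∃ φ : GaussianInt →+* 𝓞 E,
    (∀ z, algebraMap (𝓞 E) E (φ z) = algebraMap F E (algebraMap GaussianInt F z)) ∧
    ∀ z, z ≠ 0 → IsUnit (φ z) → IsUnit z := by
  obtain ⟨e, he⟩ := exists_ringOfIntegers_equiv_gaussianInt (F := F)
  have := isIntegralClosure_gaussianInt (F := F)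
  have hinj := IsFractionRing.injective GaussianInt F
  have hE := FaithfulSMul.algebraMap_injective F E
  have key : ∀ z, algebraMap (𝓞 E) E ((algebraMap (𝓞 F) (𝓞 E)).comp (e : GaussianInt →+* 𝓞 F) z) =
      algebraMap F E (algebraMap GaussianInt F z) := by
    intro z
    rw [← he]
    rfl
  refine ⟨(algebraMap (𝓞 F) (𝓞 E)).comp (e : GaussianInt →+* 𝓞 F), key, fun z hz hu => ?_⟩
  obtain ⟨y, hy⟩ := hu.exists_right_inv
  have h1 := congrArg (algebraMap (𝓞 E) E) hy
  rw [map_mul, key, map_one] at h1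
  have hz' := (map_ne_zero_iff _ hinj).2 hz
  have h2 : IsIntegral ℤ (algebraMap GaussianInt F z)⁻¹ := by
    rw [← isIntegral_algebraMap_iff hE, map_inv₀, ← eq_inv_of_mul_eq_one_right h1]
    exact RingOfIntegers.isIntegral_coe y
  obtain ⟨w, hw⟩ := (IsIntegralClosure.isIntegral_iff (A := GaussianInt)).1 h2
  refine IsUnit.of_mul_eq_one w (hinj ?_)
  rw [map_mul, hw, mul_inv_cancel₀ hz', map_one]

variable {F E}

theorem GoodRad.not_rootClass {B : Finset (Fin 6)} (hB : GoodRad F E q B) {π c : GaussianInt}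
    (hπ : Prime π) (hπB : ∀ k ∈ B, ¬ π ∣ gaussGen q k) (hc : ¬ π ∣ c) {x : F}
    (hx : SqEquiv F x (algebraMap GaussianInt F (π * c))) {κ : ClassGroup (𝓞 E)}
    (h : RootClass E (algebraMap F E x) κ) : False := by
  obtain ⟨φ, hφ, hφ'⟩ := exists_gaussianInt_hom F E
  have h1 := h.congr (hx.map (algebraMap F E))
  rw [← hφ, map_mul] at h1
  have hr := hB π hπ hπB
  rw [← hφ] at hr
  refine RootClass.false_of_radAt hr ?_ (fun hu => hπ.not_isUnit (hφ' π hπ.ne_zero hu)) ?_ h1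
  · intro h0
    have := hφ π
    rw [h0, map_zero, eq_comm, map_eq_zero_iff _ (FaithfulSMul.algebraMap_injective F E),
      map_eq_zero_iff _ (IsFractionRing.injective GaussianInt F)] at this
    exact hπ.ne_zero this
  · exact (isCoprime_of_prime hπ hc).map φ

theorem PrimeData.exists_sqEquiv_of_rootClass (H : PrimeData q a t u) {B : Finset (Fin 6)}
    (h0 : 0 ∈ B) (hB : GoodRad F E q B) {x : F} {κ : ClassGroup (𝓞 E)}
    (h : RootClass E (algebraMap F E x) κ) :
    ∃ v : Fin 6 → ZMod 2, (∀ k ∉ B, v k = 0) ∧ SqEquiv F x (gaussEl F q v) := by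
  have hx : x ≠ 0 := fun hx => h.ne_zero (by rw [hx, map_zero])
  rcases H.sqEquiv_gaussEl_or hx with ⟨v, hv⟩ | ⟨π, c, hπ, hc, hg, hx⟩
  · refine ⟨v, fun k hk => ?_, hv⟩
    by_contra hvk
    have hk0 : k ≠ 0 := by rintro rfl; exact hk h0
    have h1 := gaussProd_eq_gen_mul (q := q)
      ((by decide : ∀ z : ZMod 2, z ≠ 0 → z = 1) _ hvk)
    refine hB.not_rootClass (H.gen_prime hk0) (fun l hl => H.gen_not_dvd hk0 ?_) (c := gaussProd q
      (Function.update v k 0)) (prime_not_dvd_gaussProd (H.gen_prime hk0) fun l hl =>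
        H.gen_not_dvd hk0 ?_) (by rw [← h1]; exact hv) h
    · rintro rfl
      exact hk hl
    · rintro rfl
      exact hl (Function.update_self ..)
  · exact (hB.not_rootClass hπ (fun k _ => hg k) hc hx h).elim

theorem goodRad_self : GoodRad F F q ∅ := fun _ hπ _ => radAt_gaussian hπ

theorem isIntegral_gaussian (z : GaussianInt) :
    IsIntegral ℤ (algebraMap F E (algebraMap GaussianInt F z)) := by
  obtain ⟨φ, hφ, -⟩ := exists_gaussianInt_hom F E
  rw [← hφ]
  exact RingOfIntegers.isIntegral_coe _

variable {L : Type*} [Field L] [NumberField L] [Algebra E L] [Algebra F L] [IsScalarTower F E L]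
  [Algebra.IsQuadraticExtension E L]

theorem GoodRad.mono {B B' : Finset (Fin 6)} (hB : GoodRad F E q B) (h : B ⊆ B') :
    GoodRad F E q B' := fun π hπ hk => hB π hπ fun k hk' => hk k (h hk')

theorem GoodRad.sqrt {B : Finset (Fin 6)} (hB : GoodRad F E q B)
    (hB1 : 1 ∈ B) {v : Fin 6 → ZMod 2} (hv : ∀ k, v k ≠ 0 → k ∈ B) {s : L}
    (hs : s ^ 2 = algebraMap E L (algebraMap F E (gaussEl F q v)))
    (hs' : ∀ y, algebraMap E L y ≠ s) : GoodRad F L q B := by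
  intro π hπ hk
  have h2 : ¬ π ∣ 2 * gaussProd q v := by
    intro h
    rcases hπ.dvd_or_dvd h with h | h
    · rw [show (2 : GaussianInt) = ⟨0, -1⟩ * ⟨1, 1⟩ ^ 2 by decide] at h
      rcases hπ.dvd_or_dvd h with h | h
      · exact hπ.not_isUnit (isUnit_of_dvd_unit h (IsUnit.of_mul_eq_one ⟨0, 1⟩ (by decide)))
      · exact hk 1 hB1 (hπ.dvd_of_dvd_pow h)
    · exact prime_not_dvd_gaussProd hπ (fun k hk' => hk k (hv k hk')) h
  obtain ⟨A, C, hAC⟩ := isCoprime_of_prime hπ h2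
  rw [IsScalarTower.algebraMap_apply F E L]
  refine (hB π hπ hk).extend_sqrt ?_ (isIntegral_gaussian _) hs hs' (isIntegral_gaussian _)
    (isIntegral_gaussian (F := F) A) (isIntegral_gaussian (F := F) C) ?_
  · exact (map_ne_zero_iff _ (FaithfulSMul.algebraMap_injective F E)).2
      ((map_ne_zero_iff _ (IsFractionRing.injective GaussianInt F)).2 hπ.ne_zero)
  · have := congrArg (fun z => algebraMap F E (algebraMap GaussianInt F z)) hAC
    have e : algebraMap GaussianInt F 2 = 2 := map_ofNat _ 2
    have e' : algebraMap F E 2 = 2 := map_ofNat _ 2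
    simpa [gaussEl, e, e'] using this

theorem GoodRad.sqrt_of_sq_mod_four {B : Finset (Fin 6)} (hB : GoodRad F E q B)
    {v : Fin 6 → ZMod 2} (hv : ∀ k, v k ≠ 0 → k ∈ B) {r : GaussianInt} (hr : 4 ∣ r ^ 2 - gaussProd q v)
    {s : L} (hs : s ^ 2 = algebraMap E L (algebraMap F E (gaussEl F q v)))
    (hs' : ∀ y, algebraMap E L y ≠ s) : GoodRad F L q B := by
  intro π hπ hk
  obtain ⟨A, C, hAC⟩ := isCoprime_of_prime hπ (prime_not_dvd_gaussProd hπ fun k hk' => hk k (hv k hk'))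
  obtain ⟨k, hk⟩ := hr
  rw [IsScalarTower.algebraMap_apply F E L]
  refine (hB π hπ ‹_›).extend_half ?_ (isIntegral_gaussian _) hs hs' (isIntegral_gaussian _)
    (isIntegral_gaussian (F := F) A) (isIntegral_gaussian (F := F) C)
    (isIntegral_gaussian (F := F) k) (isIntegral_gaussian (F := F) r) ?_ ?_
  · exact (map_ne_zero_iff _ (FaithfulSMul.algebraMap_injective F E)).2
      ((map_ne_zero_iff _ (IsFractionRing.injective GaussianInt F)).2 hπ.ne_zero)
  · have := congrArg (fun z => algebraMap F E (algebraMap GaussianInt F z)) (sub_eq_iff_eq_add'.1 hk)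
    have e : algebraMap GaussianInt F 4 = 4 := map_ofNat _ 4
    have e' : algebraMap F E 4 = 4 := map_ofNat _ 4
    simpa [gaussEl, e, e'] using this
  · have := congrArg (fun z => algebraMap F E (algebraMap GaussianInt F z)) hAC
    simpa [gaussEl] using this

end GoodRad

section UnitClasses

open NumberField.Units

variable (E : Type*) [Field E] [NumberField E]

theorem exists_unit_sq_of_sqEquiv {ε η : (𝓞 E)ˣ}
    (h : SqEquiv E (algebraMap (𝓞 E) E ε) (algebraMap (𝓞 E) E η)) : ∃ θ : (𝓞 E)ˣ, ε = η * θ ^ 2 := by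
  obtain ⟨c, hc, h⟩ := h
  have h1 : algebraMap (𝓞 E) E ((η⁻¹ * ε : (𝓞 E)ˣ) : 𝓞 E) = c ^ 2 := by
    have h2 : algebraMap (𝓞 E) E ((η⁻¹ : (𝓞 E)ˣ) : 𝓞 E) * algebraMap (𝓞 E) E (η : 𝓞 E) = 1 := by
      rw [← map_mul, ← Units.val_mul, inv_mul_cancel, Units.val_one, map_one]
    rw [Units.val_mul, map_mul, h, ← mul_assoc, h2, one_mul]
  have hci : IsIntegral ℤ c := IsIntegral.of_pow two_pos (h1 ▸ RingOfIntegers.isIntegral_coe _)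
  obtain ⟨θ, rfl⟩ : ∃ θ : 𝓞 E, algebraMap (𝓞 E) E θ = c := ⟨⟨c, hci⟩, rfl⟩
  rw [← map_pow] at h1
  have h3 := RingOfIntegers.coe_injective h1
  have hu : IsUnit θ := by
    rw [← isUnit_pow_iff two_ne_zero, ← h3]
    exact Units.isUnit _
  refine ⟨hu.unit, ?_⟩
  rw [← inv_mul_eq_iff_eq_mul]
  ext
  rw [h3]
  rfl

theorem exists_torsion_not_sq : ∃ ζ : torsion E, ∀ ξ : torsion E, ζ ≠ ξ ^ 2 := by
  by_contra! h
  have hs : Function.Surjective fun ξ : torsion E => ξ ^ 2 := fun ζ => (h ζ).imp fun _ h => h.symm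
  have hi := Finite.injective_iff_surjective.2 hs
  have hm : (-1 : (𝓞 E)ˣ) ∈ torsion E := by
    refine (CommGroup.mem_torsion _).2 (isOfFinOrder_iff_pow_eq_one.2 ⟨2, two_pos, by norm_num⟩)
  have h1 : (⟨-1, hm⟩ : torsion E) = 1 := hi (by ext; simp)
  have h2 : (-1 : 𝓞 E) = 1 := by
    have := congrArg (fun z : torsion E => ((z : (𝓞 E)ˣ) : 𝓞 E)) h1
    simpa using this
  norm_num at h2

theorem exists_units_not_sqEquiv : ∃ ψ : (Fin (rank E) → ZMod 2) × ZMod 2 → (𝓞 E)ˣ,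
    ∀ v w, SqEquiv E (algebraMap (𝓞 E) E (ψ v)) (algebraMap (𝓞 E) E (ψ w)) → v = w := by
  obtain ⟨ζ, hζ⟩ := exists_torsion_not_sq E
  refine ⟨fun v => ((ζ ^ v.2.val : torsion E) : (𝓞 E)ˣ) * ∏ i, fundSystem E i ^ ((v.1 i).val : ℤ),
    fun v w h => ?_⟩
  obtain ⟨θ, hθ⟩ := exists_unit_sq_of_sqEquiv E h
  obtain ⟨⟨ξ, m⟩, hm, -⟩ := exist_unique_eq_mul_prod E θ
  simp only at hm hθ
  have key : (((ζ ^ v.2.val : torsion E) : (𝓞 E)ˣ) * ∏ i, fundSystem E i ^ ((v.1 i).val : ℤ)) =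
      ((ζ ^ w.2.val * ξ ^ 2 : torsion E) : (𝓞 E)ˣ) *
        ∏ i, fundSystem E i ^ (((w.1 i).val : ℤ) + m i * 2) := by
    rw [hθ, hm]
    simp only [zpow_add, Finset.prod_mul_distrib, Subgroup.coe_mul, Subgroup.coe_pow, mul_pow,
      ← Finset.prod_pow, zpow_mul, zpow_ofNat]
    simp only [← zpow_natCast, ← zpow_mul]
    push_cast
    simp only [mul_assoc, mul_left_comm]
  obtain ⟨z, -, hz⟩ := exist_unique_eq_mul_prod E
    (((ζ ^ v.2.val : torsion E) : (𝓞 E)ˣ) * ∏ i, fundSystem E i ^ ((v.1 i).val : ℤ))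
  have e := (hz (_, fun i => ((v.1 i).val : ℤ)) rfl).trans
    (hz (_, fun i => ((w.1 i).val : ℤ) + m i * 2) key).symm
  rw [Prod.mk.injEq] at e
  obtain ⟨e1, e2⟩ := e
  refine Prod.ext (funext fun i => ?_) ?_
  · have := congrFun e2 i
    have h1 := (v.1 i).val_lt
    have h2 := (w.1 i).val_lt
    exact ZMod.val_injective 2 (by omega)
  · have two : ∀ z : ZMod 2, z.val = 0 ∨ z.val = 1 := by decide
    refine ZMod.val_injective 2 ?_
    rcases two v.2 with hv | hv <;> rcases two w.2 with hw | hw <;> rw [hv, hw] at e1 ⊢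
    · exfalso
      refine hζ (ξ⁻¹) ?_
      rw [pow_zero, pow_one] at e1
      rw [inv_pow, eq_inv_iff_mul_eq_one, ← e1]
    · exfalso
      refine hζ ξ ?_
      rw [pow_zero, pow_one, one_mul] at e1
      exact e1

theorem exists_unit_not_sqEquiv (hr : 0 < rank E) (x y : E) : ∃ ε : (𝓞 E)ˣ,
    ¬ SqEquiv E (algebraMap (𝓞 E) E ε) x ∧ ¬ SqEquiv E (algebraMap (𝓞 E) E ε) y := by
  obtain ⟨ψ, hψ⟩ := exists_units_not_sqEquiv E
  by_contra! h
  have h1 := h (ψ (0, 0))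
  have h2 := h (ψ (0, 1))
  have h3 := h (ψ (fun _ => 1, 0))
  have n1 : ((0, 0) : (Fin (rank E) → ZMod 2) × ZMod 2) ≠ (0, 1) := by simp
  have n2 : ((0, 0) : (Fin (rank E) → ZMod 2) × ZMod 2) ≠ (fun _ => 1, 0) := by
    intro h
    have := congrFun (congrArg Prod.fst h) ⟨0, hr⟩
    simp at this
  have n3 : ((0, 1) : (Fin (rank E) → ZMod 2) × ZMod 2) ≠ (fun _ => 1, 0) := by simp
  have key : ∀ v w z, SqEquiv E (algebraMap (𝓞 E) E (ψ v)) z →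
      SqEquiv E (algebraMap (𝓞 E) E (ψ w)) z → v = w := fun v w z h h' => hψ v w (h.trans h'.symm)
  by_cases c1 : SqEquiv E (algebraMap (𝓞 E) E (ψ (0, 0))) x <;>
    by_cases c2 : SqEquiv E (algebraMap (𝓞 E) E (ψ (0, 1))) x <;>
    by_cases c3 : SqEquiv E (algebraMap (𝓞 E) E (ψ (fun _ => 1, 0))) x
  · exact n1 (key _ _ _ c1 c2)
  · exact n1 (key _ _ _ c1 c2)
  · exact n2 (key _ _ _ c1 c3)
  · exact n3 (key _ _ _ (h2 c2) (h3 c3))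
  · exact n3 (key _ _ _ c2 c3)
  · exact n2 (key _ _ _ (h1 c1) (h3 c3))
  · exact n1 (key _ _ _ (h1 c1) (h2 c2))
  · exact n1 (key _ _ _ (h1 c1) (h2 c2))

variable {E}

theorem two_mul_rank_add_one {i : E} (hi : i ^ 2 = -1) :
    2 * (rank E + 1) = Module.finrank ℚ E := by
  have hc : IsTotallyComplex E := ⟨fun v => by
    rw [← InfinitePlace.not_isReal_iff_isComplex]
    intro hv
    have h1 := congrArg (InfinitePlace.embedding_of_isReal hv) hi
    rw [map_pow, map_neg, map_one] at h1
    nlinarith [sq_nonneg (InfinitePlace.embedding_of_isReal hv i)]⟩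
  have h1 := IsTotallyComplex.finrank E
  have h2 := InfinitePlace.card_eq_nrRealPlaces_add_nrComplexPlaces E
  rw [IsTotallyComplex.nrRealPlaces_eq_zero E] at h2
  have h3 : 0 < Fintype.card (InfinitePlace E) := Fintype.card_pos
  rw [h1, rank]
  omega

end UnitClasses

section QuadField

open scoped nonZeroDivisors

theorem SqEquiv.of_mul {E : Type*} [Field E] {x y z : E} (hy : y ≠ 0) (h : SqEquiv E (x * y) z) :
    SqEquiv E x (z * y) := by
  obtain ⟨c, hc, h⟩ := h
  refine ⟨c * y⁻¹, mul_ne_zero hc (inv_ne_zero hy), ?_⟩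
  field_simp
  linear_combination h

theorem residLin_add (a t u : ZMod 2) (j : Fin 4) (v w : Fin 6 → ZMod 2) :
    residLin a t u j (v + w) = residLin a t u j v + residLin a t u j w := by
  simp [residLin, add_mul, Finset.sum_add_distrib]

theorem hilb_add (a t u : ZMod 2) (j : Fin 4) (D v w : Fin 6 → ZMod 2) :
    hilb a t u j D (v + w) = hilb a t u j D v + hilb a t u j D w := by
  simp only [hilb, residLin_add, Pi.add_apply]
  ring

theorem hilb_self (a t u : ZMod 2) (j : Fin 4) (D : Fin 6 → ZMod 2) : hilb a t u j D D = 0 :=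
  CharTwo.add_self_eq_zero _

/-- All Hilbert symbols of two products vanish. -/
def HilbZero (a t u : ZMod 2) (D v : Fin 6 → ZMod 2) : Prop := ∀ j, hilb a t u j D v = 0

theorem HilbZero.add {a t u : ZMod 2} {D v w : Fin 6 → ZMod 2} (hv : HilbZero a t u D v)
    (hw : HilbZero a t u D w) : HilbZero a t u D (v + w) := fun j => by
  rw [hilb_add, hv j, hw j, add_zero]

/-- The Hilbert symbols of a product, or of the imaginary unit times it, vanish. -/
def HilbUnit (a t u : ZMod 2) (D v : Fin 6 → ZMod 2) : Prop :=
  HilbZero a t u D v ∨ HilbZero a t u D (v + Pi.single 0 1)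

theorem zmod_two_add_self {ι : Type*} (v : ι → ZMod 2) : v + v = 0 :=
  funext fun _ => CharTwo.add_self_eq_zero _

theorem HilbUnit.add {a t u : ZMod 2} {D v w : Fin 6 → ZMod 2} (hv : HilbUnit a t u D v)
    (hw : HilbUnit a t u D w) : HilbUnit a t u D (v + w) := by
  rcases hv with hv | hv <;> rcases hw with hw | hw
  · exact .inl (hv.add hw)
  · exact .inr (add_assoc v w _ ▸ hv.add hw)
  · exact .inr (add_right_comm v _ w ▸ hv.add hw)
  · refine .inl ?_
    have := hv.add hw
    rwa [add_add_add_comm, zmod_two_add_self, add_zero] at this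

/-- The quadratic extension `K` of the Gaussian numbers `F` generated by a square root `s` of
`gaussEl F q D`, unramified outside the generators in `B`. -/
structure QuadField (F K : Type*) [Field F] [NumberField F] [Algebra GaussianInt F] [Field K]
    [NumberField K] [Algebra F K] (q : Fin 4 → GaussianInt) (a t u : ZMod 2)
    (D : Fin 6 → ZMod 2) (B : Finset (Fin 6)) (s : K) : Prop where
  sq : s ^ 2 = algebraMap F K (gaussEl F q D)
  ne : ∀ y : F, algebraMap F K y ≠ s
  rad : GoodRad F K q B
  zero_mem : 0 ∈ B
  supp : ∀ k ∉ B, D k = 0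
  not_hilbZero : ¬ HilbZero a t u D (Pi.single 0 1)
  small : ∃ k₀ k₁ : Fin 6, ∀ v : Fin 6 → ZMod 2, (∀ k ∉ B, v k = 0) → HilbUnit a t u D v →
    v k₀ = v k₁ →
    v = 0 ∨ v = Pi.single 0 1 ∨ v = D ∨ v = Pi.single 0 1 + D
  rank_pos : 0 < Units.rank K

variable {q : Fin 4 → GaussianInt} {a t u : ZMod 2}
variable {F : Type*} [Field F] [NumberField F] [Algebra GaussianInt F]
  [IsFractionRing GaussianInt F]
variable {K : Type*} [Field K] [NumberField K] [Algebra F K] [Algebra.IsQuadraticExtension F K]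
variable {D : Fin 6 → ZMod 2} {B : Finset (Fin 6)} {s : K}

theorem PrimeData.sqEquiv_mul (H : PrimeData q a t u) {x y : F} {v w : Fin 6 → ZMod 2}
    (hx : SqEquiv F x (gaussEl F q v)) (hy : SqEquiv F y (gaussEl F q w)) :
    SqEquiv F (x * y) (gaussEl F q (v + w)) := (hx.mul hy).trans (H.gaussEl_add v w)

theorem PrimeData.gauss_of_sqEquiv (H : PrimeData q a t u) (hs : s ^ 2 = algebraMap F K (gaussEl F q D))
    (hs' : ∀ y : F, algebraMap F K y ≠ s) {b : F} {v : Fin 6 → ZMod 2}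
    (h : SqEquiv K (algebraMap F K b) (algebraMap F K (gaussEl F q v))) :
    SqEquiv F b (gaussEl F q v) ∨ SqEquiv F b (gaussEl F q (v + D)) := by
  have hv := H.gaussEl_ne_zero (F := F) v
  have h1 : SqEquiv K (algebraMap F K (b * gaussEl F q v)) 1 := by
    rw [map_mul]
    exact (SqEquiv.mul_one_iff (by simpa using hv)).2 h
  rcases sqEquiv_one_of_algebraMap hs hs' h1 with h2 | h2
  · exact .inl ((SqEquiv.mul_one_iff hv).1 h2)
  · refine .inr ((h2.of_mul hv).trans ?_)
    rw [mul_comm]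
    exact H.gaussEl_add v D

theorem QuadField.norm_sqEquiv_one (Q : QuadField F K q a t u D B s) (H : PrimeData q a t u)
    {x : K} {κ : ClassGroup (𝓞 K)} (h : RootClass K x κ) :
    SqEquiv F (Algebra.norm F x) 1 := by
  rcases (h.norm (K := F)).gauss.2 with h1 | h1
  · exact h1
  · rw [← gaussEl_e0 (q := q)] at h1
    exact absurd (H.hilb_of_norm Q.sq Q.ne h1) Q.not_hilbZero

theorem QuadField.exists_sqEquiv (Q : QuadField F K q a t u D B s) (H : PrimeData q a t u)
    {x : K} {κ : ClassGroup (𝓞 K)} (h : RootClass K x κ) : ∃ v : Fin 6 → ZMod 2,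
      (∀ k ∉ B, v k = 0) ∧ SqEquiv K x (algebraMap F K (gaussEl F q v)) := by
  obtain ⟨c, hc, h1⟩ := Q.norm_sqEquiv_one H h
  rw [one_mul] at h1
  obtain ⟨b, z, hb, hz, hx, -⟩ := exists_sqEquiv_of_norm_eq_sq h.ne_zero h1
  obtain ⟨v, hv, hbv⟩ := H.exists_sqEquiv_of_rootClass Q.zero_mem Q.rad (h.congr hx)
  exact ⟨v, hv, hx.trans (hbv.map _)⟩

theorem QuadField.hilbUnit_of_unit (Q : QuadField F K q a t u D B s) (H : PrimeData q a t u)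
    {ε : (𝓞 K)ˣ} {v : Fin 6 → ZMod 2}
    (h : SqEquiv K (algebraMap (𝓞 K) K ε) (algebraMap F K (gaussEl F q v))) :
    HilbUnit a t u D v := by
  have h0 := Q.norm_sqEquiv_one H (RootClass.unit ε)
  obtain ⟨θ, hθ⟩ := exists_unit_sq_of_sqEquiv F (ε := Units.map (RingOfIntegers.norm F) ε) (η := 1)
    (by simpa using h0)
  have h1 : Algebra.norm F (algebraMap (𝓞 K) K ε) = (algebraMap (𝓞 F) F θ) ^ 2 := by
    have := congrArg (fun z : (𝓞 F)ˣ => algebraMap (𝓞 F) F z) hθ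
    simpa using this
  obtain ⟨b, z, hb, hz, hx, hn⟩ := exists_sqEquiv_of_norm_eq_sq (RootClass.unit ε).ne_zero h1
  have hn' : SqEquiv F (Algebra.norm F z) (b * algebraMap (𝓞 F) F θ) := by
    rcases hn with hn | hn
    · rw [hn]
      exact .refl _
    · rw [hn]
      exact (sqEquiv_neg F _).symm
  have hθ : ∃ w : Fin 6 → ZMod 2, (w = 0 ∨ w = Pi.single 0 1) ∧
      SqEquiv F (algebraMap (𝓞 F) F θ) (gaussEl F q w) := by
    rcases (RootClass.unit θ).gauss.2 with h2 | h2
    · exact ⟨0, .inl rfl, by rwa [gaussEl_zero]⟩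
    · exact ⟨_, .inr rfl, by rwa [gaussEl_e0]⟩
  obtain ⟨w, hw, hθw⟩ := hθ
  have hD : HilbZero a t u D D := fun j => hilb_self _ _ _ _ _
  have key : HilbZero a t u D (v + w) := by
    rcases H.gauss_of_sqEquiv Q.sq Q.ne (hx.symm.trans h) with hb | hb
    · exact H.hilb_of_norm Q.sq Q.ne (hn'.trans (H.sqEquiv_mul hb hθw))
    · have h3 : HilbZero a t u D (v + D + w) :=
        H.hilb_of_norm Q.sq Q.ne (hn'.trans (H.sqEquiv_mul hb hθw))
      have := h3.add hD
      rwa [add_right_comm v D w, add_assoc (v + w), zmod_two_add_self, add_zero] at this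
  rcases hw with rfl | rfl
  · exact .inl (by rwa [add_zero] at key)
  · exact .inr key

omit [Algebra.IsQuadraticExtension F K] in
theorem QuadField.exists_unit_of_trivial (Q : QuadField F K q a t u D B s)
    (H : PrimeData q a t u) {v : Fin 6 → ZMod 2}
    (h : v = 0 ∨ v = Pi.single 0 1 ∨ v = D ∨ v = Pi.single 0 1 + D) :
    ∃ ε : (𝓞 K)ˣ, SqEquiv K (algebraMap (𝓞 K) K ε) (algebraMap F K (gaussEl F q v)) ∧
      (SqEquiv K (algebraMap (𝓞 K) K ε) 1 ∨
        SqEquiv K (algebraMap (𝓞 K) K ε) (algebraMap F K (gaussI F))) := by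
  have hs0 : s ≠ 0 := by
    rintro rfl
    exact Q.ne 0 (map_zero _)
  have hD : SqEquiv K 1 (algebraMap F K (gaussEl F q D)) := by
    rw [← Q.sq]
    exact (SqEquiv.sq_one hs0).symm
  have hi : RootClass K (algebraMap F K (gaussI F)) 1 := by
    have h2 := (RootClass.unit (E := F) (1 : (𝓞 F)ˣ))
    have hint : IsIntegral ℤ (algebraMap F K (gaussI F)) := by
      refine IsIntegral.of_pow (n := 4) (by norm_num) ?_
      rw [show (algebraMap F K (gaussI F)) ^ 4 = algebraMap F K ((gaussI F ^ 2) ^ 2) by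
        rw [map_pow, map_pow]; ring, gaussI_sq]
      simpa using isIntegral_one
    have e : (⟨_, hint⟩ : 𝓞 K) ^ 4 = 1 := by
      apply RingOfIntegers.coe_injective
      change (algebraMap F K (gaussI F)) ^ 4 = 1
      rw [show (algebraMap F K (gaussI F)) ^ 4 = algebraMap F K ((gaussI F ^ 2) ^ 2) by
        rw [map_pow, map_pow]; ring, gaussI_sq]
      simp
    exact RootClass.unit (Units.ofPowEqOne (⟨_, hint⟩ : 𝓞 K) 4 e (by norm_num))
  obtain ⟨η, hη⟩ := hi.exists_unit
  have hsum : SqEquiv K (algebraMap F K (gaussI F))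
      (algebraMap F K (gaussEl F q (Pi.single 0 1 + D))) := by
    have h1 := (H.gaussEl_add (F := F) (Pi.single 0 1) D).map (algebraMap F K)
    rw [map_mul, gaussEl_e0] at h1
    have h2 := (SqEquiv.refl (algebraMap F K (gaussI F))).mul hD
    rw [mul_one] at h2
    exact h2.trans h1
  rcases h with rfl | rfl | rfl | rfl
  · refine ⟨1, ?_, .inl ?_⟩
    · simpa [gaussEl_zero] using SqEquiv.refl (1 : K)
    · simpa using SqEquiv.refl (1 : K)
  · exact ⟨η, by rw [gaussEl_e0]; exact hη.symm, .inr hη.symm⟩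
  · refine ⟨1, by simpa using hD, .inl ?_⟩
    simpa using SqEquiv.refl (1 : K)
  · exact ⟨η, hη.symm.trans hsum, .inr hη.symm⟩

theorem QuadField.exists_unit (Q : QuadField F K q a t u D B s) (H : PrimeData q a t u)
    {v : Fin 6 → ZMod 2} (hv : ∀ k ∉ B, v k = 0) (h : HilbUnit a t u D v) :
    ∃ ε : (𝓞 K)ˣ, SqEquiv K (algebraMap (𝓞 K) K ε) (algebraMap F K (gaussEl F q v)) := by
  obtain ⟨ε₀, h1, h2⟩ := exists_unit_not_sqEquiv K Q.rank_pos 1 (algebraMap F K (gaussI F))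
  obtain ⟨w, hw, hε⟩ := Q.exists_sqEquiv H (RootClass.unit ε₀)
  have hwu := Q.hilbUnit_of_unit H hε
  obtain ⟨k₀, k₁, hk⟩ := Q.small
  have two : ∀ x y z w : ZMod 2, x = y ∨ z = w ∨ x + z = y + w := by decide
  rcases two (v k₀) (v k₁) (w k₀) (w k₁) with h3 | h3 | h3
  · obtain ⟨ε, hε, -⟩ := Q.exists_unit_of_trivial H (hk v hv h h3)
    exact ⟨ε, hε⟩
  · obtain ⟨ε, hε', h4⟩ := Q.exists_unit_of_trivial H (hk w hw hwu h3)
    have h5 := hε.trans hε'.symm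
    rcases h4 with h4 | h4
    · exact absurd (h5.trans h4) h1
    · exact absurd (h5.trans h4) h2
  · obtain ⟨ε, hε', -⟩ := Q.exists_unit_of_trivial H (v := v + w)
      (hk _ (fun k hkB => by simp [hv k hkB, hw k hkB]) (h.add hwu) h3)
    refine ⟨ε * ε₀, ?_⟩
    have h4 := (hε'.mul hε).trans (by
      rw [← map_mul]
      exact (H.gaussEl_add (v + w) w).map _)
    rw [add_assoc, zmod_two_add_self, add_zero] at h4
    simpa using h4

omit [Algebra GaussianInt F] [IsFractionRing GaussianInt F] in
theorem RootClass.exists_norm_of_sq {g : F} (hg : g ≠ 0) {c : ClassGroup (𝓞 K)}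
    (h : RootClass K (algebraMap F K g) (c ^ 2)) :
    ∃ (w : K) (κ : ClassGroup (𝓞 F)), RootClass F (g * Algebra.norm F w) κ := by
  obtain ⟨x, b, J, hx, hb, hxb, hJ, hc⟩ := h
  obtain ⟨I, rfl⟩ := ClassGroup.mk0_surjective c
  rw [← map_pow, ClassGroup.mk0_eq_mk0_iff] at hc
  obtain ⟨r, y, hr, hy, hrj⟩ := hc
  set N : 𝓞 K →* 𝓞 F := Algebra.intNorm (𝓞 F) (𝓞 K) with hN
  have hNc : ∀ z : 𝓞 K, algebraMap (𝓞 F) F (N z) = Algebra.norm F (algebraMap (𝓞 K) K z) :=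
    fun z => Algebra.algebraMap_intNorm (L := K) z
  have h1 : Ideal.span {r ^ 2 * b} = (Ideal.span {y} * (I : Ideal (𝓞 K)) ^ 2) ^ 2 := by
    rw [← Ideal.span_singleton_mul_span_singleton, ← Ideal.span_singleton_pow, hJ, ← mul_pow, hrj]
    rfl
  have h2 : algebraMap F K g * algebraMap (𝓞 K) K (r * x) ^ 2 = algebraMap (𝓞 K) K (r ^ 2 * b) := by
    rw [map_mul _ (r ^ 2), ← hxb, map_mul, map_pow]
    ring
  have h3 : g ^ 2 * Algebra.norm F (algebraMap (𝓞 K) K (r * x)) ^ 2 =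
      algebraMap (𝓞 F) F (N (r ^ 2 * b)) := by
    rw [hNc, ← h2, map_mul (Algebra.norm F), map_pow (Algebra.norm F), Algebra.norm_algebraMap,
      Algebra.IsQuadraticExtension.finrank_eq_two]
  have h4 : (g * Algebra.norm F (algebraMap (𝓞 K) K (r * x))) ^ 2 =
      algebraMap (𝓞 F) F (N (r ^ 2 * b)) := by rw [mul_pow, h3]
  have hint : IsIntegral ℤ (g * Algebra.norm F (algebraMap (𝓞 K) K (r * x))) :=
    IsIntegral.of_pow two_pos (h4 ▸ RingOfIntegers.isIntegral_coe _)
  obtain ⟨m, hm⟩ : ∃ m : 𝓞 F, algebraMap (𝓞 F) F m =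
    g * Algebra.norm F (algebraMap (𝓞 K) K (r * x)) := ⟨⟨_, hint⟩, rfl⟩
  have h5 : m ^ 2 = N (r ^ 2 * b) := by
    apply RingOfIntegers.coe_injective
    rw [map_pow, hm, h4]
  have h6 : Ideal.span {m} = Ideal.span {N y} * Ideal.relNorm (𝓞 F) (I : Ideal (𝓞 K)) ^ 2 := by
    refine Ideal.pow_left_injective_of_isDedekindDomain two_ne_zero ?_
    rw [Ideal.span_singleton_pow, h5, ← Ideal.relNorm_singleton, h1, map_pow, map_mul, map_pow,
      Ideal.relNorm_singleton]
  have hNy : N y ≠ 0 := Algebra.intNorm_ne_zero.2 hy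
  have hm0 : m ≠ 0 := by
    intro h0
    have h7 : N (r ^ 2 * b) ≠ 0 :=
      Algebra.intNorm_ne_zero.2 (mul_ne_zero (pow_ne_zero 2 hr) hb)
    rw [← h5, h0] at h7
    simp at h7
  have hNy' : Ideal.span {N y} ≠ 0 := by simpa [Ideal.span_singleton_eq_bot] using hNy
  refine ⟨algebraMap (𝓞 K) K (r * x) * algebraMap (𝓞 K) K y, _, 1, m * N y,
    ⟨Ideal.span {N y}, mem_nonZeroDivisors_of_ne_zero hNy'⟩ * normIdeal F I, one_ne_zero,
    mul_ne_zero hm0 hNy, ?_, ?_, rfl⟩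
  · rw [map_mul, ← mul_assoc, ← hm, ← hNc y, ← map_mul, map_one, one_pow, mul_one]
  · rw [← Ideal.span_singleton_mul_span_singleton, h6]
    change _ = (Ideal.span {N y} * Ideal.relNorm (𝓞 F) (I : Ideal (𝓞 K))) ^ 2
    ring

theorem QuadField.sq_eq_one_of_pow_four (Q : QuadField F K q a t u D B s)
    (H : PrimeData q a t u) {c : ClassGroup (𝓞 K)} (hc : c ^ 4 = 1) : c ^ 2 = 1 := by
  obtain ⟨x, hx⟩ := RootClass.exists_of_sq_eq_one (c := c ^ 2) (by rw [← pow_mul]; exact hc)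
  obtain ⟨v, hv, hxv⟩ := Q.exists_sqEquiv H hx
  have hg := H.gaussEl_ne_zero (F := F) v
  obtain ⟨w, κ, hw⟩ := (hx.congr hxv).exists_norm_of_sq hg
  have h1 : HilbUnit a t u D v := by
    rcases hw.gauss.2 with h | h
    · rw [mul_comm] at h
      have := h.of_mul hg
      rw [one_mul] at this
      exact .inl (H.hilb_of_norm Q.sq Q.ne this)
    · rw [mul_comm] at h
      have := h.of_mul hg
      rw [← gaussEl_e0 (q := q)] at this
      refine .inr (H.hilb_of_norm Q.sq Q.ne (this.trans ?_))
      rw [mul_comm]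
      exact H.gaussEl_add _ _
  obtain ⟨ε, hε⟩ := Q.exists_unit H hv h1
  exact hx.eq_one_of_unit ε (hxv.trans hε.symm)

end QuadField

section Radicands

/-- The exponents of `π₁π₃`. -/
def radOne : Fin 6 → ZMod 2 := ![0, 0, 1, 0, 1, 0]

/-- The exponents of `iπ₂π₄`. -/
def radTwo : Fin 6 → ZMod 2 := ![1, 0, 0, 1, 0, 1]

/-- The exponents of `ip₁p₂`. -/
def radThree : Fin 6 → ZMod 2 := ![1, 0, 1, 1, 1, 1]

theorem vec_eta_six (v : Fin 6 → ZMod 2) : v = ![v 0, v 1, v 2, v 3, v 4, v 5] := by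
  ext i
  fin_cases i <;> rfl

theorem residLin_eq (a t u : ZMod 2) (v : Fin 6 → ZMod 2) (j : Fin 4) : residLin a t u j v = ![
    v 0 + v 1 * t + v 3 + v 4 * a + v 5 * a, v 0 + v 1 * (t + 1) + v 2 + v 4 * a + v 5 * a,
    v 0 + v 1 * u + v 2 * a + v 3 * a + v 5, v 0 + v 1 * (u + 1) + v 2 * a + v 3 * a + v 4] j := by
  fin_cases j <;> simp [residLin, Fin.sum_univ_six, residTable]

/-- The character of the exponents which detects the nontrivial ambiguous class. -/
def ambChar (t u : ZMod 2) (v : Fin 6 → ZMod 2) : ZMod 2 := v 3 + v 5 + v 1 * (t + u)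

theorem ambChar_add (t u : ZMod 2) (v w : Fin 6 → ZMod 2) :
    ambChar t u (v + w) = ambChar t u v + ambChar t u w := by
  simp only [ambChar, Pi.add_apply]
  ring

instance (a t u : ZMod 2) (D v : Fin 6 → ZMod 2) : Decidable (HilbZero a t u D v) :=
  inferInstanceAs (Decidable (∀ _, _))

instance (a t u : ZMod 2) (D v : Fin 6 → ZMod 2) : Decidable (HilbUnit a t u D v) :=
  inferInstanceAs (Decidable (_ ∨ _))

theorem not_hilbZero_radOne : ∀ a t u, ¬ HilbZero a t u radOne (Pi.single 0 1) := by decide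

theorem not_hilbZero_radTwo : ∀ a t u, ¬ HilbZero a t u radTwo (Pi.single 0 1) := by decide

theorem not_hilbZero_radThree : ∀ a t u, ¬ HilbZero a t u radThree (Pi.single 0 1) := by decide

theorem eq_vec_of_radOne {v : Fin 6 → ZMod 2} (hv : ∀ k ∉ ({0, 2, 4} : Finset (Fin 6)), v k = 0) :
    v = ![v 0, 0, v 2, 0, v 4, 0] := by
  conv_lhs => rw [vec_eta_six v, hv 1 (by decide), hv 3 (by decide), hv 5 (by decide)]

theorem eq_vec_of_radTwo {v : Fin 6 → ZMod 2}
    (hv : ∀ k ∉ ({0, 1, 3, 5} : Finset (Fin 6)), v k = 0) : v = ![v 0, v 1, 0, v 3, 0, v 5] := by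
  conv_lhs => rw [vec_eta_six v, hv 2 (by decide), hv 4 (by decide)]

theorem small_radOne (a t u : ZMod 2) (v : Fin 6 → ZMod 2)
    (hv : ∀ k ∉ ({0, 2, 4} : Finset (Fin 6)), v k = 0) (_ : HilbUnit a t u radOne v)
    (h0 : v 2 = v 4) : v = 0 ∨ v = Pi.single 0 1 ∨ v = radOne ∨ v = Pi.single 0 1 + radOne := by
  rw [eq_vec_of_radOne hv, h0]
  generalize v 0 = x
  generalize v 4 = y
  revert x y
  decide

theorem small_radTwo (a t u : ZMod 2) (v : Fin 6 → ZMod 2)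
    (hv : ∀ k ∉ ({0, 1, 3, 5} : Finset (Fin 6)), v k = 0) (h : HilbUnit a t u radTwo v)
    (h0 : v 1 = v 2) : v = 0 ∨ v = Pi.single 0 1 ∨ v = radTwo ∨ v = Pi.single 0 1 + radTwo := by
  rw [hv 2 (by decide)] at h0
  rw [eq_vec_of_radTwo hv, h0] at h ⊢
  generalize v 0 = x at h ⊢
  generalize v 3 = y at h ⊢
  generalize v 5 = z at h ⊢
  revert x y z a t u
  decide +kernel

theorem small_radThree (a t u : ZMod 2) (v : Fin 6 → ZMod 2)
    (h : HilbUnit a t u radThree v) (h0 : v 2 = v 3) :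
    v = 0 ∨ v = Pi.single 0 1 ∨ v = radThree ∨ v = Pi.single 0 1 + radThree := by
  rw [vec_eta_six v, h0] at h ⊢
  generalize v 0 = x at h ⊢
  generalize v 1 = x' at h ⊢
  generalize v 3 = y at h ⊢
  generalize v 4 = y' at h ⊢
  generalize v 5 = z at h ⊢
  revert x x' y y' z a t u
  decide +kernel

theorem ambChar_eq_zero_of_radTwo (a t u : ZMod 2) (v : Fin 6 → ZMod 2)
    (hv : ∀ k ∉ ({0, 1, 3, 5} : Finset (Fin 6)), v k = 0) :
    HilbUnit a t u radTwo v ↔ ambChar t u v = 0 := by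
  rw [eq_vec_of_radTwo hv]
  generalize v 0 = x
  generalize v 1 = x'
  generalize v 3 = y
  generalize v 5 = z
  revert x x' y z a t u
  decide +kernel

theorem ambChar_eq_zero_of_radThree (a t u : ZMod 2) (v : Fin 6 → ZMod 2)
    (h : HilbUnit a t u radThree v) : ambChar t u v = 0 := by
  rw [vec_eta_six v] at h ⊢
  generalize v 0 = x at h ⊢
  generalize v 1 = x' at h ⊢
  generalize v 2 = y'' at h ⊢
  generalize v 3 = y at h ⊢
  generalize v 4 = y' at h ⊢
  generalize v 5 = z at h ⊢
  revert x x' y'' y y' z a t u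
  decide +kernel

theorem hilbUnit_radOne (a t u : ZMod 2) (v : Fin 6 → ZMod 2)
    (hv : ∀ k ∉ ({0, 2, 4} : Finset (Fin 6)), v k = 0) : HilbUnit a t u radOne v := by
  rw [eq_vec_of_radOne hv]
  generalize v 0 = x
  generalize v 2 = x'
  generalize v 4 = y
  revert x x' y a t u
  decide +kernel

end Radicands

section BiquadField

open scoped nonZeroDivisors

/-- The field `L = F(s₁, s₂)` over the Gaussian numbers `F`, with its quadratic subfields
`K₁ = F(s₁)`, `K₂ = F(s₂)`, `K₃ = F(s₁s₂)`, where `s₁² = π₁π₃` and `s₂² = iπ₂π₄`. -/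
structure BiquadField (F K₁ K₂ K₃ L : Type*) [Field F] [NumberField F] [Algebra GaussianInt F]
    [Field K₁] [NumberField K₁] [Algebra F K₁] [Field K₂] [NumberField K₂] [Algebra F K₂]
    [Field K₃] [NumberField K₃] [Algebra F K₃] [Field L] [NumberField L] [Algebra K₁ L]
    [Algebra K₂ L] [Algebra K₃ L] (q : Fin 4 → GaussianInt) (a t u : ZMod 2) (s₁ : K₁) (s₂ : K₂)
    (s₃ : K₃) : Prop where
  data : PrimeData q a t u
  one : QuadField F K₁ q a t u radOne {0, 2, 4} s₁
  two : QuadField F K₂ q a t u radTwo {0, 1, 3, 5} s₂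
  three : QuadField F K₃ q a t u radThree Finset.univ s₃
  root : algebraMap K₃ L s₃ = algebraMap K₁ L s₁ * algebraMap K₂ L s₂
  ne : ∀ y : K₁, algebraMap K₁ L y ≠ algebraMap K₂ L s₂
  rank : Units.rank L = 3

variable {q : Fin 4 → GaussianInt} {a t u : ZMod 2}
variable {F : Type*} [Field F] [NumberField F] [Algebra GaussianInt F]
  [IsFractionRing GaussianInt F]
variable {K₁ : Type*} [Field K₁] [NumberField K₁] [Algebra F K₁]
  [Algebra.IsQuadraticExtension F K₁]
variable {K₂ : Type*} [Field K₂] [NumberField K₂] [Algebra F K₂]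
  [Algebra.IsQuadraticExtension F K₂]
variable {K₃ : Type*} [Field K₃] [NumberField K₃] [Algebra F K₃]
  [Algebra.IsQuadraticExtension F K₃]
variable {L : Type*} [Field L] [NumberField L] [Algebra F L]
  [Algebra K₁ L] [IsScalarTower F K₁ L] [Algebra.IsQuadraticExtension K₁ L]
  [Algebra K₂ L] [IsScalarTower F K₂ L] [Algebra.IsQuadraticExtension K₂ L]
  [Algebra K₃ L] [IsScalarTower F K₃ L] [Algebra.IsQuadraticExtension K₃ L]
variable {s₁ : K₁} {s₂ : K₂} {s₃ : K₃}

namespace BiquadField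

include F

theorem sq_one (Q : BiquadField F K₁ K₂ K₃ L q a t u s₁ s₂ s₃) :
    algebraMap K₁ L s₁ ^ 2 = algebraMap F L (gaussEl F q radOne) := by
  rw [← map_pow, Q.one.sq, ← IsScalarTower.algebraMap_apply]

theorem sq_two (Q : BiquadField F K₁ K₂ K₃ L q a t u s₁ s₂ s₃) :
    algebraMap K₂ L s₂ ^ 2 = algebraMap F L (gaussEl F q radTwo) := by
  rw [← map_pow, Q.two.sq, ← IsScalarTower.algebraMap_apply]

theorem sq_one_two (Q : BiquadField F K₁ K₂ K₃ L q a t u s₁ s₂ s₃) :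
    algebraMap K₁ L s₁ ^ 2 = algebraMap K₂ L (algebraMap F K₂ (gaussEl F q radOne)) := by
  rw [Q.sq_one, ← IsScalarTower.algebraMap_apply]

theorem sq_one_three (Q : BiquadField F K₁ K₂ K₃ L q a t u s₁ s₂ s₃) :
    algebraMap K₁ L s₁ ^ 2 = algebraMap K₃ L (algebraMap F K₃ (gaussEl F q radOne)) := by
  rw [Q.sq_one, ← IsScalarTower.algebraMap_apply]

theorem sq_two_one (Q : BiquadField F K₁ K₂ K₃ L q a t u s₁ s₂ s₃) :
    algebraMap K₂ L s₂ ^ 2 = algebraMap K₁ L (algebraMap F K₁ (gaussEl F q radTwo)) := by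
  rw [Q.sq_two, ← IsScalarTower.algebraMap_apply]

theorem one_ne_zero (Q : BiquadField F K₁ K₂ K₃ L q a t u s₁ s₂ s₃) : algebraMap K₁ L s₁ ≠ 0 := by
  intro h
  refine Q.one.ne 0 ?_
  rw [map_zero, eq_comm]
  simpa using h

theorem two_ne_zero (Q : BiquadField F K₁ K₂ K₃ L q a t u s₁ s₂ s₃) : algebraMap K₂ L s₂ ≠ 0 := by
  intro h
  refine Q.two.ne 0 ?_
  rw [map_zero, eq_comm]
  simpa using h

theorem algebraMap_ne_one (Q : BiquadField F K₁ K₂ K₃ L q a t u s₁ s₂ s₃) (y : F) :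
    algebraMap F L y ≠ algebraMap K₁ L s₁ := by
  rw [IsScalarTower.algebraMap_apply F K₁ L]
  exact fun h => Q.one.ne y (FaithfulSMul.algebraMap_injective K₁ L h)

theorem ne_two (Q : BiquadField F K₁ K₂ K₃ L q a t u s₁ s₂ s₃) (y : K₂) :
    algebraMap K₂ L y ≠ algebraMap K₁ L s₁ := by
  intro h
  obtain ⟨α, β, rfl, -⟩ := exists_coords Q.two.sq Q.two.ne y
  rw [map_add, map_mul, ← IsScalarTower.algebraMap_apply, ← IsScalarTower.algebraMap_apply] at h
  by_cases hβ : β = 0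
  · rw [hβ, map_zero, zero_mul, add_zero] at h
    exact Q.algebraMap_ne_one _ h
  · have hβ' : algebraMap F L β ≠ 0 := by simpa using hβ
    refine Q.ne ((s₁ - algebraMap F K₁ α) / algebraMap F K₁ β) ?_
    rw [map_div₀, map_sub, ← IsScalarTower.algebraMap_apply, ← IsScalarTower.algebraMap_apply, ← h]
    field_simp
    ring

theorem ne_three (Q : BiquadField F K₁ K₂ K₃ L q a t u s₁ s₂ s₃) (y : K₃) :
    algebraMap K₃ L y ≠ algebraMap K₁ L s₁ := by
  intro h
  obtain ⟨α, β, rfl, -⟩ := exists_coords Q.three.sq Q.three.ne y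
  rw [map_add, map_mul, ← IsScalarTower.algebraMap_apply, ← IsScalarTower.algebraMap_apply,
    Q.root] at h
  by_cases hβ : β = 0
  · rw [hβ, map_zero, zero_mul, add_zero] at h
    exact Q.algebraMap_ne_one _ h
  · have hβ' : algebraMap F L β ≠ 0 := by simpa using hβ
    have h1 := Q.one_ne_zero
    refine Q.ne ((s₁ - algebraMap F K₁ α) / (algebraMap F K₁ β * s₁)) ?_
    rw [map_div₀, map_sub, map_mul, ← IsScalarTower.algebraMap_apply,
      ← IsScalarTower.algebraMap_apply]
    rw [div_eq_iff (mul_ne_zero hβ' h1)]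
    linear_combination - h

theorem rad (Q : BiquadField F K₁ K₂ K₃ L q a t u s₁ s₂ s₃) : GoodRad F L q Finset.univ :=
  (Q.one.rad.mono (Finset.subset_univ _)).sqrt (Finset.mem_univ _) (fun _ _ => Finset.mem_univ _)
    Q.sq_two_one Q.ne

theorem hom_ext (Q : BiquadField F K₁ K₂ K₃ L q a t u s₁ s₂ s₃) {f g : L →+* L}
    (h : ∀ x : F, f (algebraMap F L x) = g (algebraMap F L x))
    (h₁ : f (algebraMap K₁ L s₁) = g (algebraMap K₁ L s₁))
    (h₂ : f (algebraMap K₂ L s₂) = g (algebraMap K₂ L s₂)) : f = g := by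
  ext x
  obtain ⟨α, β, rfl, -⟩ := exists_coords Q.sq_two_one Q.ne x
  obtain ⟨a, b, rfl, -⟩ := exists_coords Q.one.sq Q.one.ne α
  obtain ⟨c, d, rfl, -⟩ := exists_coords Q.one.sq Q.one.ne β
  simp only [map_add, map_mul, h₁, h₂, ← IsScalarTower.algebraMap_apply, h]

variable {σ₁ : Gal(L/K₁)} {σ₂ : Gal(L/K₂)} {σ₃ : Gal(L/K₃)}

omit [Algebra GaussianInt F] [IsFractionRing GaussianInt F] in
theorem gal_base {K : Type*} [Field K] [Algebra F K] [Algebra K L] [IsScalarTower F K L]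
    (σ : Gal(L/K)) (x : F) : σ (algebraMap F L x) = algebraMap F L x := by
  rw [IsScalarTower.algebraMap_apply F K L, AlgEquiv.commutes]

theorem galOne_two (Q : BiquadField F K₁ K₂ K₃ L q a t u s₁ s₂ s₃) (hσ : σ₁ ≠ 1) :
    σ₁ (algebraMap K₂ L s₂) = -algebraMap K₂ L s₂ := gal_apply_sqrt Q.sq_two_one Q.ne hσ

theorem galTwo_one (Q : BiquadField F K₁ K₂ K₃ L q a t u s₁ s₂ s₃) (hσ : σ₂ ≠ 1) :
    σ₂ (algebraMap K₁ L s₁) = -algebraMap K₁ L s₁ := gal_apply_sqrt Q.sq_one_two Q.ne_two hσ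

theorem galThree_one (Q : BiquadField F K₁ K₂ K₃ L q a t u s₁ s₂ s₃) (hσ : σ₃ ≠ 1) :
    σ₃ (algebraMap K₁ L s₁) = -algebraMap K₁ L s₁ := gal_apply_sqrt Q.sq_one_three Q.ne_three hσ

theorem galThree_two (Q : BiquadField F K₁ K₂ K₃ L q a t u s₁ s₂ s₃) (hσ : σ₃ ≠ 1) :
    σ₃ (algebraMap K₂ L s₂) = -algebraMap K₂ L s₂ := by
  have h1 := AlgEquiv.commutes σ₃ s₃
  rw [Q.root, map_mul, Q.galThree_one hσ] at h1
  apply mul_left_cancel₀ Q.one_ne_zero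
  linear_combination - h1

theorem gal_two_one (Q : BiquadField F K₁ K₂ K₃ L q a t u s₁ s₂ s₃) (h₁ : σ₁ ≠ 1) (h₂ : σ₂ ≠ 1)
    (h₃ : σ₃ ≠ 1) (x : L) : σ₂ (σ₁ x) = σ₃ x := by
  refine RingHom.congr_fun (Q.hom_ext (f := (σ₂ : L →+* L).comp (σ₁ : L →+* L))
    (g := (σ₃ : L →+* L)) (fun x => ?_) ?_ ?_) x
  · change σ₂ (σ₁ _) = σ₃ _
    simp only [gal_base]
  · change σ₂ (σ₁ _) = σ₃ _
    rw [AlgEquiv.commutes, Q.galTwo_one h₂, Q.galThree_one h₃]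
  · change σ₂ (σ₁ _) = σ₃ _
    rw [Q.galOne_two h₁, map_neg, AlgEquiv.commutes, Q.galThree_two h₃]

theorem gal_one_three (Q : BiquadField F K₁ K₂ K₃ L q a t u s₁ s₂ s₃) (h₁ : σ₁ ≠ 1) (h₂ : σ₂ ≠ 1)
    (h₃ : σ₃ ≠ 1) (x : L) : σ₁ (σ₃ x) = σ₂ x := by
  refine RingHom.congr_fun (Q.hom_ext (f := (σ₁ : L →+* L).comp (σ₃ : L →+* L))
    (g := (σ₂ : L →+* L)) (fun x => ?_) ?_ ?_) x
  · change σ₁ (σ₃ _) = σ₂ _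
    simp only [gal_base]
  · change σ₁ (σ₃ _) = σ₂ _
    rw [Q.galThree_one h₃, map_neg, AlgEquiv.commutes, Q.galTwo_one h₂]
  · change σ₁ (σ₃ _) = σ₂ _
    rw [Q.galThree_two h₃, map_neg, Q.galOne_two h₁, AlgEquiv.commutes, neg_neg]

theorem norm_algebraMap_one (Q : BiquadField F K₁ K₂ K₃ L q a t u s₁ s₂ s₃) (α : K₁) :
    Algebra.norm K₂ (algebraMap K₁ L α) = algebraMap F K₂ (Algebra.norm F α) := by
  obtain ⟨σ₂, h₂⟩ := exists_gal_ne_one (K := K₂) (E := L)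
  apply FaithfulSMul.algebraMap_injective K₂ L
  rw [algebraMap_norm_eq h₂, ← IsScalarTower.algebraMap_apply]
  obtain ⟨c, d, rfl, hn⟩ := exists_coords Q.one.sq Q.one.ne α
  rw [hn]
  simp only [map_add, map_mul, ← IsScalarTower.algebraMap_apply, gal_base, Q.galTwo_one h₂,
    map_sub, map_pow, ← Q.sq_one]
  ring

theorem sqEquiv_one (Q : BiquadField F K₁ K₂ K₃ L q a t u s₁ s₂ s₃) {v : Fin 6 → ZMod 2}
    (h : SqEquiv L (algebraMap F L (gaussEl F q v)) 1) :
    v = 0 ∨ v = radOne ∨ v = radTwo ∨ v = radTwo + radOne := by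
  rw [IsScalarTower.algebraMap_apply F K₁ L] at h
  rcases sqEquiv_one_of_algebraMap Q.sq_two_one Q.ne h with h1 | h1
  · rw [← map_one (algebraMap F K₁), ← gaussEl_zero F (q := q)] at h1
    rcases Q.data.gauss_of_sqEquiv Q.one.sq Q.one.ne h1 with h2 | h2
    · exact .inl (Q.data.eq_of_sqEquiv h2)
    · exact .inr (.inl ((Q.data.eq_of_sqEquiv h2).trans (zero_add _)))
  · rcases Q.data.gauss_of_sqEquiv Q.one.sq Q.one.ne h1 with h2 | h2
    · exact .inr (.inr (.inl (Q.data.eq_of_sqEquiv h2)))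
    · exact .inr (.inr (.inr (Q.data.eq_of_sqEquiv h2)))

/-- A product of generators on which the ambiguous character vanishes is a unit up to squares. -/
theorem exists_unit (Q : BiquadField F K₁ K₂ K₃ L q a t u s₁ s₂ s₃) {v : Fin 6 → ZMod 2}
    (hv : ambChar t u v = 0) :
    ∃ ε : (𝓞 L)ˣ, SqEquiv L (algebraMap F L (gaussEl F q v)) (algebraMap (𝓞 L) L ε) := by
  have h1 : ∀ k ∉ ({0, 2, 4} : Finset (Fin 6)), ![v 0, 0, v 2, 0, v 4, 0] k = 0 := by
    intro k hk
    fin_cases k <;> simp_all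
  have h2 : ∀ k ∉ ({0, 1, 3, 5} : Finset (Fin 6)), ![0, v 1, 0, v 3, 0, v 5] k = 0 := by
    intro k hk
    fin_cases k <;> simp_all
  obtain ⟨ε, hε⟩ := Q.one.exists_unit Q.data h1 (hilbUnit_radOne a t u _ h1)
  obtain ⟨η, hη⟩ := Q.two.exists_unit Q.data h2 ((ambChar_eq_zero_of_radTwo a t u _ h2).2 hv)
  have h3 := hε.map (algebraMap K₁ L)
  have h4 := hη.map (algebraMap K₂ L)
  rw [← IsScalarTower.algebraMap_apply F] at h3 h4
  have h5 := (h3.mul h4).trans (by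
    rw [← map_mul]
    exact (Q.data.gaussEl_add _ _).map _)
  rw [show (![v 0, 0, v 2, 0, v 4, 0] + ![0, v 1, 0, v 3, 0, v 5] : Fin 6 → ZMod 2) = v by
    ext k
    fin_cases k <;> simp] at h5
  refine ⟨Units.map (algebraMap (𝓞 K₁) (𝓞 L)) ε * Units.map (algebraMap (𝓞 K₂) (𝓞 L)) η, ?_⟩
  refine h5.symm.trans ?_
  rw [Units.val_mul, map_mul]
  exact .refl _

end BiquadField

end BiquadField

section RamifiedPrimes

open scoped nonZeroDivisors

variable {q : Fin 4 → GaussianInt} {a t u : ZMod 2}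
variable {F : Type*} [Field F] [NumberField F] [Algebra GaussianInt F]
  [IsFractionRing GaussianInt F]
variable {K : Type*} [Field K] [NumberField K] [Algebra F K]
variable {D : Fin 6 → ZMod 2} {B : Finset (Fin 6)} {s : K}

theorem span_pair_sq {R : Type*} [CommRing R] {p w σ : R} (hσ : σ ^ 2 = p * w)
    (hpw : IsCoprime p w) : Ideal.span {p, σ} ^ 2 = Ideal.span {p} := by
  rw [pow_two, Ideal.span_pair_mul_span_pair]
  apply le_antisymm
  · rw [Ideal.span_le]
    rintro x (rfl | rfl | rfl | rfl) <;> rw [SetLike.mem_coe, Ideal.mem_span_singleton]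
    · exact ⟨p, rfl⟩
    · exact ⟨σ, rfl⟩
    · exact ⟨σ, mul_comm _ _⟩
    · exact ⟨w, by rw [← hσ, pow_two]⟩
  · obtain ⟨α, β, h⟩ := hpw
    rw [Ideal.span_singleton_le_iff_mem]
    have h1 : p = α * (p * p) + β * (σ * σ) := by
      linear_combination - p * h - β * hσ
    have h2 : α * (p * p) + β * (σ * σ) ∈ Ideal.span {p * p, p * σ, σ * p, σ * σ} :=
      add_mem (Ideal.mul_mem_left _ _ (Ideal.subset_span (by simp)))
        (Ideal.mul_mem_left _ _ (Ideal.subset_span (by simp)))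
    rwa [← h1] at h2

theorem QuadField.exists_ideal_sq (Q : QuadField F K q a t u D B s) (H : PrimeData q a t u)
    {j : Fin 4} (hj : D (primeIdx j) = 1) {φ : GaussianInt →+* 𝓞 K}
    (hφ : ∀ z, algebraMap (𝓞 K) K (φ z) = algebraMap F K (algebraMap GaussianInt F z)) :
    ∃ P : (Ideal (𝓞 K))⁰, (P : Ideal (𝓞 K)) ^ 2 = Ideal.span {φ (q j)} ∧
      ∃ σ : 𝓞 K, algebraMap (𝓞 K) K σ = s ∧ (P : Ideal (𝓞 K)) = Ideal.span {φ (q j), σ} := by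
  have hs : s ^ 2 = algebraMap (𝓞 K) K (φ (gaussProd q D)) := by
    rw [Q.sq, hφ]
    rfl
  have hint : IsIntegral ℤ s := IsIntegral.of_pow two_pos (hs ▸ RingOfIntegers.isIntegral_coe _)
  obtain ⟨σ, hσ⟩ : ∃ σ : 𝓞 K, algebraMap (𝓞 K) K σ = s := ⟨⟨s, hint⟩, rfl⟩
  have h1 : σ ^ 2 = φ (q j) * φ (gaussProd q (Function.update D (primeIdx j) 0)) := by
    rw [← map_mul, ← gaussGen_primeIdx (q := q), ← gaussProd_eq_gen_mul hj]
    apply RingOfIntegers.coe_injective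
    rw [map_pow, hσ]
    exact hs
  have h2 : ¬ q j ∣ gaussProd q (Function.update D (primeIdx j) 0) := by
    refine prime_not_dvd_gaussProd (H.prime j) fun k hk => ?_
    have hkj : primeIdx j ≠ k := by
      rintro rfl
      simp at hk
    rw [← gaussGen_primeIdx (q := q)]
    exact H.gen_not_dvd (by fin_cases j <;> decide) hkj
  have h3 := span_pair_sq h1 ((isCoprime_of_prime (H.prime j) h2).map φ)
  have h4 : φ (q j) ≠ 0 := by
    rw [Ne, ← map_eq_zero_iff _ (RingOfIntegers.coe_injective (K := K)), hφ]
    have := IsFractionRing.injective GaussianInt F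
    rw [map_eq_zero, map_eq_zero_iff _ this]
    exact (H.prime j).ne_zero
  refine ⟨⟨Ideal.span {φ (q j), σ}, mem_nonZeroDivisors_of_ne_zero ?_⟩, h3, σ, hσ, rfl⟩
  intro h0
  refine h4 ?_
  rw [← Ideal.mem_bot, ← Ideal.zero_eq_bot, ← h0]
  exact Ideal.subset_span (by simp)

theorem rootClass_prime {j : Fin 4} (H : PrimeData q a t u) {φ : GaussianInt →+* 𝓞 K}
    (hφ : ∀ z, algebraMap (𝓞 K) K (φ z) = algebraMap F K (algebraMap GaussianInt F z))
    {P : (Ideal (𝓞 K))⁰} (hP : (P : Ideal (𝓞 K)) ^ 2 = Ideal.span {φ (q j)}) :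
    RootClass K (algebraMap F K (gaussEl F q (Pi.single (primeIdx j) 1))) (ClassGroup.mk0 P) := by
  refine ⟨1, φ (q j), P, one_ne_zero, ?_, ?_, hP.symm, rfl⟩
  · intro h0
    rw [h0, Ideal.span_singleton_eq_bot.2 rfl, ← Ideal.zero_eq_bot] at hP
    exact nonZeroDivisors.coe_ne_zero P (pow_eq_zero_iff two_ne_zero |>.1 hP)
  · rw [map_one, one_pow, mul_one, hφ, gaussEl_single, gaussGen_primeIdx]

end RamifiedPrimes

section AmbiguousClass

open scoped nonZeroDivisors

theorem exists_unit_of_sq_eq {E : Type*} [Field E] [NumberField E] {v : E} {η : (𝓞 E)ˣ}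
    (h : v ^ 2 = algebraMap (𝓞 E) E η) : ∃ θ : (𝓞 E)ˣ, algebraMap (𝓞 E) E θ = v := by
  have hint : IsIntegral ℤ v := IsIntegral.of_pow two_pos (h ▸ RingOfIntegers.isIntegral_coe _)
  obtain ⟨σ, rfl⟩ : ∃ σ : 𝓞 E, algebraMap (𝓞 E) E σ = v := ⟨⟨v, hint⟩, rfl⟩
  have h1 : σ ^ 2 = η := RingOfIntegers.coe_injective (by rw [map_pow]; exact h)
  have hu : IsUnit σ := (isUnit_pow_iff two_ne_zero).1 (h1 ▸ η.isUnit)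
  exact ⟨hu.unit, rfl⟩

theorem exists_norm_eq_mul_unit {F K L : Type*} [Field F] [Field K] [NumberField K]
    [Field L] [NumberField L] [Algebra F K] [Algebra F L] [Algebra K L] [IsScalarTower F K L]
    [Algebra.IsQuadraticExtension K L] {p : F} (hp : p ≠ 0) {ε : (𝓞 L)ˣ} {y : L}
    (h : algebraMap F L p = algebraMap (𝓞 L) L ε * y ^ 2) :
    ∃ θ : (𝓞 K)ˣ, Algebra.norm K y = algebraMap F K p * algebraMap (𝓞 K) K θ := by
  have hp' : algebraMap F K p ≠ 0 := by simpa using hp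
  have h1 : algebraMap F K p ^ 2 =
      algebraMap (𝓞 K) K (RingOfIntegers.norm K (ε : 𝓞 L)) * Algebra.norm K y ^ 2 := by
    have := congrArg (Algebra.norm K) h
    rw [IsScalarTower.algebraMap_apply F K L, Algebra.norm_algebraMap,
      Algebra.IsQuadraticExtension.finrank_eq_two, map_mul, map_pow] at this
    exact this
  have h2 : algebraMap (𝓞 K) K ((Units.map (RingOfIntegers.norm K) ε)⁻¹ : (𝓞 K)ˣ) *
      algebraMap (𝓞 K) K (RingOfIntegers.norm K (ε : 𝓞 L)) = 1 := by
    rw [← map_mul, ← map_one (algebraMap (𝓞 K) K)]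
    congr 1
    exact Units.inv_mul (Units.map (RingOfIntegers.norm K) ε)
  obtain ⟨θ, hθ⟩ := exists_unit_of_sq_eq (v := Algebra.norm K y / algebraMap F K p)
    (η := (Units.map (RingOfIntegers.norm K) ε)⁻¹) (by
      rw [div_pow, div_eq_iff (pow_ne_zero 2 hp'), h1, ← mul_assoc, h2, one_mul])
  exact ⟨θ, by rw [hθ, mul_div_cancel₀ _ hp']⟩

variable {q : Fin 4 → GaussianInt} {a t u : ZMod 2}
variable {F : Type*} [Field F] [NumberField F] [Algebra GaussianInt F]
  [IsFractionRing GaussianInt F]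
variable {K₁ : Type*} [Field K₁] [NumberField K₁] [Algebra F K₁]
  [Algebra.IsQuadraticExtension F K₁]
variable {K₂ : Type*} [Field K₂] [NumberField K₂] [Algebra F K₂]
  [Algebra.IsQuadraticExtension F K₂]
variable {K₃ : Type*} [Field K₃] [NumberField K₃] [Algebra F K₃]
  [Algebra.IsQuadraticExtension F K₃]
variable {L : Type*} [Field L] [NumberField L] [Algebra F L]
  [Algebra K₁ L] [IsScalarTower F K₁ L] [Algebra.IsQuadraticExtension K₁ L]
  [Algebra K₂ L] [IsScalarTower F K₂ L] [Algebra.IsQuadraticExtension K₂ L]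
  [Algebra K₃ L] [IsScalarTower F K₃ L] [Algebra.IsQuadraticExtension K₃ L]
variable {s₁ : K₁} {s₂ : K₂} {s₃ : K₃}

theorem QuadField.sq_eq_one_of_pow_two_pow {K : Type*} [Field K] [NumberField K] [Algebra F K]
    [Algebra.IsQuadraticExtension F K] {D : Fin 6 → ZMod 2} {B : Finset (Fin 6)} {s : K}
    (Q : QuadField F K q a t u D B s) (H : PrimeData q a t u) (n : ℕ) {c : ClassGroup (𝓞 K)}
    (hc : c ^ 2 ^ n = 1) : c ^ 2 = 1 := by
  induction n with
  | zero =>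
    rw [pow_zero, pow_one] at hc
    rw [hc, one_pow]
  | succ n ih =>
    match n with
    | 0 => simpa using hc
    | m + 1 =>
      refine ih ?_
      rw [pow_succ, pow_mul]
      refine Q.sq_eq_one_of_pow_four H ?_
      rw [← pow_mul, ← hc]
      congr 1
      ring

namespace BiquadField

include F

theorem exists_rootClass (Q : BiquadField F K₁ K₂ K₃ L q a t u s₁ s₂ s₃) :
    ∃ c, RootClass L (algebraMap F L (gaussEl F q (Pi.single 3 1))) c := by
  obtain ⟨φ, hφ, -⟩ := exists_gaussianInt_hom F K₃
  obtain ⟨P, hP, -⟩ := Q.three.exists_ideal_sq Q.data (j := 1) (by decide) hφ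
  have h := (rootClass_prime Q.data hφ hP).map L
  rw [← IsScalarTower.algebraMap_apply] at h
  exact ⟨_, h⟩

variable {c : ClassGroup (𝓞 L)}

theorem eq_one_or_of_rootClass (Q : BiquadField F K₁ K₂ K₃ L q a t u s₁ s₂ s₃)
    (hc : RootClass L (algebraMap F L (gaussEl F q (Pi.single 3 1))) c) {v : Fin 6 → ZMod 2}
    {κ : ClassGroup (𝓞 L)} (h : RootClass L (algebraMap F L (gaussEl F q v)) κ) :
    κ = 1 ∨ κ = c := by
  by_cases hv : ambChar t u v = 0
  · obtain ⟨ε, hε⟩ := Q.exists_unit hv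
    exact .inl (h.eq_one_of_unit ε hε)
  · right
    have hv' : ambChar t u (v + Pi.single 3 1) = 0 := by
      have two : ∀ x : ZMod 2, x ≠ 0 → x + 1 = 0 := by decide
      rw [ambChar_add]
      convert two _ hv using 2
      simp [ambChar]
    obtain ⟨ε, hε⟩ := Q.exists_unit hv'
    have h1 := (h.mul hc).eq_one_of_unit ε (by
      rw [← map_mul]
      exact ((Q.data.gaussEl_add _ _).map _).trans hε)
    have h2 := hc.sq_eq_one
    rw [pow_two] at h2
    exact mul_right_cancel (h1.trans h2.symm)

theorem rootClass_ne_one (Q : BiquadField F K₁ K₂ K₃ L q a t u s₁ s₂ s₃)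
    (hc : RootClass L (algebraMap F L (gaussEl F q (Pi.single 3 1))) c) : c ≠ 1 := by
  rintro rfl
  obtain ⟨ε, y, hy, h⟩ := hc.exists_unit
  have hp := Q.data.gaussEl_ne_zero (F := F) (Pi.single 3 1)
  obtain ⟨θ₁, h₁⟩ := exists_norm_eq_mul_unit (K := K₁) hp h
  obtain ⟨θ₂, h₂⟩ := exists_norm_eq_mul_unit (K := K₂) hp h
  obtain ⟨θ₃, h₃⟩ := exists_norm_eq_mul_unit (K := K₃) hp h
  obtain ⟨σ₁, hσ₁⟩ := exists_gal_ne_one (K := K₁) (E := L)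
  obtain ⟨σ₂, hσ₂⟩ := exists_gal_ne_one (K := K₂) (E := L)
  obtain ⟨σ₃, hσ₃⟩ := exists_gal_ne_one (K := K₃) (E := L)
  obtain ⟨w₁, hw₁, e₁⟩ := Q.one.exists_sqEquiv Q.data (RootClass.unit θ₁)
  obtain ⟨w₂, hw₂, e₂⟩ := Q.two.exists_sqEquiv Q.data (RootClass.unit θ₂)
  obtain ⟨w₃, hw₃, e₃⟩ := Q.three.exists_sqEquiv Q.data (RootClass.unit θ₃)
  have u₁ : ambChar t u w₁ = 0 := by
    simp [ambChar, hw₁ 1 (by decide), hw₁ 3 (by decide), hw₁ 5 (by decide)]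
  have u₂ := (ambChar_eq_zero_of_radTwo a t u w₂ hw₂).1 (Q.two.hilbUnit_of_unit Q.data e₂)
  have u₃ := ambChar_eq_zero_of_radThree a t u w₃ (Q.three.hilbUnit_of_unit Q.data e₃)
  have n₁ := algebraMap_norm_eq hσ₁ y
  have n₂ := algebraMap_norm_eq hσ₂ y
  have n₃ := congrArg σ₁ (algebraMap_norm_eq hσ₃ y)
  rw [map_mul, Q.gal_one_three hσ₁ hσ₂ hσ₃, h₃, map_mul, ← IsScalarTower.algebraMap_apply F K₃ L,
    map_mul, gal_base] at n₃
  rw [h₁, map_mul, ← IsScalarTower.algebraMap_apply F K₁ L] at n₁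
  rw [h₂, map_mul, ← IsScalarTower.algebraMap_apply F K₂ L] at n₂
  have e₁' := e₁.map (algebraMap K₁ L)
  have e₂' := e₂.map (algebraMap K₂ L)
  have e₃' := e₃.map (algebraMap K₃ L)
  rw [← IsScalarTower.algebraMap_apply F] at e₁' e₂' e₃'
  have e₄' : SqEquiv L (σ₁ (algebraMap K₃ L (algebraMap (𝓞 K₃) K₃ θ₃)))
      (σ₁ (algebraMap F L (gaussEl F q w₃))) := e₃'.map (σ₁ : L →+* L)
  rw [gal_base (F := F) σ₁] at e₄'
  set p := algebraMap F L (gaussEl F q (Pi.single 3 1)) with hpdef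
  have hp0 : p ≠ 0 := by simpa [hpdef] using hp
  have key : SqEquiv L (p * σ₁ (algebraMap K₃ L (algebraMap (𝓞 K₃) K₃ θ₃)))
      (algebraMap K₁ L (algebraMap (𝓞 K₁) K₁ θ₁) * algebraMap K₂ L (algebraMap (𝓞 K₂) K₂ θ₂)) := by
    refine ⟨p / y, div_ne_zero hp0 hy, ?_⟩
    rw [div_pow, ← mul_div_assoc, eq_div_iff (pow_ne_zero 2 hy)]
    linear_combination y ^ 2 * n₃ - (y * σ₂ y) * n₁ - p * algebraMap K₁ L (algebraMap (𝓞 K₁) K₁ θ₁) * n₂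
  have key2 := (((SqEquiv.refl p).mul e₄').symm.trans key).trans (e₁'.mul e₂')
  rw [hpdef, ← map_mul, ← map_mul] at key2
  have key3 := ((Q.data.gaussEl_add (F := F) (Pi.single 3 1) w₃).symm.map (algebraMap F L)).trans
    (key2.trans ((Q.data.gaussEl_add (F := F) w₁ w₂).map (algebraMap F L)))
  have hne : algebraMap F L (gaussEl F q (w₁ + w₂)) ≠ 0 := by
    simpa using Q.data.gaussEl_ne_zero (F := F) _
  have key4 := (SqEquiv.mul_one_iff hne).2 key3
  rw [← map_mul] at key4
  have key5 := Q.sqEquiv_one (((Q.data.gaussEl_add _ _).symm.map (algebraMap F L)).trans key4)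
  have h0 : ambChar t u (Pi.single 3 1 + w₃ + (w₁ + w₂)) = 1 := by
    simp only [ambChar_add, u₁, u₂, u₃]
    simp [ambChar]
  have h1 : ambChar t u radOne = 0 := by simp [ambChar, radOne]
  have h2 : ambChar t u radTwo = 0 := by simp [ambChar, radTwo, CharTwo.add_self_eq_zero]
  have h3 : ambChar t u 0 = 0 := by simp [ambChar]
  rcases key5 with h | h | h | h <;> rw [h] at h0 <;>
    simp [ambChar_add, h1, h2, h3] at h0

theorem extendedHom_clNorm_eq (Q : BiquadField F K₁ K₂ K₃ L q a t u s₁ s₂ s₃)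
    (hc : RootClass L (algebraMap F L (gaussEl F q (Pi.single 3 1))) c) {n : ℕ}
    {d : ClassGroup (𝓞 L)} (hd : d ^ 2 ^ n = 1) {K : Type*} [Field K] [NumberField K]
    [Algebra F K] [Algebra.IsQuadraticExtension F K] [Algebra K L] [IsScalarTower F K L]
    [Algebra.IsQuadraticExtension K L] {D : Fin 6 → ZMod 2} {B : Finset (Fin 6)} {s : K}
    (QK : QuadField F K q a t u D B s) :
    ClassGroup.extendedHom (𝓞 K) (𝓞 L) (clNorm K L d) = 1 ∨
      ClassGroup.extendedHom (𝓞 K) (𝓞 L) (clNorm K L d) = c := by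
  have h1 := QK.sq_eq_one_of_pow_two_pow Q.data n (c := clNorm K L d)
    (by rw [← map_pow, hd, map_one])
  obtain ⟨x, hx⟩ := RootClass.exists_of_sq_eq_one h1
  obtain ⟨v, -, hv⟩ := QK.exists_sqEquiv Q.data hx
  have h2 := (hx.congr hv).map L
  rw [← IsScalarTower.algebraMap_apply] at h2
  exact Q.eq_one_or_of_rootClass hc h2

/-- The square of a class of `2`-power order is ambiguous. -/
theorem sq_eq_one_or (Q : BiquadField F K₁ K₂ K₃ L q a t u s₁ s₂ s₃)
    (hc : RootClass L (algebraMap F L (gaussEl F q (Pi.single 3 1))) c) {n : ℕ}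
    {d : ClassGroup (𝓞 L)} (hd : d ^ 2 ^ n = 1) : d ^ 2 = 1 ∨ d ^ 2 = c := by
  have g₁ := Q.extendedHom_clNorm_eq hc hd Q.one
  have g₂ := Q.extendedHom_clNorm_eq hc hd Q.two
  have g₃ := Q.extendedHom_clNorm_eq hc hd Q.three
  have hcc : c * c = 1 := by rw [← pow_two, hc.sq_eq_one]
  obtain ⟨J, rfl⟩ := ClassGroup.mk0_surjective d
  obtain ⟨σ₁, hσ₁⟩ := exists_gal_ne_one (K := K₁) (E := L)
  obtain ⟨σ₂, hσ₂⟩ := exists_gal_ne_one (K := K₂) (E := L)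
  obtain ⟨σ₃, hσ₃⟩ := exists_gal_ne_one (K := K₃) (E := L)
  have hN : clNorm K₂ L c = 1 := by
    rw [IsScalarTower.algebraMap_apply F K₂ L] at hc
    exact clNorm_eq_one_of_rootClass_algebraMap hc
  have h₂₁ : galIdeal σ₂ (galIdeal σ₁ J) = galIdeal σ₃ J := by
    apply Subtype.ext
    change ((J : Ideal (𝓞 L)).map _).map _ = (J : Ideal (𝓞 L)).map _
    rw [Ideal.map_map]
    congr 1
    ext x
    exact Q.gal_two_one hσ₁ hσ₂ hσ₃ x
  have k := extendedHom_clNorm hσ₂ (galIdeal σ₁ J)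
  rw [h₂₁] at k
  rw [extendedHom_clNorm hσ₁] at g₁
  rw [extendedHom_clNorm hσ₃] at g₃
  have k₁ : clNorm K₂ L (ClassGroup.mk0 J) * clNorm K₂ L (ClassGroup.mk0 (galIdeal σ₁ J)) = 1 := by
    rw [← map_mul]
    rcases g₁ with h | h <;> rw [h]
    · exact map_one _
    · exact hN
  have k₂ := congrArg (ClassGroup.extendedHom (𝓞 K₂) (𝓞 L)) k₁
  rw [map_mul, map_one, k] at k₂
  set x := ClassGroup.mk0 J
  set x₁ := ClassGroup.mk0 (galIdeal σ₁ J)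
  set x₃ := ClassGroup.mk0 (galIdeal σ₃ J)
  set y := ClassGroup.extendedHom (𝓞 K₂) (𝓞 L) (clNorm K₂ L x)
  have key : x ^ 2 = (x * x₁) * (x * x₃) * y * (y * (x₁ * x₃))⁻¹ := by
    rw [eq_mul_inv_iff_mul_eq, pow_two]
    ac_rfl
  rw [k₂, inv_one, mul_one] at key
  rw [key]
  rcases g₁ with h | h <;> rcases g₂ with h' | h' <;> rcases g₃ with h'' | h'' <;>
    simp [h, h', h'', hcc]

end BiquadField

end AmbiguousClass

section NonSquare

open scoped nonZeroDivisors

theorem hilb_radTwo_ne (t u : ZMod 2) {v : Fin 6 → ZMod 2}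
    (hv : ∀ k ∉ ({0, 2, 4} : Finset (Fin 6)), v k = 0)
    (h₁ : hilb 1 t u 1 radTwo (v + Pi.single 3 1) = 0)
    (h₃ : hilb 1 t u 3 radTwo (v + Pi.single 3 1) = 0) : False := by
  rw [eq_vec_of_radOne hv] at h₁ h₃
  generalize v 0 = x at h₁ h₃
  generalize v 2 = y at h₁ h₃
  generalize v 4 = z at h₁ h₃
  revert x y z t u
  decide +kernel

variable {q : Fin 4 → GaussianInt} {a t u : ZMod 2}
variable {F : Type*} [Field F] [NumberField F] [Algebra GaussianInt F]
  [IsFractionRing GaussianInt F]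
variable {K₁ : Type*} [Field K₁] [NumberField K₁] [Algebra F K₁]
  [Algebra.IsQuadraticExtension F K₁]
variable {K₂ : Type*} [Field K₂] [NumberField K₂] [Algebra F K₂]
  [Algebra.IsQuadraticExtension F K₂]
variable {K₃ : Type*} [Field K₃] [NumberField K₃] [Algebra F K₃]
  [Algebra.IsQuadraticExtension F K₃]
variable {L : Type*} [Field L] [NumberField L] [Algebra F L]
  [Algebra K₁ L] [IsScalarTower F K₁ L] [Algebra.IsQuadraticExtension K₁ L]
  [Algebra K₂ L] [IsScalarTower F K₂ L] [Algebra.IsQuadraticExtension K₂ L]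
  [Algebra K₃ L] [IsScalarTower F K₃ L] [Algebra.IsQuadraticExtension K₃ L]
variable {s₁ : K₁} {s₂ : K₂} {s₃ : K₃} {c : ClassGroup (𝓞 L)}

namespace BiquadField

include F

theorem sq_ne (Q : BiquadField F K₁ K₂ K₃ L q a t u s₁ s₂ s₃) (ha : a = 1)
    (hc : RootClass L (algebraMap F L (gaussEl F q (Pi.single 3 1))) c) (d : ClassGroup (𝓞 L)) :
    d ^ 2 ≠ c := by
  rintro rfl
  subst ha
  have hp := Q.data.gaussEl_ne_zero (F := F) (Pi.single 3 1)
  have hp' : algebraMap F K₁ (gaussEl F q (Pi.single 3 1)) ≠ 0 := by simpa using hp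
  rw [IsScalarTower.algebraMap_apply F K₁ L] at hc
  obtain ⟨w, κ, h⟩ := hc.exists_norm_of_sq hp'
  obtain ⟨v, hv, hv'⟩ := Q.one.exists_sqEquiv Q.data h
  rw [mul_comm] at hv'
  have h1 := hv'.of_mul hp'
  rw [← map_mul] at h1
  have h2 := h1.trans ((Q.data.gaussEl_add _ _).map (algebraMap F K₁))
  have h3 := fun j h h' => Q.data.hilb_of_norm_tower Q.one.sq Q.one.ne Q.sq_two_one Q.ne h2
    (j := j) h h'
  refine hilb_radTwo_ne t u hv (h3 1 (by decide) ?_) (h3 3 (by decide) ?_) <;>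
    rw [residLin_eq] <;> simp [radOne] <;> decide

end BiquadField

end NonSquare

section RelIndex

variable {G : Type*} [Group G] {A B : Subgroup G} {T : Type*} [Finite T]

theorem Subgroup.relIndex_le_card (r : G → T → Prop) (h₁ : ∀ x ∈ B, ∃ t, r x t)
    (h₂ : ∀ x ∈ B, ∀ y ∈ B, ∀ t, r x t → r y t → x⁻¹ * y ∈ A) :
    A.relIndex B ≠ 0 ∧ A.relIndex B ≤ Nat.card T := by
  choose f hf using fun x : B => h₁ x x.2
  have hinj : Function.Injective fun k : B ⧸ A.subgroupOf B => f k.out := by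
    intro k l hkl
    rw [← k.out_eq', ← l.out_eq', QuotientGroup.eq]
    refine h₂ _ k.out.2 _ l.out.2 _ (hf _) ?_
    dsimp only at hkl
    rw [hkl]
    exact hf _
  have := Finite.of_injective _ hinj
  rw [Subgroup.relIndex, Subgroup.index_eq_card]
  exact ⟨Nat.card_pos.ne', Nat.card_le_card_of_injective _ hinj⟩

theorem Subgroup.card_le_relIndex (f : T → G) (hf : ∀ x, f x ∈ B)
    (h : ∀ x y, (f x)⁻¹ * f y ∈ A → x = y) (h0 : A.relIndex B ≠ 0) :
    Nat.card T ≤ A.relIndex B := by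
  rw [Subgroup.relIndex, Subgroup.index_eq_card] at h0 ⊢
  have := Nat.finite_of_card_ne_zero h0
  refine Nat.card_le_card_of_injective
    (fun x => (QuotientGroup.mk ⟨f x, hf x⟩ : B ⧸ A.subgroupOf B)) fun x y hxy => h x y ?_
  exact (QuotientGroup.eq (s := A.subgroupOf B)).1 hxy

end RelIndex

section RootGroups

theorem SqEquiv.inv_mul {E : Type*} [Field E] {x y z : E} (hz : z ≠ 0) (hx : SqEquiv E x z)
    (hy : SqEquiv E y z) : SqEquiv E (x⁻¹ * y) 1 := by
  obtain ⟨c, hc, rfl⟩ := hx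
  obtain ⟨d, hd, rfl⟩ := hy
  exact ⟨d / c, div_ne_zero hd hc, by field_simp⟩

theorem SqEquiv.of_inv_mul {E : Type*} [Field E] {x y : E} (hx : x ≠ 0)
    (h : SqEquiv E (x⁻¹ * y) 1) : SqEquiv E x y := by
  obtain ⟨d, hd, h⟩ := h
  refine ⟨d⁻¹, inv_ne_zero hd, ?_⟩
  field_simp at h ⊢
  linear_combination -h

/-- The units of `E` whose image in `H` under `f` is a square. -/
def sqComap {E H : Type*} [Field E] [Field H] (f : E →* H) : Subgroup Eˣ where
  carrier := {x | SqEquiv H (f x) 1}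
  mul_mem' {x y} hx hy := by
    have := SqEquiv.mul hx hy
    rwa [one_mul, ← map_mul] at this
  one_mem' := by
    change SqEquiv H (f (1 : Eˣ)) 1
    rw [Units.val_one, map_one]
    exact .refl 1
  inv_mem' {x} hx := by
    have hx' : SqEquiv H (f x) 1 := hx
    have h1 : f ((x⁻¹ : Eˣ) : E) * f x = 1 := by rw [← map_mul, Units.inv_mul, map_one]
    have h2 : f ((x⁻¹ : Eˣ) : E) = (f x)⁻¹ := eq_inv_of_mul_eq_one_left h1
    change SqEquiv H (f ((x⁻¹ : Eˣ) : E)) 1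
    rw [h2]
    exact (SqEquiv.inv (right_ne_zero_of_mul_eq_one h1)).trans hx'

theorem mem_sqComap {E H : Type*} [Field E] [Field H] {f : E →* H} {x : Eˣ} :
    x ∈ sqComap f ↔ SqEquiv H (f x) 1 := Iff.rfl

variable (E : Type*) [Field E] [NumberField E]

/-- The units generating the square of a fractional ideal. -/
def rootGroup : Subgroup Eˣ where
  carrier := {x | ∃ κ, RootClass E x κ}
  mul_mem' {x y} hx hy := by
    obtain ⟨κ, hκ⟩ := hx
    obtain ⟨κ', hκ'⟩ := hy
    exact ⟨κ * κ', by
      rw [Units.val_mul]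
      exact hκ.mul hκ'⟩
  one_mem' := ⟨1, by simpa using RootClass.unit (E := E) 1⟩
  inv_mem' {x} hx := by
    obtain ⟨κ, hκ⟩ := hx
    exact ⟨κ, hκ.congr (by
      rw [Units.val_inv_eq_inv_val]
      exact (SqEquiv.inv x.ne_zero).symm)⟩

variable {E}

/-- The units which are, up to squares, in the image of `F`. -/
def baseGroup (F : Type*) [Field F] [Algebra F E] : Subgroup Eˣ where
  carrier := {x | ∃ b : F, SqEquiv E x (algebraMap F E b)}
  mul_mem' {x y} hx hy := by
    obtain ⟨b, hb⟩ := hx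
    obtain ⟨b', hb'⟩ := hy
    exact ⟨b * b', by
      rw [Units.val_mul, map_mul]
      exact hb.mul hb'⟩
  one_mem' := ⟨1, by
    rw [map_one]
    exact .refl 1⟩
  inv_mem' {x} hx := by
    obtain ⟨b, hb⟩ := hx
    exact ⟨b, by
      rw [Units.val_inv_eq_inv_val]
      exact (SqEquiv.inv x.ne_zero).trans hb⟩

theorem card_sq_eq_one_mul_le (h0 : (sqComap (MonoidHom.id E)).relIndex (rootGroup E) ≠ 0) :
    Nat.card {κ : ClassGroup (𝓞 E) // κ ^ 2 = 1} * 2 ^ (Units.rank E + 1) ≤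
      (sqComap (MonoidHom.id E)).relIndex (rootGroup E) := by
  obtain ⟨ψ, hψ⟩ := exists_units_not_sqEquiv E
  choose x hx using fun κ : {κ : ClassGroup (𝓞 E) // κ ^ 2 = 1} =>
    RootClass.exists_of_sq_eq_one κ.2
  have hψ0 : ∀ m, algebraMap (𝓞 E) E (ψ m) ≠ 0 := fun m =>
    (map_ne_zero_iff _ RingOfIntegers.coe_injective).2 (ψ m).ne_zero
  have hcard : Nat.card ({κ : ClassGroup (𝓞 E) // κ ^ 2 = 1} ×
      ((Fin (Units.rank E) → ZMod 2) × ZMod 2)) =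
      Nat.card {κ : ClassGroup (𝓞 E) // κ ^ 2 = 1} * 2 ^ (Units.rank E + 1) := by
    rw [Nat.card_prod, Nat.card_prod, Nat.card_pi, Finset.prod_const, Nat.card_zmod,
      Finset.card_univ, Fintype.card_fin, pow_succ]
  rw [← hcard]
  have hroot : ∀ κ m, RootClass E (x κ * algebraMap (𝓞 E) E (ψ m)) κ := fun κ m => by
    simpa using (hx κ).mul (RootClass.unit (ψ m))
  refine Subgroup.card_le_relIndex (fun p => Units.mk0 _ (hroot p.1 p.2).ne_zero)
    (fun p => ⟨_, hroot p.1 p.2⟩) ?_ h0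
  rintro ⟨κ, m⟩ ⟨κ', m'⟩ h
  rw [mem_sqComap] at h
  have h1 : SqEquiv E (x κ * algebraMap (𝓞 E) E (ψ m)) (x κ' * algebraMap (𝓞 E) E (ψ m')) :=
    SqEquiv.of_inv_mul (hroot κ m).ne_zero (by simpa using h)
  have h2 : κ = κ' := Subtype.ext (((hroot κ m).congr h1).unique (hroot κ' m'))
  subst h2
  have h3 : m = m' := by
    refine hψ _ _ ?_
    obtain ⟨c, hc, h⟩ := h1
    exact ⟨c, hc, mul_left_cancel₀ (hx κ).ne_zero (h.trans (by ring))⟩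
  rw [h3]

end RootGroups

section AmbiguousBound

theorem Algebra.norm_inv_mul_of_ne_zero {K E : Type*} [Field K] [Field E] [Algebra K E] {x : E} (hx : x ≠ 0) (y : E) :
    Algebra.norm K (x⁻¹ * y) = (Algebra.norm K x)⁻¹ * Algebra.norm K y := by
  rw [map_mul]
  congr 1
  exact eq_inv_of_mul_eq_one_left (by rw [← map_mul, inv_mul_cancel₀ hx, map_one])

/-- The possible norms to `F(s₁)`. -/
abbrev NormLabel (a t u : ZMod 2) : Type :=
  {p : ZMod 2 × ZMod 2 // (a = 1 → p.1 + p.2 = 0) ∧ (t = u → p.2 = 0)}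

/-- The exponents of an element supported on `i`, `1 + i`, `π₂`, `π₄`. -/
def twoVec (p : ZMod 2 × ZMod 2 × ZMod 2 × ZMod 2) : Fin 6 → ZMod 2 :=
  ![p.1, p.2.1, 0, p.2.2.1, 0, p.2.2.2]

/-- The possible norms from `F(s₁)` to `F`. -/
abbrev BaseLabel (a t u : ZMod 2) : Type :=
  {p : ZMod 2 × ZMod 2 × ZMod 2 × ZMod 2 // HilbZero a t u radOne (twoVec p)}

theorem card_label_of_eq_one (t u : ZMod 2) :
    Fintype.card (NormLabel 1 t u) * Fintype.card (BaseLabel 1 t u) ≤ 8 := by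
  revert t u
  decide +kernel

theorem card_label_of_eq_zero (t u : ZMod 2) :
    Fintype.card (NormLabel 0 t u) * Fintype.card (BaseLabel 0 t u) ≤ 4 := by
  revert t u
  decide +kernel

variable {q : Fin 4 → GaussianInt} {a t u : ZMod 2}
variable {F : Type*} [Field F] [NumberField F] [Algebra GaussianInt F]
  [IsFractionRing GaussianInt F]
variable {K₁ : Type*} [Field K₁] [NumberField K₁] [Algebra F K₁]
  [Algebra.IsQuadraticExtension F K₁]
variable {K₂ : Type*} [Field K₂] [NumberField K₂] [Algebra F K₂]
  [Algebra.IsQuadraticExtension F K₂]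
variable {K₃ : Type*} [Field K₃] [NumberField K₃] [Algebra F K₃]
  [Algebra.IsQuadraticExtension F K₃]
variable {L : Type*} [Field L] [NumberField L] [Algebra F L]
  [Algebra K₁ L] [IsScalarTower F K₁ L] [Algebra.IsQuadraticExtension K₁ L]
  [Algebra K₂ L] [IsScalarTower F K₂ L] [Algebra.IsQuadraticExtension K₂ L]
  [Algebra K₃ L] [IsScalarTower F K₃ L] [Algebra.IsQuadraticExtension K₃ L]
variable {s₁ : K₁} {s₂ : K₂} {s₃ : K₃}

namespace BiquadField

include F

theorem exists_normLabel (Q : BiquadField F K₁ K₂ K₃ L q a t u s₁ s₂ s₃) {x : L}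
    {κ : ClassGroup (𝓞 L)} (h : RootClass L x κ) : ∃ p : NormLabel a t u,
      SqEquiv K₁ (Algebra.norm K₁ x) (algebraMap F K₁ (gaussEl F q ![p.1.1, 0, p.1.2, 0, 0, 0])) := by
  obtain ⟨v, hv, hv'⟩ := Q.one.exists_sqEquiv Q.data (h.norm (K := K₁))
  rw [eq_vec_of_radOne hv] at hv'
  obtain ⟨y, z, hyz⟩ : ∃ y z, SqEquiv K₁ (Algebra.norm K₁ x)
      (algebraMap F K₁ (gaussEl F q ![y, 0, z, 0, 0, 0])) := by
    by_cases h4 : v 4 = 0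
    · rw [h4] at hv'
      exact ⟨_, _, hv'⟩
    · have two : ∀ x : ZMod 2, x ≠ 0 → x = 1 := by decide
      rw [two _ h4] at hv'
      refine ⟨v 0, v 2 + 1, hv'.trans ?_⟩
      have h1 := (Q.data.gaussEl_add (F := F) ![v 0, 0, v 2 + 1, 0, 0, 0] radOne).map (algebraMap F K₁)
      rw [map_mul, ← Q.one.sq, show ![v 0, 0, v 2 + 1, 0, 0, 0] + radOne =
        ![v 0, 0, v 2, 0, 1, 0] by
          ext k
          fin_cases k <;> simp [radOne, add_assoc, CharTwo.add_self_eq_zero]] at h1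
      refine h1.symm.trans (SqEquiv.mul_sq ?_)
      rintro h0
      exact Q.one.ne 0 (by rw [map_zero, h0])
  refine ⟨⟨(y, z), fun ha => ?_, fun htu => ?_⟩, hyz⟩
  · subst ha
    have h1 := Q.data.hilb_of_norm_tower Q.one.sq Q.one.ne Q.sq_two_one Q.ne hyz
      (j := 1) (by decide) (by rw [residLin_eq]; simp [radOne]; decide)
    simpa [hilb, residLin_eq, radTwo, primeIdx] using h1
  · by_contra hz
    have two : ∀ x : ZMod 2, x ≠ 0 → x = 1 := by decide
    dsimp only at hz
    rw [two _ hz] at hyz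
    exact Q.data.false_of_norm_tower htu Q.one.sq Q.one.ne Q.sq_two_one Q.ne hyz

theorem exists_baseLabel (Q : BiquadField F K₁ K₂ K₃ L q a t u s₁ s₂ s₃) {x : L}
    {κ : ClassGroup (𝓞 L)} (h : RootClass L x κ) (h' : SqEquiv K₁ (Algebra.norm K₁ x) 1) :
    ∃ (p : BaseLabel a t u) (α : K₁), SqEquiv L x (algebraMap K₁ L α) ∧
      SqEquiv F (Algebra.norm F α) (gaussEl F q (twoVec p)) := by
  obtain ⟨c, hc, h1⟩ := h'
  rw [one_mul] at h1
  obtain ⟨α, z, hα, hz, hx, -⟩ := exists_sqEquiv_of_norm_eq_sq h.ne_zero h1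
  have h2 := (h.congr hx).norm (K := K₂)
  rw [Q.norm_algebraMap_one] at h2
  obtain ⟨w, hw, hw'⟩ := Q.data.exists_sqEquiv_of_rootClass Q.two.zero_mem Q.two.rad h2
  have h3 : HilbZero a t u radOne w := Q.data.hilb_of_norm Q.one.sq Q.one.ne hw'
  rw [eq_vec_of_radTwo hw] at h3 hw'
  exact ⟨⟨(w 0, w 1, w 3, w 5), h3⟩, α, hx, hw'⟩

theorem exists_rootLabel (Q : BiquadField F K₁ K₂ K₃ L q a t u s₁ s₂ s₃) {b : F}
    {κ : ClassGroup (𝓞 L)} (h : RootClass L (algebraMap F L b) κ) :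
    ∃ p : ZMod 2 × ZMod 2 × ZMod 2 × ZMod 2, SqEquiv L (algebraMap F L b)
      (algebraMap F L (gaussEl F q ![p.1, p.2.1, 0, 0, p.2.2.1, p.2.2.2])) := by
  obtain ⟨v, -, hv⟩ := Q.data.exists_sqEquiv_of_rootClass (Finset.mem_univ _) Q.rad h
  have h1 := hv.map (algebraMap F L)
  have two : ∀ x : ZMod 2, x = 0 ∨ x = 1 := by decide
  obtain ⟨v', hv', h2⟩ : ∃ v' : Fin 6 → ZMod 2, v' 3 = 0 ∧
      SqEquiv L (algebraMap F L b) (algebraMap F L (gaussEl F q v')) := by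
    rcases two (v 3) with h3 | h3
    · exact ⟨v, h3, h1⟩
    · refine ⟨v + radTwo, by simp [h3, radTwo, CharTwo.add_self_eq_zero], h1.trans ?_⟩
      have h4 := (Q.data.gaussEl_add (F := F) v radTwo).map (algebraMap F L)
      rw [map_mul, ← Q.sq_two] at h4
      exact (SqEquiv.mul_sq Q.two_ne_zero).symm.trans h4
  obtain ⟨v'', hv'', hv3, h3⟩ : ∃ v'' : Fin 6 → ZMod 2, v'' 2 = 0 ∧ v'' 3 = 0 ∧
      SqEquiv L (algebraMap F L b) (algebraMap F L (gaussEl F q v'')) := by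
    rcases two (v' 2) with h3 | h3
    · exact ⟨v', h3, hv', h2⟩
    · refine ⟨v' + radOne, by simp [h3, radOne, CharTwo.add_self_eq_zero],
        by simp [hv', radOne], h2.trans ?_⟩
      have h4 := (Q.data.gaussEl_add (F := F) v' radOne).map (algebraMap F L)
      rw [map_mul, ← Q.sq_one] at h4
      exact (SqEquiv.mul_sq Q.one_ne_zero).symm.trans h4
  rw [vec_eta_six v'', hv'', hv3] at h3
  exact ⟨(v'' 0, v'' 1, v'' 4, v'' 5), h3⟩

theorem card_sq_eq_one_le (Q : BiquadField F K₁ K₂ K₃ L q a t u s₁ s₂ s₃) :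
    Nat.card {κ : ClassGroup (𝓞 L) // κ ^ 2 = 1} ≤
      Fintype.card (NormLabel a t u) * Fintype.card (BaseLabel a t u) := by
  have hne := fun v => Q.data.gaussEl_ne_zero (F := F) v
  have hne₁ : ∀ v, algebraMap F K₁ (gaussEl F q v) ≠ 0 := fun v => by simpa using hne v
  have hneL : ∀ v, algebraMap F L (gaussEl F q v) ≠ 0 := fun v => by simpa using hne v
  have r₁ : (sqComap (Algebra.norm K₁) ⊓ rootGroup L).relIndex (rootGroup L) ≠ 0 ∧
      (sqComap (Algebra.norm K₁) ⊓ rootGroup L).relIndex (rootGroup L) ≤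
        Nat.card (NormLabel a t u) := by
    refine Subgroup.relIndex_le_card (fun x p => SqEquiv K₁ (Algebra.norm K₁ (x : L))
      (algebraMap F K₁ (gaussEl F q ![p.1.1, 0, p.1.2, 0, 0, 0]))) ?_ ?_
    · rintro x ⟨κ, hκ⟩
      exact Q.exists_normLabel hκ
    · intro x hx y hy p hxp hyp
      refine Subgroup.mem_inf.2 ⟨?_, (rootGroup L).mul_mem ((rootGroup L).inv_mem hx) hy⟩
      rw [mem_sqComap, Units.val_mul, Units.val_inv_eq_inv_val, Algebra.norm_inv_mul_of_ne_zero x.ne_zero]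
      exact SqEquiv.inv_mul (hne₁ _) hxp hyp
  have r₂ : (baseGroup F ⊓ rootGroup L).relIndex (sqComap (Algebra.norm K₁) ⊓ rootGroup L) ≠ 0 ∧
      (baseGroup F ⊓ rootGroup L).relIndex (sqComap (Algebra.norm K₁) ⊓ rootGroup L) ≤
        Nat.card (BaseLabel a t u) := by
    refine Subgroup.relIndex_le_card (fun x p => ∃ α : K₁, SqEquiv L (x : L) (algebraMap K₁ L α) ∧
      SqEquiv F (Algebra.norm F α) (gaussEl F q (twoVec p))) ?_ ?_
    · rintro x ⟨hx, κ, hκ⟩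
      exact Q.exists_baseLabel hκ hx
    · rintro x hx y hy p ⟨α, hα, hα'⟩ ⟨β, hβ, hβ'⟩
      refine Subgroup.mem_inf.2 ⟨?_, (rootGroup L).mul_mem ((rootGroup L).inv_mem hx.2) hy.2⟩
      obtain ⟨c, hc, h1⟩ := SqEquiv.inv_mul (hne _) hα' hβ'
      have hα0 : α ≠ 0 := fun h0 => by
        have := hα.ne_zero_iff.1 x.ne_zero
        rw [h0, map_zero] at this
        exact this rfl
      have hβ0 : β ≠ 0 := fun h0 => by
        have := hβ.ne_zero_iff.1 y.ne_zero
        rw [h0, map_zero] at this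
        exact this rfl
      rw [one_mul, ← Algebra.norm_inv_mul_of_ne_zero hα0] at h1
      obtain ⟨b, z, hb, hz, h2, -⟩ :=
        exists_sqEquiv_of_norm_eq_sq (mul_ne_zero (inv_ne_zero hα0) hβ0) h1
      refine ⟨b, ?_⟩
      rw [Units.val_mul, Units.val_inv_eq_inv_val, IsScalarTower.algebraMap_apply F K₁ L]
      refine SqEquiv.trans ?_ (h2.map (algebraMap K₁ L))
      rw [map_mul, map_inv₀]
      refine SqEquiv.mul ?_ hβ
      exact ((SqEquiv.inv x.ne_zero).trans hα).trans (SqEquiv.inv (by simpa using hα0)).symm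
  have r₃ : (sqComap (MonoidHom.id L)).relIndex (baseGroup F ⊓ rootGroup L) ≠ 0 ∧
      (sqComap (MonoidHom.id L)).relIndex (baseGroup F ⊓ rootGroup L) ≤
        Nat.card (ZMod 2 × ZMod 2 × ZMod 2 × ZMod 2) := by
    refine Subgroup.relIndex_le_card (fun x p => SqEquiv L (x : L)
      (algebraMap F L (gaussEl F q ![p.1, p.2.1, 0, 0, p.2.2.1, p.2.2.2]))) ?_ ?_
    · rintro x ⟨⟨b, hb⟩, κ, hκ⟩
      obtain ⟨p, hp⟩ := Q.exists_rootLabel (hκ.congr hb)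
      exact ⟨p, hb.trans hp⟩
    · intro x hx y hy p hxp hyp
      rw [mem_sqComap]
      simpa using SqEquiv.inv_mul (hneL _) hxp hyp
  have i₁ : baseGroup F ⊓ rootGroup L ≤ sqComap (Algebra.norm K₁) ⊓ rootGroup L := by
    rintro x ⟨⟨b, c, hc, hx⟩, hx'⟩
    refine Subgroup.mem_inf.2 ⟨?_, hx'⟩
    rw [mem_sqComap, hx, map_mul, map_pow, IsScalarTower.algebraMap_apply F K₁ L,
      Algebra.norm_algebraMap, Algebra.IsQuadraticExtension.finrank_eq_two, ← mul_pow]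
    refine SqEquiv.sq_one (mul_ne_zero ?_ (Algebra.norm_ne_zero_iff.2 hc))
    intro h0
    refine x.ne_zero ?_
    rw [hx, IsScalarTower.algebraMap_apply F K₁ L, h0, map_zero, zero_mul]
  have i₂ : sqComap (MonoidHom.id L) ≤ baseGroup F ⊓ rootGroup L := by
    intro x hx
    rw [mem_sqComap] at hx
    refine ⟨⟨1, by simpa using hx⟩, 1, ?_⟩
    exact RootClass.congr (by simpa using RootClass.unit (E := L) 1) hx.symm
  have e₁ := Subgroup.relIndex_mul_relIndex _ _ _ i₁ inf_le_right
  have e₂ := Subgroup.relIndex_mul_relIndex _ _ _ i₂ (i₁.trans inf_le_right)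
  have h0 : (sqComap (MonoidHom.id L)).relIndex (rootGroup L) ≠ 0 := by
    rw [← e₂, ← e₁]
    exact mul_ne_zero r₃.1 (mul_ne_zero r₂.1 r₁.1)
  have h := card_sq_eq_one_mul_le h0
  rw [← e₂, ← e₁, Q.rank] at h
  have h16 : Nat.card (ZMod 2 × ZMod 2 × ZMod 2 × ZMod 2) = 16 := by
    simp [Nat.card_prod]
  rw [h16] at r₃
  rw [Nat.card_eq_fintype_card] at r₁ r₂
  have := Nat.mul_le_mul r₃.2 (Nat.mul_le_mul r₂.2 r₁.2)
  have h' := h.trans this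
  rw [mul_comm (Fintype.card (NormLabel a t u))]
  omega

end BiquadField

end AmbiguousBound

section NormImage

open scoped nonZeroDivisors

theorem sup_span_mul_sup_span {R : Type*} [CommRing R] {A : Ideal R} {p k r s : R}
    (hA : A ^ 2 = Ideal.span {p}) (hk : r ^ 2 - s ^ 2 = p * k) (hr : IsCoprime p (2 * r)) :
    (A ⊔ Ideal.span {s - r}) * (A ⊔ Ideal.span {-s - r}) = A := by
  have hp : p ∈ A * A := by
    rw [← pow_two, hA]
    exact Ideal.mem_span_singleton_self p
  apply le_antisymm
  · rw [Ideal.sup_mul, Ideal.mul_sup, Ideal.mul_sup, Ideal.span_singleton_mul_span_singleton]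
    refine sup_le (sup_le Ideal.mul_le_left Ideal.mul_le_left) (sup_le Ideal.mul_le_right ?_)
    rw [Ideal.span_singleton_le_iff_mem, show (s - r) * (-s - r) = p * k by rw [← hk]; ring]
    exact Ideal.mul_mem_right _ _ (Ideal.mul_le_left hp)
  · intro x hx
    obtain ⟨α, β, h⟩ := hr
    have h1 : (x * α) * p + -β * (x * (-s - r) + (s - r) * x) = x := by
      linear_combination x * h
    rw [← h1]
    refine add_mem (Ideal.mul_mem_left _ _ (Ideal.mul_mono le_sup_left le_sup_left hp))
      (Ideal.mul_mem_left _ _ (add_mem ?_ ?_))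
    · exact Ideal.mul_mem_mul (Ideal.mem_sup_left hx)
        (Ideal.mem_sup_right (Ideal.mem_span_singleton_self _))
    · exact Ideal.mul_mem_mul (Ideal.mem_sup_right (Ideal.mem_span_singleton_self _))
        (Ideal.mem_sup_left hx)

section

variable {K E : Type*} [Field K] [NumberField K] [Field E] [NumberField E] [Algebra K E]
  [Algebra.IsQuadraticExtension K E]

theorem map_algebraMap_injective {I J : Ideal (𝓞 K)}
    (h : I.map (algebraMap (𝓞 K) (𝓞 E)) = J.map (algebraMap (𝓞 K) (𝓞 E))) : I = J := by
  have h1 := congrArg (Ideal.relNorm (𝓞 K)) h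
  rw [Ideal.relNorm_algebraMap, Ideal.relNorm_algebraMap] at h1
  exact Ideal.pow_left_injective_of_isDedekindDomain (Module.finrank_pos (R := 𝓞 K) (M := 𝓞 E)).ne' h1

/-- The class of a ramified prime which splits in a quadratic extension is a norm. -/
theorem exists_clNorm_eq {σ : Gal(E/K)} (hσ : σ ≠ 1) {P : (Ideal (𝓞 K))⁰} {p k r : 𝓞 K} {s : 𝓞 E}
    (hp : p ≠ 0) (hP : (P : Ideal (𝓞 K)) ^ 2 = Ideal.span {p})
    (hs : σ (algebraMap (𝓞 E) E s) = - algebraMap (𝓞 E) E s)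
    (hk : algebraMap (𝓞 K) (𝓞 E) (r ^ 2) - s ^ 2 = algebraMap (𝓞 K) (𝓞 E) (p * k))
    (hr : IsCoprime p (2 * r)) : ∃ d, clNorm K E d = ClassGroup.mk0 P := by
  set f := algebraMap (𝓞 K) (𝓞 E) with hf
  set A : Ideal (𝓞 E) := (P : Ideal (𝓞 K)).map f with hA
  have hA2 : A ^ 2 = Ideal.span {f p} := by
    rw [hA, ← Ideal.map_pow, hP, Ideal.map_span, Set.image_singleton]
  have hmul := sup_span_mul_sup_span hA2 (k := f k) (r := f r) (s := s)
    (by rw [← map_pow, ← map_mul, ← hk])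
    (by have h := hr.map f; rwa [map_mul, map_ofNat] at h)
  have hJ0 : A ⊔ Ideal.span {s - f r} ≠ 0 := by
    intro h0
    rw [h0, zero_mul] at hmul
    rw [← hmul, zero_pow two_ne_zero, eq_comm, Ideal.zero_eq_bot,
      Ideal.span_singleton_eq_bot] at hA2
    exact hp (FaithfulSMul.algebraMap_injective (𝓞 K) (𝓞 E) (hA2.trans (map_zero f).symm))
  set J : (Ideal (𝓞 E))⁰ := ⟨_, mem_nonZeroDivisors_of_ne_zero hJ0⟩ with hJ
  have hgal : (galIdeal σ J : Ideal (𝓞 E)) = A ⊔ Ideal.span {-s - f r} := by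
    change (A ⊔ Ideal.span {s - f r}).map _ = _
    rw [Ideal.map_sup, Ideal.map_span, Set.image_singleton, hA, Ideal.map_map]
    have hfix : ∀ x, RingOfIntegers.mapRingEquiv (σ : E ≃+* E) (f x) = f x := fun x => by
      apply RingOfIntegers.coe_injective
      exact σ.commutes (x : K)
    congr 2
    · ext x
      exact congrArg _ (hfix x)
    · rw [map_sub]
      congr 2
      · apply RingOfIntegers.coe_injective
        rw [map_neg, ← hs]
        rfl
      · exact hfix r
  refine ⟨ClassGroup.mk0 J, clNorm_mk0 (map_algebraMap_injective (E := E) ?_)⟩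
  rw [map_relNorm_eq hσ J, hgal]
  exact hmul.symm

end

variable {q : Fin 4 → GaussianInt} {a t u : ZMod 2}
variable {F : Type*} [Field F] [NumberField F] [Algebra GaussianInt F]
  [IsFractionRing GaussianInt F]
variable {K₁ : Type*} [Field K₁] [NumberField K₁] [Algebra F K₁]
  [Algebra.IsQuadraticExtension F K₁]
variable {K₂ : Type*} [Field K₂] [NumberField K₂] [Algebra F K₂]
  [Algebra.IsQuadraticExtension F K₂]
variable {K₃ : Type*} [Field K₃] [NumberField K₃] [Algebra F K₃]
  [Algebra.IsQuadraticExtension F K₃]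
variable {L : Type*} [Field L] [NumberField L] [Algebra F L]
  [Algebra K₁ L] [IsScalarTower F K₁ L] [Algebra.IsQuadraticExtension K₁ L]
  [Algebra K₂ L] [IsScalarTower F K₂ L] [Algebra.IsQuadraticExtension K₂ L]
  [Algebra K₃ L] [IsScalarTower F K₃ L] [Algebra.IsQuadraticExtension K₃ L]
variable {s₁ : K₁} {s₂ : K₂} {s₃ : K₃} {c : ClassGroup (𝓞 L)}

namespace BiquadField

include F

theorem exists_clNorm_rootClass (Q : BiquadField F K₁ K₂ K₃ L q a t u s₁ s₂ s₃)
    {σ : Gal(L/K₃)} (hσ : σ ≠ 1) {D : Fin 6 → ZMod 2} {s : L}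
    (hs : s ^ 2 = algebraMap F L (gaussEl F q D)) (hs' : σ s = -s) {j : Fin 4}
    (hD : D (primeIdx j) = 0) (hD' : residLin a t u j D = 0) : ∃ d,
      RootClass K₃ (algebraMap F K₃ (gaussEl F q (Pi.single (primeIdx j) 1))) (clNorm K₃ L d) := by
  obtain ⟨φ, hφ, -⟩ := exists_gaussianInt_hom F K₃
  obtain ⟨P, hP, -⟩ := Q.three.exists_ideal_sq Q.data (j := j) (by fin_cases j <;> decide) hφ
  have hroot := rootClass_prime Q.data hφ hP
  obtain ⟨hd, hres⟩ := Q.data.resid_gaussProd (j := j) hD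
  rw [hD', resid_eq_zero_iff] at hres
  obtain ⟨m, k, hk⟩ := hres
  have hk' : (m : GaussianInt) ^ 2 - gaussProd q D = q j * k := by
    rw [← hk]
    congr 1
    ext <;> simp [pow_two]
  have hφ0 : ∀ z, z ≠ 0 → φ z ≠ 0 := fun z hz => by
    rw [Ne, ← map_eq_zero_iff _ (RingOfIntegers.coe_injective (K := K₃)), hφ, map_eq_zero,
      map_eq_zero_iff _ (IsFractionRing.injective GaussianInt F)]
    exact hz
  have hsφ : s ^ 2 = algebraMap (𝓞 L) L (algebraMap (𝓞 K₃) (𝓞 L) (φ (gaussProd q D))) := by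
    rw [hs, ← IsScalarTower.algebraMap_apply (𝓞 K₃) (𝓞 L) L,
      IsScalarTower.algebraMap_apply (𝓞 K₃) K₃ L, hφ, ← IsScalarTower.algebraMap_apply F K₃ L]
    rfl
  have hint : IsIntegral ℤ s := IsIntegral.of_pow two_pos (hsφ ▸ RingOfIntegers.isIntegral_coe _)
  obtain ⟨s, rfl⟩ : ∃ s' : 𝓞 L, algebraMap (𝓞 L) L s' = s := ⟨⟨s, hint⟩, rfl⟩
  have hcop : ¬ q j ∣ 2 * (m : GaussianInt) := by
    intro h
    rcases (Q.data.prime j).dvd_or_dvd h with h | h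
    · exact Q.data.not_dvd_two j h
    · apply hd
      rw [show gaussProd q D = (m : GaussianInt) ^ 2 - q j * k by rw [← hk']; ring]
      exact dvd_sub (dvd_pow h _root_.two_ne_zero) (dvd_mul_right _ _)
  obtain ⟨d, hd⟩ := exists_clNorm_eq (E := L) hσ (P := P) (p := φ (q j)) (k := φ k)
    (r := φ (m : GaussianInt)) (s := s) (hφ0 _ (Q.data.prime j).ne_zero) hP hs' (by
      have h1 : s ^ 2 = algebraMap (𝓞 K₃) (𝓞 L) (φ (gaussProd q D)) := by
        apply RingOfIntegers.coe_injective
        rw [map_pow]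
        exact hsφ
      rw [h1, ← map_sub, ← map_pow, ← map_sub, hk', map_mul]) (by
      have h := (isCoprime_of_prime (Q.data.prime j) hcop).map φ
      rwa [map_mul, map_ofNat] at h)
  exact ⟨d, hd ▸ hroot⟩

theorem clNorm_ne_one (Q : BiquadField F K₁ K₂ K₃ L q a t u s₁ s₂ s₃) {v : Fin 6 → ZMod 2}
    {κ : ClassGroup (𝓞 K₃)} (h : RootClass K₃ (algebraMap F K₃ (gaussEl F q v)) κ)
    (hv : ¬ HilbUnit a t u radThree v) : κ ≠ 1 := by
  rintro rfl
  obtain ⟨ε, hε⟩ := h.exists_unit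
  exact hv (Q.three.hilbUnit_of_unit Q.data hε.symm)

theorem exists_pair_clNorm (Q : BiquadField F K₁ K₂ K₃ L q a t u s₁ s₂ s₃) :
    ∃ d d' : ClassGroup (𝓞 L), clNorm K₃ L d ^ 2 = 1 ∧ clNorm K₃ L d' ^ 2 = 1 ∧
      clNorm K₃ L d ≠ 1 ∧ clNorm K₃ L d' ≠ 1 ∧ clNorm K₃ L d * clNorm K₃ L d' ≠ 1 := by
  obtain ⟨σ, hσ⟩ := exists_gal_ne_one (K := K₃) (E := L)
  have main : ∀ j j' : Fin 4, ¬ HilbUnit a t u radThree (Pi.single (primeIdx j) 1) →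
      ¬ HilbUnit a t u radThree (Pi.single (primeIdx j') 1) →
      ¬ HilbUnit a t u radThree (Pi.single (primeIdx j) 1 + Pi.single (primeIdx j') 1) →
      (∃ d, RootClass K₃ (algebraMap F K₃ (gaussEl F q (Pi.single (primeIdx j) 1)))
        (clNorm K₃ L d)) →
      (∃ d, RootClass K₃ (algebraMap F K₃ (gaussEl F q (Pi.single (primeIdx j') 1)))
        (clNorm K₃ L d)) →
      ∃ d d' : ClassGroup (𝓞 L), clNorm K₃ L d ^ 2 = 1 ∧ clNorm K₃ L d' ^ 2 = 1 ∧
        clNorm K₃ L d ≠ 1 ∧ clNorm K₃ L d' ≠ 1 ∧ clNorm K₃ L d * clNorm K₃ L d' ≠ 1 := by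
    rintro j j' hj hj' hjj' ⟨d, hd⟩ ⟨d', hd'⟩
    refine ⟨d, d', hd.sq_eq_one, hd'.sq_eq_one, Q.clNorm_ne_one hd hj, Q.clNorm_ne_one hd' hj',
      Q.clNorm_ne_one (v := Pi.single (primeIdx j) 1 + Pi.single (primeIdx j') 1) ?_ hjj'⟩
    refine (hd.mul hd').congr ?_
    rw [← map_mul]
    exact (Q.data.gaussEl_add _ _).map _
  have two : ∀ x : ZMod 2, x = 0 ∨ x = 1 := by decide
  rcases two a with rfl | rfl
  · have hs := Q.sq_two
    have hs' := Q.galThree_two hσ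
    refine main 0 2 ?_ ?_ ?_ (Q.exists_clNorm_rootClass hσ hs hs' (by decide) ?_)
      (Q.exists_clNorm_rootClass hσ hs hs' (by decide) ?_)
    iterate 3 clear * -; revert t u; decide +kernel
    all_goals rw [residLin_eq]; simp [radTwo]; try decide
  · have hs := Q.sq_one
    have hs' := Q.galThree_one hσ
    refine main 1 3 ?_ ?_ ?_ (Q.exists_clNorm_rootClass hσ hs hs' (by decide) ?_)
      (Q.exists_clNorm_rootClass hσ hs hs' (by decide) ?_)
    iterate 3 clear * -; revert t u; decide +kernel
    all_goals rw [residLin_eq]; simp [radOne]; try decide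

end BiquadField

theorem two_dvd_card {H : Type*} [Group H] [Finite H] {x : H} (hx : x ^ 2 = 1) (hx' : x ≠ 1) :
    2 ∣ Nat.card H := orderOf_eq_prime hx hx' ▸ orderOf_dvd_natCard x

theorem four_dvd_card {H : Type*} [CommGroup H] [Finite H] {x y : H} (hx : x ^ 2 = 1)
    (hy : y ^ 2 = 1) (hx' : x ≠ 1) (hy' : y ≠ 1) (hxy : x * y ≠ 1) : 4 ∣ Nat.card H := by
  rw [Subgroup.card_eq_card_quotient_mul_card_subgroup (Subgroup.zpowers x), Nat.card_zpowers,
    orderOf_eq_prime hx hx']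
  refine mul_dvd_mul_right (two_dvd_card (x := (y : H ⧸ Subgroup.zpowers x)) ?_ ?_) 2
  · rw [← QuotientGroup.mk_pow, hy, QuotientGroup.mk_one]
  · rw [Ne, QuotientGroup.eq_one_iff, Subgroup.mem_zpowers_iff]
    rintro ⟨k, rfl⟩
    rcases Int.even_or_odd' k with ⟨m, rfl | rfl⟩
    · rw [zpow_mul] at hy'
      exact hy' (by norm_cast; rw [hx, one_zpow])
    · apply hxy
      rw [← zpow_one_add, show 1 + (2 * m + 1) = 2 * (m + 1) by ring, zpow_mul]
      norm_cast
      rw [hx, one_zpow]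

theorem BiquadField.eight_dvd_card (Q : BiquadField F K₁ K₂ K₃ L q a t u s₁ s₂ s₃) :
    8 ∣ Nat.card (ClassGroup (𝓞 L)) := by
  obtain ⟨c, hc⟩ := Q.exists_rootClass
  have hc1 := Q.rootClass_ne_one hc
  have hc2 := hc.sq_eq_one
  have hN : clNorm K₃ L c = 1 := by
    rw [IsScalarTower.algebraMap_apply F K₃ L] at hc
    exact clNorm_eq_one_of_rootClass_algebraMap hc
  obtain ⟨d, d', hd, hd', h1, h2, h3⟩ := Q.exists_pair_clNorm
  rw [Subgroup.card_eq_card_quotient_mul_card_subgroup (clNorm K₃ L).ker,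
    Nat.card_congr (QuotientGroup.quotientKerEquivRange (clNorm K₃ L)).toEquiv]
  refine mul_dvd_mul (a := 4) (c := 2) (four_dvd_card (x := ⟨_, d, rfl⟩) (y := ⟨_, d', rfl⟩)
    (Subtype.ext hd) (Subtype.ext hd') (fun h => h1 (congrArg Subtype.val h))
    (fun h => h2 (congrArg Subtype.val h)) (fun h => h3 (congrArg Subtype.val h)))
    (two_dvd_card (x := ⟨c, hN⟩) (Subtype.ext hc2) (fun h => hc1 (congrArg Subtype.val h)))

end NormImage

section TwoGroups

theorem ncard_pair_le {α : Type*} (a b : α) : ({a, b} : Set α).ncard ≤ 2 :=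
  (Set.ncard_insert_le a {b}).trans (by rw [Set.ncard_singleton])

theorem nonempty_addEquiv_of_sq_eq_one {H : Type*} [CommGroup H] (hH : Nat.card H = 8)
    (hsq : ∀ x : H, x ^ 2 = 1) : Nonempty (Additive H ≃+ (ZMod 2 × ZMod 2 × ZMod 2)) := by
  have : Finite H := Nat.finite_of_card_ne_zero (by omega)
  let _ : Module (ZMod 2) (Additive H) := AddCommGroup.zmodModule fun x => hsq x.toMul
  have h1 : Nat.card (Additive H) = 2 ^ Module.finrank (ZMod 2) (Additive H) := by
    rw [Module.natCard_eq_pow_finrank (K := ZMod 2), Nat.card_zmod]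
  have h2 : Module.finrank (ZMod 2) (Additive H) = 3 := by
    apply Nat.pow_right_injective le_rfl
    change 2 ^ _ = 2 ^ 3
    rw [← h1]
    exact hH
  obtain ⟨f⟩ := FiniteDimensional.nonempty_linearEquiv_of_finrank_eq (R := ZMod 2)
    (M := Additive H) (M' := ZMod 2 × ZMod 2 × ZMod 2) (by rw [h2]; simp)
  exact ⟨f.toAddEquiv⟩

theorem nonempty_addEquiv_of_order_four {H : Type*} [AddCommGroup H] (hH : Nat.card H = 8)
    {x y : H} (hx : 2 • x ≠ 0) (hx' : 4 • x = 0) (hy : 2 • y = 0) (hy0 : y ≠ 0)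
    (hxy : y ≠ 2 • x) : Nonempty (H ≃+ (ZMod 2 × ZMod 4)) := by
  have : Finite H := Nat.finite_of_card_ne_zero (by omega)
  let α : ZMod 2 →+ H := ZMod.lift 2 ⟨zmultiplesHom H y, by simpa [← natCast_zsmul] using hy⟩
  let β : ZMod 4 →+ H := ZMod.lift 4 ⟨zmultiplesHom H x, by simpa [← natCast_zsmul] using hx'⟩
  have hα : α 1 = y := by
    have := ZMod.lift_coe 2 ⟨zmultiplesHom H y, by simpa [← natCast_zsmul] using hy⟩ (1 : ℤ)
    simpa [α] using this
  have hβ : β 1 = x := by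
    have := ZMod.lift_coe 4 ⟨zmultiplesHom H x, by simpa [← natCast_zsmul] using hx'⟩ (1 : ℤ)
    simpa [β] using this
  have hβ2 : β 2 = 2 • x := by
    rw [show (2 : ZMod 4) = 2 • 1 by decide, map_nsmul, hβ]
  have hβ3 : β 3 = 3 • x := by
    rw [show (3 : ZMod 4) = 3 • 1 by decide, map_nsmul, hβ]
  have hx0 : x ≠ 0 := by
    rintro rfl
    simp at hx
  have hx3 : 3 • x ≠ 0 := by
    intro h
    apply hx0
    rw [show 4 • x = 3 • x + x by abel, h, zero_add] at hx'
    exact hx'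
  have hinj : Function.Injective (α.coprod β) := by
    rw [injective_iff_map_eq_zero]
    rintro ⟨m, n⟩ h
    rw [AddMonoidHom.coprod_apply] at h
    have key : ∀ z, y + z = 0 → 2 • z = 0 := by
      intro z hz
      have : 2 • (y + z) = 0 := by rw [hz, smul_zero]
      rwa [smul_add, hy, zero_add] at this
    have two : ∀ m : ZMod 2, m = 0 ∨ m = 1 := by decide
    have four : ∀ n : ZMod 4, n = 0 ∨ n = 1 ∨ n = 2 ∨ n = 3 := by decide
    rcases two m with rfl | rfl <;> rcases four n with rfl | rfl | rfl | rfl <;>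
      simp only [map_zero, hα, hβ, hβ2, hβ3, zero_add, add_zero] at h
    · rfl
    · exact absurd h hx0
    · exact absurd h hx
    · exact absurd h hx3
    · exact absurd h hy0
    · exact absurd (key _ h) hx
    · apply absurd _ hxy
      rw [← add_zero (2 • x), ← h, add_left_comm, ← two_nsmul, smul_smul]
      norm_num [hx']
    · apply absurd _ hx
      have := key _ h
      rw [smul_smul, show 2 * 3 = 4 + 2 by norm_num, add_smul, hx', zero_add] at this
      exact this
  have hcard : Nat.card (ZMod 2 × ZMod 4) = Nat.card H := by
    rw [hH, Nat.card_prod, Nat.card_zmod, Nat.card_zmod]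
  exact ⟨(AddEquiv.ofBijective (α.coprod β)
    ((Nat.bijective_iff_injective_and_card _).2 ⟨hinj, hcard⟩)).symm⟩

variable {G : Type*} [CommGroup G] [Finite G]

theorem eight_dvd_card_sylow (hG : 8 ∣ Nat.card G) (P : Sylow 2 G) : 8 ∣ Nat.card P :=
  Sylow.pow_dvd_card_of_pow_dvd_card (p := 2) (n := 3) P hG

theorem nonempty_sylow_addEquiv_of_sq_ne {c : G} (hG : 8 ∣ Nat.card G)
    (hsq : ∀ (d : G) (n : ℕ), d ^ 2 ^ n = 1 → d ^ 2 = 1 ∨ d ^ 2 = c) (hc : ∀ d : G, d ^ 2 ≠ c)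
    (hcard : Nat.card {κ : G // κ ^ 2 = 1} ≤ 8) (P : Sylow 2 G) :
    Nonempty (Additive P ≃+ (ZMod 2 × ZMod 2 × ZMod 2)) := by
  have hP : ∀ x : P, x ^ 2 = 1 := by
    intro x
    obtain ⟨n, hn⟩ := P.isPGroup' x
    apply Subtype.ext
    exact (hsq x n (congrArg Subtype.val hn)).resolve_right (hc _)
  have hle : Nat.card P ≤ 8 := by
    refine le_trans (Nat.card_le_card_of_injective
      (fun x : P => (⟨x, congrArg Subtype.val (hP x)⟩ : {κ : G // κ ^ 2 = 1})) ?_) hcard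
    intro x y h
    rw [Subtype.mk.injEq] at h
    exact Subtype.ext h
  exact nonempty_addEquiv_of_sq_eq_one
    (le_antisymm hle (Nat.le_of_dvd Nat.card_pos (eight_dvd_card_sylow hG P))) hP

theorem nonempty_sylow_addEquiv {c : G} (hc : c ^ 2 = 1) (hG : 8 ∣ Nat.card G)
    (hsq : ∀ (d : G) (n : ℕ), d ^ 2 ^ n = 1 → d ^ 2 = 1 ∨ d ^ 2 = c)
    (hcard : Nat.card {κ : G // κ ^ 2 = 1} ≤ 4) (P : Sylow 2 G) :
    Nonempty (Additive P ≃+ (ZMod 2 × ZMod 4)) := by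
  have hP : ∀ x : P, (x : G) ^ 2 = 1 ∨ (x : G) ^ 2 = c := by
    intro x
    obtain ⟨n, hn⟩ := P.isPGroup' x
    exact hsq x n (congrArg Subtype.val hn)
  set S := (powMonoidHom 2 : P →* P) with hS
  have hk : ∀ x : S.ker, ((x : P) : G) ^ 2 = 1 := fun x => Subtype.ext_iff.1 x.2
  have hker : Nat.card S.ker ≤ 4 := by
    refine le_trans (Nat.card_le_card_of_injective
      (fun x : S.ker => (⟨(x : P), hk x⟩ : {κ : G // κ ^ 2 = 1})) ?_) hcard
    intro x y h
    rw [Subtype.mk.injEq] at h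
    exact Subtype.ext (Subtype.ext h)
  have hrange : Nat.card S.range ≤ 2 := by
    have h1 : ∀ y : S.range, ((y : P) : G) ∈ ({1, c} : Set G) := by
      rintro ⟨_, x, rfl⟩
      exact hP x
    refine le_trans (Nat.card_le_card_of_injective
      (fun y : S.range => (⟨(y : P), h1 y⟩ : ({1, c} : Set G))) ?_) ?_
    · intro x y h
      rw [Subtype.mk.injEq] at h
      exact Subtype.ext (Subtype.ext h)
    · exact ncard_pair_le 1 c
  have hmul : Nat.card P = Nat.card S.range * Nat.card S.ker := by
    rw [Subgroup.card_eq_card_quotient_mul_card_subgroup S.ker,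
      Nat.card_congr (QuotientGroup.quotientKerEquivRange S).toEquiv]
  have h8 := Nat.le_of_dvd Nat.card_pos (eight_dvd_card_sylow hG P)
  have hr2 : Nat.card S.range = 2 := by nlinarith
  have hk4 : Nat.card S.ker = 4 := by nlinarith
  have h8' : Nat.card P = 8 := by rw [hmul, hr2, hk4]
  obtain ⟨g, hg⟩ : ∃ g : P, g ^ 2 ≠ 1 := by
    by_contra! h
    have : Subsingleton S.range := by
      refine ⟨?_⟩
      rintro ⟨_, x, rfl⟩ ⟨_, y, rfl⟩
      exact Subtype.ext ((h x).trans (h y).symm)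
    have := Nat.card_of_subsingleton (1 : S.range)
    omega
  have hgc : (g : G) ^ 2 = c := (hP g).resolve_left fun h => hg (Subtype.ext h)
  have hg4 : g ^ 4 = 1 := by
    apply Subtype.ext
    change (g : G) ^ 4 = 1
    rw [show 4 = 2 * 2 by norm_num, pow_mul, hgc, hc]
  obtain ⟨y, hy, hy0, hyg⟩ : ∃ y : P, y ^ 2 = 1 ∧ y ≠ 1 ∧ y ≠ g ^ 2 := by
    by_contra! h
    have h1 : (S.ker : Set P) ⊆ {1, g ^ 2} := by
      intro y hy
      by_cases hy1 : y = 1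
      · exact Or.inl hy1
      · exact Or.inr (h y hy hy1)
    have h2 := (Set.ncard_le_ncard h1).trans (ncard_pair_le 1 (g ^ 2))
    have h3 : (S.ker : Set P).ncard = 4 := hk4
    omega
  exact nonempty_addEquiv_of_order_four (H := Additive P) h8' (x := Additive.ofMul g)
    (y := Additive.ofMul y) hg hg4 hy hy0 hyg

end TwoGroups

section

variable {q : Fin 4 → GaussianInt} {a t u : ZMod 2}
variable {F : Type*} [Field F] [NumberField F] [Algebra GaussianInt F]
  [IsFractionRing GaussianInt F]
variable {K₁ : Type*} [Field K₁] [NumberField K₁] [Algebra F K₁]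
  [Algebra.IsQuadraticExtension F K₁]
variable {K₂ : Type*} [Field K₂] [NumberField K₂] [Algebra F K₂]
  [Algebra.IsQuadraticExtension F K₂]
variable {K₃ : Type*} [Field K₃] [NumberField K₃] [Algebra F K₃]
  [Algebra.IsQuadraticExtension F K₃]
variable {L : Type*} [Field L] [NumberField L] [Algebra F L]
  [Algebra K₁ L] [IsScalarTower F K₁ L] [Algebra.IsQuadraticExtension K₁ L]
  [Algebra K₂ L] [IsScalarTower F K₂ L] [Algebra.IsQuadraticExtension K₂ L]
  [Algebra K₃ L] [IsScalarTower F K₃ L] [Algebra.IsQuadraticExtension K₃ L]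
variable {s₁ : K₁} {s₂ : K₂} {s₃ : K₃}

namespace BiquadField

include F

theorem nonempty_sylow_addEquiv_of_eq_one
    (Q : BiquadField F K₁ K₂ K₃ L q a t u s₁ s₂ s₃) (ha : a = 1)
    (P : Sylow 2 (ClassGroup (𝓞 L))) :
    Nonempty (Additive P ≃+ (ZMod 2 × ZMod 2 × ZMod 2)) := by
  obtain ⟨c, hc⟩ := Q.exists_rootClass
  refine nonempty_sylow_addEquiv_of_sq_ne Q.eight_dvd_card (fun d n => Q.sq_eq_one_or hc)
    (Q.sq_ne ha hc) (Q.card_sq_eq_one_le.trans ?_) P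
  subst ha
  exact card_label_of_eq_one t u

theorem nonempty_sylow_addEquiv_of_eq_zero
    (Q : BiquadField F K₁ K₂ K₃ L q a t u s₁ s₂ s₃) (ha : a = 0)
    (P : Sylow 2 (ClassGroup (𝓞 L))) : Nonempty (Additive P ≃+ (ZMod 2 × ZMod 4)) := by
  obtain ⟨c, hc⟩ := Q.exists_rootClass
  refine _root_.nonempty_sylow_addEquiv hc.sq_eq_one Q.eight_dvd_card
    (fun d n => Q.sq_eq_one_or hc) (Q.card_sq_eq_one_le.trans ?_) P
  subst ha
  exact card_label_of_eq_zero t u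

end BiquadField

end

section Construction

/-- Gaussian integers as pairs of integers. -/
def gaussianIntEquiv : GaussianInt ≃ₗ[ℤ] ℤ × ℤ where
  toFun z := (z.re, z.im)
  invFun z := ⟨z.1, z.2⟩
  left_inv _ := rfl
  right_inv _ := rfl
  map_add' _ _ := rfl
  map_smul' n z := by
    rw [zsmul_eq_mul, ← zsmul_eq_mul]
    simp

instance : Module.Finite ℤ GaussianInt := Module.Finite.equiv gaussianIntEquiv.symm

theorem finrank_gaussian (F : Type*) [Field F] [NumberField F] [Algebra GaussianInt F]
    [IsFractionRing GaussianInt F] : Module.finrank ℚ F = 2 := by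
  have h1 := gaussianIntEquiv.finrank_eq
  rw [Module.finrank_prod, Module.finrank_self] at h1
  exact (IsFractionRing.finrank_eq ℤ ℚ GaussianInt F).trans h1

theorem numberField_of_isFractionRing (F : Type*) [Field F] [CharZero F] [Algebra GaussianInt F]
    [IsFractionRing GaussianInt F] : NumberField F where
  to_finiteDimensional := Module.Finite.of_isLocalization ℤ GaussianInt (nonZeroDivisors ℤ)

instance : NumberField (FractionRing GaussianInt) := numberField_of_isFractionRing _

theorem finrank_adjoin_sqrt {E L : Type*} [Field E] [Field L] [Algebra E L] {s : L} {d : E}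
    (hs : s ^ 2 = algebraMap E L d) (hs' : ∀ y, algebraMap E L y ≠ s) :
    Module.finrank E E⟮s⟯ = 2 := by
  have hroot : Polynomial.aeval s (Polynomial.X ^ 2 - Polynomial.C d) = 0 := by
    simp [hs]
  have hmonic : (Polynomial.X ^ 2 - Polynomial.C d).Monic := Polynomial.monic_X_pow_sub_C d two_ne_zero
  have hint : IsIntegral E s := ⟨_, hmonic, hroot⟩
  rw [adjoin.finrank hint]
  apply le_antisymm
  · refine (Polynomial.natDegree_le_of_dvd (minpoly.dvd E s hroot) hmonic.ne_zero).trans ?_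
    rw [Polynomial.natDegree_X_pow_sub_C]
  · rw [minpoly.two_le_natDegree_iff hint]
    rintro ⟨y, hy⟩
    exact hs' y hy

variable {q : Fin 4 → GaussianInt} {a t u : ZMod 2}
variable {F : Type*} [Field F] [NumberField F] [Algebra GaussianInt F]
  [IsFractionRing GaussianInt F]
variable {L : Type*} [Field L] [NumberField L] [Algebra F L]

include F

theorem PrimeData.algebraMap_ne (H : PrimeData q a t u) {v : Fin 6 → ZMod 2} (hv : v ≠ 0)
    {s : L} (hs : s ^ 2 = algebraMap F L (gaussEl F q v)) (y : F) : algebraMap F L y ≠ s := by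
  rintro rfl
  rw [← map_pow] at hs
  have h := FaithfulSMul.algebraMap_injective F L hs
  refine hv (H.eq_zero_of_sqEquiv_one (F := F) ⟨y, ?_, by rw [one_mul, h]⟩)
  rintro rfl
  exact H.gaussEl_ne_zero v (h.symm.trans (zero_pow two_ne_zero))

theorem PrimeData.algebraMap_adjoin_ne (H : PrimeData q a t u) {v v' : Fin 6 → ZMod 2}
    (hv : v ≠ 0) (hv' : v' ≠ 0) (hvv' : v ≠ v') {s s' : L}
    (hs : s ^ 2 = algebraMap F L (gaussEl F q v))
    (hs' : s' ^ 2 = algebraMap F L (gaussEl F q v')) (y : F⟮s⟯) : algebraMap F⟮s⟯ L y ≠ s' := by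
  have hinj := FaithfulSMul.algebraMap_injective F L
  have : Algebra.IsQuadraticExtension F F⟮s⟯ :=
    { finrank_eq_two' := finrank_adjoin_sqrt hs (H.algebraMap_ne hv hs) }
  have hgen : (AdjoinSimple.gen F s) ^ 2 = algebraMap F F⟮s⟯ (gaussEl F q v) := by
    apply FaithfulSMul.algebraMap_injective F⟮s⟯ L
    rw [map_pow, AdjoinSimple.algebraMap_gen, hs, ← IsScalarTower.algebraMap_apply]
  rintro rfl
  obtain ⟨α, β, rfl, -⟩ := exists_coords hgen (H.algebraMap_ne hv hgen) y
  simp only [map_add, map_mul, AdjoinSimple.algebraMap_gen, ← IsScalarTower.algebraMap_apply]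
    at hs'
  have hne := H.algebraMap_ne hv hs
  have h2 : algebraMap F L (α ^ 2 + β ^ 2 * gaussEl F q v - gaussEl F q v') =
      algebraMap F L (- (2 * α * β)) * s := by
    simp only [map_sub, map_add, map_mul, map_pow, map_neg, map_ofNat]
    rw [← hs, ← hs']
    ring
  have h3 : 2 * α * β = 0 := by
    by_contra h0
    apply hne ((α ^ 2 + β ^ 2 * gaussEl F q v - gaussEl F q v') / (- (2 * α * β)))
    have h0' := (map_ne_zero_iff _ hinj).2 (neg_ne_zero.2 h0)
    rw [map_div₀, div_eq_iff h0', h2, mul_comm]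
  rw [h3, neg_zero, map_zero, zero_mul, map_eq_zero_iff _ hinj, sub_eq_zero] at h2
  rcases mul_eq_zero.1 h3 with h3 | rfl
  · have hα : α = 0 := (mul_eq_zero.1 h3).resolve_left two_ne_zero
    subst hα
    have hβ : β ≠ 0 := by
      rintro rfl
      exact H.gaussEl_ne_zero v' (by rw [← h2]; ring)
    exact hvv' (H.eq_of_sqEquiv (F := F) ⟨β, hβ, by rw [← h2]; ring⟩).symm
  · have hα : α ≠ 0 := by
      rintro rfl
      exact H.gaussEl_ne_zero v' (by rw [← h2]; ring)
    exact hv' (H.eq_zero_of_sqEquiv_one (F := F) ⟨α, hα, by rw [← h2]; ring⟩)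

theorem isQuadraticExtension_of_forall {s : L} (K : IntermediateField F L) {d : K}
    (htop : ∀ M : IntermediateField F L, K ≤ M → s ∈ M → M = ⊤)
    (hs : s ^ 2 = algebraMap K L d) (hs' : ∀ y, algebraMap K L y ≠ s) :
    Algebra.IsQuadraticExtension K L := by
  have h : K⟮s⟯ = ⊤ := by
    have h1 := htop (K⟮s⟯.restrictScalars F) (fun x hx => K⟮s⟯.algebraMap_mem ⟨x, hx⟩)
      (mem_adjoin_simple_self K s)
    exact restrictScalars_injective F (h1.trans (restrictScalars_top (K := F)).symm)
  refine { finrank_eq_two' := ?_ }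
  rw [← finrank_top', ← h]
  exact finrank_adjoin_sqrt hs hs'

end Construction

section BiquadConstruction

variable {q : Fin 4 → GaussianInt} {a t u : ZMod 2}

theorem gaussProd_radOne : gaussProd q radOne = q 0 * q 2 := by
  simp [gaussProd, radOne, gaussGen, Fin.prod_univ_succ, ZMod.val_one]

theorem gaussProd_radTwo : gaussProd q radTwo = ⟨0, 1⟩ * (q 1 * q 3) := by
  simp [gaussProd, radTwo, gaussGen, Fin.prod_univ_succ, ZMod.val_one]

theorem gaussProd_radThree : gaussProd q radThree = ⟨0, 1⟩ * (q 0 * q 1 * (q 2 * q 3)) := by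
  simp [gaussProd, radThree, gaussGen, Fin.prod_univ_succ, ZMod.val_one, mul_assoc]

theorem PrimeData.exists_sq_sub_radOne (H : PrimeData q a t u) :
    ∃ r : GaussianInt, 4 ∣ r ^ 2 - gaussProd q radOne := by
  rw [gaussProd_radOne]
  rcases H.mod_four_mul with h | h
  · exact ⟨1, by rw [one_pow, ← neg_sub]; exact (dvd_neg.2 h)⟩
  · refine ⟨⟨0, 1⟩, ?_⟩
    rw [show (⟨0, 1⟩ : GaussianInt) ^ 2 = -1 by decide, ← neg_add', add_comm]
    exact dvd_neg.2 h

variable {F : Type*} [Field F] [NumberField F] [Algebra GaussianInt F]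
  [IsFractionRing GaussianInt F]
variable {L : Type*} [Field L] [NumberField L] [Algebra F L]

theorem gaussEl_radThree : gaussEl F q radThree = gaussEl F q radOne * gaussEl F q radTwo := by
  rw [gaussEl, gaussEl, gaussEl, ← map_mul, gaussProd_radOne, gaussProd_radTwo,
    gaussProd_radThree]
  congr 1
  ring

theorem finrank_eq_four (K : IntermediateField F L) [Algebra.IsQuadraticExtension F K] :
    Module.finrank ℚ K = 4 := by
  rw [← Module.finrank_mul_finrank ℚ F K, finrank_gaussian,
    Algebra.IsQuadraticExtension.finrank_eq_two]

theorem gen_sq {v : Fin 6 → ZMod 2} {s : L} (hs : s ^ 2 = algebraMap F L (gaussEl F q v)) :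
    (AdjoinSimple.gen F s) ^ 2 = algebraMap F F⟮s⟯ (gaussEl F q v) := by
  apply FaithfulSMul.algebraMap_injective F⟮s⟯ L
  rw [map_pow, AdjoinSimple.algebraMap_gen, hs, ← IsScalarTower.algebraMap_apply]

theorem PrimeData.quadField (H : PrimeData q a t u) {v : Fin 6 → ZMod 2} {B : Finset (Fin 6)}
    {s : L} (hs : s ^ 2 = algebraMap F L (gaussEl F q v)) (hv : v ≠ 0)
    (hB : ∀ k ∉ B, v k = 0) (hB0 : 0 ∈ B)
    (hr : 1 ∈ B ∨ ∃ r : GaussianInt, 4 ∣ r ^ 2 - gaussProd q v)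
    (hz : ¬ HilbZero a t u v (Pi.single 0 1))
    (hsmall : ∃ k₀ k₁ : Fin 6, ∀ w : Fin 6 → ZMod 2, (∀ k ∉ B, w k = 0) → HilbUnit a t u v w →
      w k₀ = w k₁ → w = 0 ∨ w = Pi.single 0 1 ∨ w = v ∨ w = Pi.single 0 1 + v) :
    QuadField F F⟮s⟯ q a t u v B (AdjoinSimple.gen F s) := by
  have hgen := gen_sq hs
  have hne := H.algebraMap_ne hv hgen
  have : Algebra.IsQuadraticExtension F F⟮s⟯ :=
    { finrank_eq_two' := finrank_adjoin_sqrt hs (H.algebraMap_ne hv hs) }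
  have hB' : ∀ k, v k ≠ 0 → k ∈ B := fun k hk => by
    by_contra h
    exact hk (hB k h)
  have hrad : GoodRad F F q B := (goodRad_self).mono (Finset.empty_subset _)
  refine ⟨hgen, hne, ?_, hB0, hB, hz, hsmall, ?_⟩
  · rcases hr with hr | ⟨r, hr⟩
    · exact hrad.sqrt hr hB' hgen hne
    · exact hrad.sqrt_of_sq_mod_four hB' hr hgen hne
  · have h1 := two_mul_rank_add_one (E := F⟮s⟯) (i := algebraMap F _ (gaussI F))
      (by rw [← map_pow, gaussI_sq, map_neg, map_one])
    rw [finrank_eq_four] at h1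
    omega

theorem PrimeData.isQuadraticExtension (H : PrimeData q a t u) {v v' : Fin 6 → ZMod 2}
    (hv : v ≠ 0) (hv' : v' ≠ 0) (hvv' : v ≠ v') {s s' : L}
    (hs : s ^ 2 = algebraMap F L (gaussEl F q v))
    (hs' : s' ^ 2 = algebraMap F L (gaussEl F q v'))
    (htop : ∀ M : IntermediateField F L, s ∈ M → s' ∈ M → M = ⊤) :
    Algebra.IsQuadraticExtension F⟮s⟯ L := by
  refine isQuadraticExtension_of_forall (s := s') F⟮s⟯ (d := algebraMap F _ (gaussEl F q v'))
    (fun M hM hM' => htop M (hM (mem_adjoin_simple_self F s)) hM') ?_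
    (H.algebraMap_adjoin_ne hv hv' hvv' hs hs')
  rw [hs', ← IsScalarTower.algebraMap_apply]

/-- The two alternatives for the Sylow `2`-subgroup of the class group of `F(s₁, s₂)`. -/
theorem PrimeData.nonempty_sylow_addEquiv (H : PrimeData q a t u) {s₁ s₂ : L}
    (hs₁ : s₁ ^ 2 = algebraMap F L (gaussEl F q radOne))
    (hs₂ : s₂ ^ 2 = algebraMap F L (gaussEl F q radTwo))
    (htop : ∀ M : IntermediateField F L, s₁ ∈ M → s₂ ∈ M → M = ⊤)
    (P : Sylow 2 (ClassGroup (𝓞 L))) :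
    (a = 1 → Nonempty (Additive P ≃+ (ZMod 2 × ZMod 2 × ZMod 2))) ∧
      (a = 0 → Nonempty (Additive P ≃+ (ZMod 2 × ZMod 4))) := by
  have hs₃ : (s₁ * s₂) ^ 2 = algebraMap F L (gaussEl F q radThree) := by
    rw [mul_pow, hs₁, hs₂, gaussEl_radThree, map_mul]
  have h₁ : radOne ≠ 0 := by decide
  have h₂ : radTwo ≠ 0 := by decide
  have h₃ : radThree ≠ 0 := by decide
  have h12 : radOne ≠ radTwo := by decide
  have h31 : radThree ≠ radOne := by decide
  have hs1 : s₁ ≠ 0 := by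
    rintro rfl
    exact H.algebraMap_ne h₁ hs₁ 0 (map_zero _)
  have : Algebra.IsQuadraticExtension F F⟮s₁⟯ :=
    { finrank_eq_two' := finrank_adjoin_sqrt hs₁ (H.algebraMap_ne h₁ hs₁) }
  have : Algebra.IsQuadraticExtension F F⟮s₂⟯ :=
    { finrank_eq_two' := finrank_adjoin_sqrt hs₂ (H.algebraMap_ne h₂ hs₂) }
  have : Algebra.IsQuadraticExtension F F⟮s₁ * s₂⟯ :=
    { finrank_eq_two' := finrank_adjoin_sqrt hs₃ (H.algebraMap_ne h₃ hs₃) }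
  have : Algebra.IsQuadraticExtension F⟮s₁⟯ L :=
    H.isQuadraticExtension h₁ h₂ h12 hs₁ hs₂ htop
  have : Algebra.IsQuadraticExtension F⟮s₂⟯ L :=
    H.isQuadraticExtension h₂ h₁ h12.symm hs₂ hs₁ fun M h h' => htop M h' h
  have : Algebra.IsQuadraticExtension F⟮s₁ * s₂⟯ L :=
    H.isQuadraticExtension h₃ h₁ h31 hs₃ hs₁ fun M h h' => htop M h' (by
      have := M.mul_mem (M.inv_mem h') h
      rwa [inv_mul_cancel_left₀ hs1] at this)
  have Q : BiquadField F F⟮s₁⟯ F⟮s₂⟯ F⟮s₁ * s₂⟯ L q a t u (AdjoinSimple.gen F s₁)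
      (AdjoinSimple.gen F s₂) (AdjoinSimple.gen F (s₁ * s₂)) := by
    refine ⟨H, H.quadField hs₁ h₁ (by decide) (by decide) (.inr H.exists_sq_sub_radOne)
        (not_hilbZero_radOne a t u) ⟨2, 4, small_radOne a t u⟩,
      H.quadField hs₂ h₂ (by decide) (by decide) (.inl (by decide))
        (not_hilbZero_radTwo a t u) ⟨1, 2, small_radTwo a t u⟩,
      H.quadField hs₃ h₃ (by simp) (by simp) (.inl (by simp))
        (not_hilbZero_radThree a t u) ⟨2, 3, fun v _ => small_radThree a t u v⟩, ?_, ?_, ?_⟩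
    · simp only [AdjoinSimple.algebraMap_gen]
    · rw [AdjoinSimple.algebraMap_gen]
      exact H.algebraMap_adjoin_ne h₁ h₂ h12 hs₁ hs₂
    · have h1 := two_mul_rank_add_one (E := L) (i := algebraMap F _ (gaussI F))
        (by rw [← map_pow, gaussI_sq, map_neg, map_one])
      rw [← Module.finrank_mul_finrank ℚ F⟮s₁⟯ L, finrank_eq_four,
        Algebra.IsQuadraticExtension.finrank_eq_two] at h1
      omega
  exact ⟨fun ha => Q.nonempty_sylow_addEquiv_of_eq_one ha P,
    fun ha => Q.nonempty_sylow_addEquiv_of_eq_zero ha P⟩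

end BiquadConstruction

section Embedding

theorem isSquare_mk_iff {q : Fin 4 → GaussianInt} {a t u : ZMod 2} (H : PrimeData q a t u)
    {j : Fin 4} {x : GaussianInt} (hx : ¬ q j ∣ x) :
    IsSquare (Ideal.Quotient.mk (Ideal.span {q j}) x) ↔ resid (q j) x = 0 := by
  constructor
  · rintro ⟨y, hy⟩
    obtain ⟨r, rfl⟩ := Ideal.Quotient.mk_surjective y
    rw [← map_mul, eq_comm, Ideal.Quotient.eq, Ideal.mem_span_singleton, ← pow_two] at hy
    exact H.resid_eq_zero_of_sq hx hy
  · rw [resid_eq_zero_iff]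
    rintro ⟨r, hr⟩
    refine ⟨Ideal.Quotient.mk _ (r : GaussianInt), ?_⟩
    rw [← map_mul, eq_comm, Ideal.Quotient.eq, Ideal.mem_span_singleton]
    convert hr using 2
    ext <;> simp [pow_two]

theorem sqrt_relation {w s I d : ℂ} {p₁ p₂ : ℂ} (hI : I ^ 2 = -1) (hd : d ^ 2 = 2 * p₁ * p₂)
    {A B A' B' : ℂ} (hw : w ^ 2 = A * B) (hA : A * A' = p₁) (hB : B * B' = p₂) (hw0 : w ≠ 0)
    (hs : s = I * d / ((1 + I) * w)) (hI1 : 1 + I ≠ 0) : s ^ 2 = I * (A' * B') := by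
  have h : (1 + I) ^ 2 * (w ^ 2 * (s ^ 2 - I * (A' * B'))) = 0 := by
    have h1 : s * ((1 + I) * w) = I * d := by
      rw [hs, div_mul_cancel₀ _ (mul_ne_zero hI1 hw0)]
    have h2 : (1 + I) ^ 2 = 2 * I := by linear_combination hI
    have h3 : (s * ((1 + I) * w)) ^ 2 = (I * d) ^ 2 := by rw [h1]
    calc (1 + I) ^ 2 * (w ^ 2 * (s ^ 2 - I * (A' * B')))
        = (s * ((1 + I) * w)) ^ 2 - (1 + I) ^ 2 * I * (A' * B') * w ^ 2 := by ring
      _ = I ^ 2 * d ^ 2 - 2 * I ^ 2 * (A * A') * (B * B') := by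
        rw [h3, h2, hw]
        ring
      _ = 0 := by
        rw [hA, hB, hd]
        ring
  have h' := (mul_eq_zero.1 h).resolve_left (pow_ne_zero 2 hI1)
  exact sub_eq_zero.1 ((mul_eq_zero.1 h').resolve_left (pow_ne_zero 2 hw0))

end Embedding

/-- Assume `p₁` is a quadratic residue mod `p₂`.  Let
`K₄ = 𝕜(√(π₁π₃))` be the extension of `𝕜 = ℚ(√(2p₁p₂), i)` generated by a square root `w` of
`π₁π₃ = (e + 2if)(g + 2ih)`.  If `π₁` is not a square in the residue field `ℤ[i]/(π₃)`, then
`Cl₂(K₄) ≃ ℤ/2ℤ × ℤ/2ℤ × ℤ/2ℤ`; if `π₁` is a square in `ℤ[i]/(π₃)`, then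
`Cl₂(K₄) ≃ ℤ/2ℤ × ℤ/4ℤ`. -/
theorem stmt_17 (p₁ p₂ : ℕ) (hp₁ : p₁.Prime) (hp₂ : p₂.Prime) (hne : p₁ ≠ p₂)
    (hm₁ : p₁ % 8 = 5) (hm₂ : p₂ % 8 = 5)
    (e f g h : ℤ) (hef : (p₁ : ℤ) = e ^ 2 + 4 * f ^ 2) (hgh : (p₂ : ℤ) = g ^ 2 + 4 * h ^ 2)
    (hQR : IsSquare ((p₁ : ZMod p₂)))
    (w : ℂ) (hw : w ^ 2 = ((e : ℂ) + 2 * f * Complex.I) * ((g : ℂ) + 2 * h * Complex.I))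
    (K₄ : IntermediateField ℚ ℂ)
    (hK₄ : K₄ = ℚ⟮((Real.sqrt (2 * (p₁ : ℝ) * p₂) : ℝ) : ℂ), Complex.I, w⟯)
    [NumberField K₄] :
    (¬ IsSquare (Ideal.Quotient.mk (Ideal.span {(⟨g, 2 * h⟩ : GaussianInt)})
        (⟨e, 2 * f⟩ : GaussianInt)) →
      ∀ P : Sylow 2 (ClassGroup (RingOfIntegers K₄)),
        Nonempty (Additive P ≃+ (ZMod 2 × ZMod 2 × ZMod 2))) ∧
    (IsSquare (Ideal.Quotient.mk (Ideal.span {(⟨g, 2 * h⟩ : GaussianInt)})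
        (⟨e, 2 * f⟩ : GaussianInt)) →
      ∀ P : Sylow 2 (ClassGroup (RingOfIntegers K₄)),
        Nonempty (Additive P ≃+ (ZMod 2 × ZMod 4))) := by
  have H := SumSq.primeData ⟨hp₁, hm₁, hef⟩ ⟨hp₂, hm₂, hgh⟩ hne hQR
  set q : Fin 4 → GaussianInt := ![⟨e, 2 * f⟩, ⟨e, 2 * -f⟩, ⟨g, 2 * h⟩, ⟨g, 2 * -h⟩] with hq
  have hsquare := isSquare_mk_iff H (H.not_dvd 2 0 (by decide))
  change IsSquare (Ideal.Quotient.mk (Ideal.span {(⟨g, 2 * h⟩ : GaussianInt)})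
    (⟨e, 2 * f⟩ : GaussianInt)) ↔ resid ⟨g, 2 * h⟩ ⟨e, 2 * f⟩ = 0 at hsquare
  set d : ℂ := ((Real.sqrt (2 * (p₁ : ℝ) * p₂) : ℝ) : ℂ) with hd
  have hd2 : d ^ 2 = 2 * p₁ * p₂ := by
    rw [hd, ← Complex.ofReal_pow, Real.sq_sqrt (by positivity)]
    push_cast
    rfl
  have hdmem : d ∈ K₄ := hK₄ ▸ subset_adjoin ℚ _ (by simp)
  have hImem : Complex.I ∈ K₄ := hK₄ ▸ subset_adjoin ℚ _ (by simp)
  have hwmem : w ∈ K₄ := hK₄ ▸ subset_adjoin ℚ _ (by simp)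
  have hI1 : 1 + Complex.I ≠ 0 := by
    intro h0
    have := congrArg Complex.re h0
    simp at this
  have hA : ((e : ℂ) + 2 * f * Complex.I) * ((e : ℂ) - 2 * f * Complex.I) = p₁ := by
    have : (p₁ : ℂ) = e ^ 2 + 4 * f ^ 2 := by exact_mod_cast congrArg (Int.cast : ℤ → ℂ) hef
    rw [this]
    linear_combination -4 * (f : ℂ) ^ 2 * Complex.I_sq
  have hB : ((g : ℂ) + 2 * h * Complex.I) * ((g : ℂ) - 2 * h * Complex.I) = p₂ := by
    have : (p₂ : ℂ) = g ^ 2 + 4 * h ^ 2 := by exact_mod_cast congrArg (Int.cast : ℤ → ℂ) hgh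
    rw [this]
    linear_combination -4 * (h : ℂ) ^ 2 * Complex.I_sq
  have hw0 : w ≠ 0 := by
    rintro rfl
    have h1 : (p₁ : ℂ) * p₂ = 0 := by
      rw [← hA, ← hB]
      linear_combination -((e : ℂ) - 2 * f * Complex.I) * ((g : ℂ) - 2 * h * Complex.I) * hw
    exact mul_ne_zero (Nat.cast_ne_zero.2 hp₁.ne_zero) (Nat.cast_ne_zero.2 hp₂.ne_zero) h1
  let i : K₄ := ⟨Complex.I, hImem⟩
  let s₁ : K₄ := ⟨w, hwmem⟩
  let δ : K₄ := ⟨d, hdmem⟩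
  let s₂ : K₄ := i * δ / ((1 + i) * s₁)
  have hi : i * i = ((-1 : ℤ) : K₄) := Subtype.ext (by simp [i])
  let ψ : GaussianInt →+* K₄ := Zsqrtd.lift ⟨i, hi⟩
  have hψ : ∀ z : GaussianInt, ((ψ z : K₄) : ℂ) = z.re + z.im * Complex.I := fun z => by
    simp [ψ, i]
  have hinj : Function.Injective ψ := Zsqrtd.lift_injective _ fun n hn => by nlinarith
  letI : Algebra (FractionRing GaussianInt) K₄ := (IsFractionRing.lift hinj).toAlgebra
  have halg : ∀ z, algebraMap (FractionRing GaussianInt) K₄ (algebraMap GaussianInt _ z) = ψ z :=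
    fun z => IsFractionRing.lift_algebraMap hinj z
  have hs₁ : s₁ ^ 2 = algebraMap (FractionRing GaussianInt) K₄ (gaussEl _ q radOne) := by
    rw [gaussEl, halg, gaussProd_radOne, map_mul]
    apply Subtype.ext
    simp [s₁, hq, hψ, hw]
  have hs₂ : s₂ ^ 2 = algebraMap (FractionRing GaussianInt) K₄ (gaussEl _ q radTwo) := by
    rw [gaussEl, halg, gaussProd_radTwo, map_mul, map_mul]
    apply Subtype.ext
    have h1 := sqrt_relation (s := (s₂ : ℂ)) Complex.I_sq hd2 hw hA hB hw0
      (by simp [s₂, i, δ, s₁]) hI1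
    simp only [MulMemClass.coe_mul, hψ]
    simp [h1, hq, ← sub_eq_add_neg]
  have htop : ∀ M : IntermediateField (FractionRing GaussianInt) K₄, s₁ ∈ M → s₂ ∈ M →
      M = ⊤ := by
    intro M h1 h2
    have hiM : i ∈ M := by
      have := M.algebraMap_mem (algebraMap GaussianInt _ ⟨0, 1⟩)
      rw [halg] at this
      convert this
      apply Subtype.ext
      simp [hψ, i]
    have hi0 : i ≠ 0 := fun h0 => Complex.I_ne_zero (congrArg Subtype.val h0)
    have hδM : δ ∈ M := by
      have h3 := M.div_mem (M.mul_mem (M.mul_mem (M.add_mem M.one_mem hiM) h1) h2) hiM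
      have h4 : (1 + i) * s₁ ≠ 0 := mul_ne_zero
        (fun h0 => hI1 (congrArg Subtype.val h0)) (fun h0 => hw0 (congrArg Subtype.val h0))
      rwa [mul_div_cancel₀ _ h4, mul_div_cancel_left₀ _ hi0] at h3
    have : IsScalarTower ℚ (FractionRing GaussianInt) K₄ :=
      IsScalarTower.of_algebraMap_eq' (Subsingleton.elim _ _)
    have hle : K₄ ≤ lift (M.restrictScalars ℚ) := by
      refine hK₄.le.trans (adjoin_le_iff.2 ?_)
      rintro x (rfl | rfl | rfl)
      · exact (mem_lift δ).2 hδM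
      · exact (mem_lift i).2 hiM
      · exact (mem_lift s₁).2 h1
    rw [eq_top_iff]
    intro x _
    exact (mem_lift x).1 (hle x.2)
  have two : ∀ x : ZMod 2, x ≠ 0 → x = 1 := by decide
  rw [hsquare]
  exact ⟨fun ha P => (H.nonempty_sylow_addEquiv hs₁ hs₂ htop P).1 (two _ ha),
    fun ha P => (H.nonempty_sylow_addEquiv hs₁ hs₂ htop P).2 ha⟩
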